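/- Let k be a fixed nonzero integer, p a prime, λ an integer coprime to p, and ε > 0 fixed. If p > N > p^(63/76+ε), then the number of triples of primes (p₁, p₂, p₃) with p₁, p₂, p₃ ≤ N satisfying p₁p₂(p₃+k) ≡ λ (mod p) equals (1 + o(1))·π(N)³/p as p → ∞. -/

import Mathlib

section
open Finset ComplexConjugate

theorem sum_weighted_normSq {α ι : Type*} (X : Finset α) (w : α → ℝ) (s : Finset ι) (a : ι → ℂ)
    (f : ι → α → ℂ) :
    ((∑ x ∈ X, w x * ‖∑ i ∈ s, a i * f i x‖ ^ 2 : ℝ) : ℂ) =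
      ∑ i ∈ s, ∑ j ∈ s, a i * conj (a j) * ∑ x ∈ X, (w x : ℂ) * (f i x * conj (f j x)) := by
  have h (x : α) : ((w x * ‖∑ i ∈ s, a i * f i x‖ ^ 2 : ℝ) : ℂ) =
      ∑ i ∈ s, ∑ j ∈ s, a i * conj (a j) * ((w x : ℂ) * (f i x * conj (f j x))) := by
    push_cast
    rw [← Complex.mul_conj', map_sum, sum_mul_sum, mul_sum]
    refine sum_congr rfl fun i _ => ?_
    rw [mul_sum]
    refine sum_congr rfl fun j _ => ?_
    rw [map_mul]; ring
  rw [Complex.ofReal_sum, sum_congr rfl fun x _ => h x, sum_comm]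
  refine sum_congr rfl fun i _ => ?_
  rw [sum_comm]
  refine sum_congr rfl fun j _ => ?_
  rw [mul_sum]

theorem sum_normSq {α ι : Type*} (X : Finset α) (s : Finset ι) (a : ι → ℂ)
    (f : ι → α → ℂ) :
    ((∑ x ∈ X, ‖∑ i ∈ s, a i * f i x‖ ^ 2 : ℝ) : ℂ) =
      ∑ i ∈ s, ∑ j ∈ s, a i * conj (a j) * ∑ x ∈ X, f i x * conj (f j x) := by
  simpa using sum_weighted_normSq X (fun _ => 1) s a f

section characters
variable {p : ℕ} [Fact p.Prime]

omit [Fact p.Prime] in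
theorem norm_char_le_one (χ : DirichletCharacter ℂ p) (a : ZMod p) : ‖χ a‖ ≤ 1 :=
  DirichletCharacter.norm_le_one χ a

theorem char_norm_eq_one (χ : DirichletCharacter ℂ p) {a : ZMod p} (ha : a ≠ 0) : ‖χ a‖ = 1 := by
  obtain ⟨u, rfl⟩ := ha.isUnit
  exact χ.unit_norm_eq_one u

theorem conj_char (χ : DirichletCharacter ℂ p) (a : ZMod p) : conj (χ a) = χ a⁻¹ := by
  have := MulChar.star_apply' χ a
  rw [MulChar.inv_apply'] at this
  exact this

theorem sum_char_mul_conj (a b : ZMod p) :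
    ∑ χ : DirichletCharacter ℂ p, χ a * conj (χ b) =
      if a = b ∧ a ≠ 0 then ((p : ℂ) - 1) else 0 := by
  have hp : p.Prime := Fact.out
  by_cases hb : b = 0
  · subst hb
    have : ¬ (a = 0 ∧ a ≠ 0) := by tauto
    rw [if_neg this]
    exact sum_eq_zero fun χ _ => by rw [MulChar.map_zero χ, map_zero, mul_zero]
  · have := DirichletCharacter.sum_char_inv_mul_char_eq ℂ (n := p) (a := b) (Ne.isUnit hb) a
    rw [sum_congr rfl fun χ _ => by rw [conj_char, mul_comm], this]
    by_cases hab : b = a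
    · subst hab
      rw [if_pos rfl, if_pos ⟨rfl, hb⟩, Nat.totient_prime hp, Nat.cast_sub hp.one_lt.le]; simp
    · rw [if_neg hab, if_neg (by tauto)]

theorem sum_char_normSq {ι : Type*} (s : Finset ι) (a : ι → ℂ) (f : ι → ZMod p) :
    ((∑ χ : DirichletCharacter ℂ p, ‖∑ i ∈ s, a i * χ (f i)‖ ^ 2 : ℝ) : ℂ) =
      (p - 1) * ∑ i ∈ s, ∑ j ∈ s, if f i = f j ∧ f i ≠ 0 then a i * conj (a j) else 0 := by
  rw [sum_normSq univ s a fun i (χ : DirichletCharacter ℂ p) => χ (f i), mul_sum]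
  refine sum_congr rfl fun i _ => ?_
  rw [mul_sum]
  refine sum_congr rfl fun j _ => ?_
  rw [sum_char_mul_conj]
  split_ifs <;> ring

theorem one_le_p_real : (0:ℝ) ≤ (p:ℝ) - 1 := by
  have hp : p.Prime := Fact.out
  have : (1:ℝ) ≤ p := by exact_mod_cast hp.one_lt.le
  linarith

theorem sum_char_normSq_le {ι : Type*} (s : Finset ι) (a : ι → ℂ) (f : ι → ZMod p) :
    ∑ χ : DirichletCharacter ℂ p, ‖∑ i ∈ s, a i * χ (f i)‖ ^ 2 ≤
      (p - 1) * ∑ i ∈ s, ∑ j ∈ s, if f i = f j ∧ f i ≠ 0 then ‖a i‖ * ‖a j‖ else 0 := by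
  have h := congrArg norm (sum_char_normSq s a f)
  rw [Complex.norm_real, Real.norm_of_nonneg (by positivity), norm_mul] at h
  rw [h]
  have h1 : ‖(p:ℂ) - 1‖ = (p:ℝ) - 1 := by
    rw [show (p:ℂ) - 1 = (((p:ℝ) - 1 : ℝ) : ℂ) by push_cast; rfl, Complex.norm_real,
      Real.norm_of_nonneg one_le_p_real]
  rw [h1]
  refine mul_le_mul_of_nonneg_left ?_ one_le_p_real
  refine (norm_sum_le _ _).trans (sum_le_sum fun i _ => (norm_sum_le _ _).trans
    (sum_le_sum fun j _ => ?_))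
  split_ifs <;> simp

/-- Number of pairs in `s × s` with the same nonzero image. -/
theorem sum_char_normSq_count {ι : Type*} (s : Finset ι) (f : ι → ZMod p) :
    ∑ χ : DirichletCharacter ℂ p, ‖∑ i ∈ s, χ (f i)‖ ^ 2 =
      (p - 1) * #{x ∈ s ×ˢ s | f x.1 = f x.2 ∧ f x.1 ≠ 0} := by
  have h := sum_char_normSq s (fun _ => 1) f
  simp only [one_mul] at h
  have h2 : (∑ i ∈ s, ∑ j ∈ s, if f i = f j ∧ f i ≠ 0 then (1:ℂ) * conj (1:ℂ) else 0) =
      #{x ∈ s ×ˢ s | f x.1 = f x.2 ∧ f x.1 ≠ 0} := by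
    rw [← sum_product', card_filter]
    push_cast
    simp
  simp only [map_one, mul_one] at h h2
  rw [h2] at h
  exact_mod_cast h

theorem sum_char_eq_zero {χ : DirichletCharacter ℂ p} (hχ : χ ≠ 1) : ∑ x : ZMod p, χ x = 0 :=
  MulChar.sum_eq_zero_of_ne_one hχ

theorem sum_shift_mul_conj {χ : DirichletCharacter ℂ p} (hχ : χ ≠ 1) {a b : ZMod p} (hab : a ≠ b) :
    ∑ x : ZMod p, χ (x + a) * conj (χ (x + b)) = -1 := by
  simp_rw [conj_char, ← map_mul]
  have hc : a - b ≠ 0 := sub_ne_zero.2 hab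
  have h1 : ∑ x : ZMod p, χ ((x + a) * (x + b)⁻¹) = ∑ y : ZMod p, χ ((y + (a - b)) * y⁻¹) := by
    refine Fintype.sum_equiv (Equiv.addRight b) _ _ fun x => ?_
    simp only [Equiv.coe_addRight]
    congr 2; ring
  have h2 : ∑ y : ZMod p, χ ((y + (a - b)) * y⁻¹) =
      ∑ y ∈ univ.erase (0 : ZMod p), χ (1 + (a - b) * y⁻¹) := by
    rw [← add_sum_erase univ _ (mem_univ (0 : ZMod p))]
    simp only [inv_zero, mul_zero, MulChar.map_zero, zero_add]
    refine sum_congr rfl fun y hy => ?_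
    have : y ≠ 0 := ne_of_mem_erase hy
    congr 1; field_simp
  have h3 : ∑ y ∈ univ.erase (0 : ZMod p), χ (1 + (a - b) * y⁻¹) =
      ∑ z ∈ univ.erase (1 : ZMod p), χ z := by
    refine sum_nbij' (fun y => 1 + (a - b) * y⁻¹) (fun z => (a - b) * (z - 1)⁻¹) ?_ ?_ ?_ ?_ ?_
    · intro y hy; simp at hy ⊢; exact ⟨hc, hy⟩
    · intro z hz; simp at hz ⊢; exact ⟨hc, sub_ne_zero.2 hz⟩
    · intro y hy; simp at hy ⊢; field_simp
    · intro z hz; simp at hz ⊢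
      have : z - 1 ≠ 0 := sub_ne_zero.2 hz
      field_simp; ring
    · intro y _; rfl
  rw [h1, h2, h3]
  have := sum_char_eq_zero hχ
  rw [← add_sum_erase univ _ (mem_univ (1 : ZMod p)), map_one] at this
  exact eq_neg_of_add_eq_zero_right this

theorem sum_shift_mul_conj_self (χ : DirichletCharacter ℂ p) (a : ZMod p) :
    ∑ x : ZMod p, χ (x + a) * conj (χ (x + a)) = p - 1 := by
  have hp : p.Prime := Fact.out
  have h1 : ∑ x : ZMod p, χ (x + a) * conj (χ (x + a)) = ∑ y : ZMod p, χ y * conj (χ y) :=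
    Fintype.sum_equiv (Equiv.addRight a) _ _ fun x => rfl
  rw [h1, ← add_sum_erase univ _ (mem_univ (0 : ZMod p))]
  have : ∀ y ∈ univ.erase (0 : ZMod p), χ y * conj (χ y) = 1 := fun y hy => by
    rw [Complex.mul_conj', char_norm_eq_one χ (ne_of_mem_erase hy)]; simp
  rw [sum_congr rfl this, MulChar.map_zero]
  simp [card_erase_of_mem, ZMod.card, Nat.cast_sub hp.one_lt.le]

/-- The operator `c ↦ (x ↦ ∑ b, c b χ(x+b))` has norm at most `√p`. -/
theorem sum_shift_normSq_le {χ : DirichletCharacter ℂ p} (hχ : χ ≠ 1) (c : ZMod p → ℂ) :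
    ∑ x : ZMod p, ‖∑ b, c b * χ (x + b)‖ ^ 2 ≤ p * ∑ b, ‖c b‖ ^ 2 := by
  have h := sum_normSq (univ : Finset (ZMod p)) univ c fun b x => χ (x + b)
  have h2 : ∀ i j : ZMod p, c i * conj (c j) * ∑ x : ZMod p, χ (x + i) * conj (χ (x + j)) =
      (if i = j then (p : ℂ) * (c i * conj (c j)) else 0) - c i * conj (c j) := by
    intro i j
    by_cases hij : i = j
    · subst hij
      rw [sum_shift_mul_conj_self, if_pos rfl]; ring
    · rw [sum_shift_mul_conj hχ hij, if_neg hij]; ring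
  simp_rw [h2, sum_sub_distrib] at h
  simp only [sum_ite_eq, mem_univ, if_true] at h
  rw [← mul_sum, ← sum_mul_sum, ← map_sum, Complex.mul_conj'] at h
  simp_rw [Complex.mul_conj'] at h
  have h' : ∑ x : ZMod p, ‖∑ b, c b * χ (x + b)‖ ^ 2 = p * ∑ b, ‖c b‖ ^ 2 - ‖∑ b, c b‖ ^ 2 := by
    exact_mod_cast h
  rw [h']
  nlinarith [sq_nonneg ‖∑ b, c b‖]
end characters

section additive
variable {p : ℕ} [Fact p.Prime]

/-- The standard additive character of `ZMod p`. -/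
noncomputable abbrev ee (x : ZMod p) : ℂ := ZMod.stdAddChar x

theorem ee_add (x y : ZMod p) : ee (x + y) = ee x * ee y := AddChar.map_add_eq_mul _ _ _

theorem ee_zero : ee (0 : ZMod p) = 1 := AddChar.map_zero_eq_one _

theorem norm_ee (x : ZMod p) : ‖ee x‖ = 1 := by
  simp [ee]

theorem conj_ee (x : ZMod p) : conj (ee x) = ee (-x) := by
  rw [ee, ee, AddChar.map_neg_eq_conj]

theorem sum_ee (s : ZMod p) : ∑ x : ZMod p, ee (s * x) = if s = 0 then (p : ℂ) else 0 := by
  have := AddChar.sum_mulShift (R := ZMod p) s (ZMod.isPrimitive_stdAddChar p)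
  simp_rw [mul_comm s]
  rw [this]
  simp [ZMod.card]

theorem parseval (c : ZMod p → ℂ) :
    ∑ s : ZMod p, ‖∑ u, c u * ee (s * u)‖ ^ 2 = p * ∑ u, ‖c u‖ ^ 2 := by
  have h := sum_normSq (univ : Finset (ZMod p)) univ c fun u s => ee (s * u)
  have h2 : ∀ i j : ZMod p, ∑ x : ZMod p, ee (x * i) * conj (ee (x * j)) =
      if i = j then (p : ℂ) else 0 := by
    intro i j
    have hs := sum_ee (i - j)
    simp only [sub_eq_zero] at hs
    rw [← hs]
    refine sum_congr rfl fun x _ => ?_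
    rw [conj_ee, ← ee_add]; congr 1; ring
  simp_rw [h2] at h
  simp only [mul_ite, mul_zero, sum_ite_eq, mem_univ, if_true] at h
  simp_rw [Complex.mul_conj'] at h
  rw [← sum_mul, mul_comm] at h
  exact_mod_cast h
end additive

section fourth
variable {p : ℕ} [Fact p.Prime]

noncomputable def shiftQuot (χ : DirichletCharacter ℂ p) (x : ZMod p) : ℂ := χ (x + 1) * conj (χ x)

noncomputable def shiftQuotSum (χ : DirichletCharacter ℂ p) (s : ZMod p) : ℂ :=
  ∑ x : ZMod p, shiftQuot χ x * ee (s * x)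

theorem norm_shiftQuot_le (χ : DirichletCharacter ℂ p) (x : ZMod p) : ‖shiftQuot χ x‖ ≤ 1 := by
  rw [shiftQuot, norm_mul, RCLike.norm_conj]
  exact mul_le_one₀ (norm_char_le_one _ _) (norm_nonneg _) (norm_char_le_one _ _)

theorem norm_shiftQuotSum_zero {χ : DirichletCharacter ℂ p} (hχ : χ ≠ 1) :
    ‖shiftQuotSum χ 0‖ = 1 := by
  have := sum_shift_mul_conj hχ (a := 1) (b := 0) one_ne_zero
  simp only [add_zero] at this
  simp [shiftQuotSum, shiftQuot, this]

noncomputable def quadC (p : ℕ) [Fact p.Prime] : DirichletCharacter ℂ p :=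
  (quadraticChar (ZMod p)).ringHomComp (Int.castRingHom ℂ)

theorem quadC_apply (a : ZMod p) : quadC p a = (quadraticChar (ZMod p) a : ℂ) := by
  simp [quadC, MulChar.ringHomComp_apply]

theorem quadC_ne_one (hp : p ≠ 2) : quadC p ≠ 1 := by
  have h : ringChar (ZMod p) ≠ 2 := by rwa [ZMod.ringChar_zmod_n]
  rw [quadC]
  exact (MulChar.ringHomComp_ne_one_iff (Int.cast_injective (α := ℂ))).2 (quadraticChar_ne_one h)

theorem card_mul_sub_eq (hp : p ≠ 2) (u q : ZMod p) :
    (#{x : ZMod p | x * (u - x) = q} : ℂ) = 1 + quadC p (u ^ 2 - 4 * q) := by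
  have h : ringChar (ZMod p) ≠ 2 := by rwa [ZMod.ringChar_zmod_n]
  have h2 : (2 : ZMod p) ≠ 0 := Ring.two_ne_zero h
  have h1 := quadraticChar_card_sqrts h (u ^ 2 - 4 * q)
  have h3 : #{x : ZMod p | x * (u - x) = q} = #{x : ZMod p | x ^ 2 = u ^ 2 - 4 * q} := by
    refine card_nbij' (fun x => 2 * x - u) (fun z => (z + u) / 2) ?_ ?_ ?_ ?_
    · intro x hx
      simp only [mem_univ, true_and, coe_filter, Set.mem_ofPred_eq] at hx ⊢
      rw [← hx]; ring
    · intro z hz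
      simp only [mem_univ, true_and, coe_filter, Set.mem_ofPred_eq] at hz ⊢
      field_simp
      linear_combination -hz
    · intro x _; field_simp; ring
    · intro z _; field_simp; ring
  rw [h3, quadC_apply]
  have h4 : ({x : ZMod p | x ^ 2 = u ^ 2 - 4 * q} : Set (ZMod p)).toFinset =
      ({x : ZMod p | x ^ 2 = u ^ 2 - 4 * q} : Finset (ZMod p)) := by ext; simp
  rw [h4] at h1
  have := congrArg (Int.cast : ℤ → ℂ) h1
  push_cast at this
  rw [this]; ring

theorem sum_comp_le_two {h : ZMod p → ℝ} (hh : ∀ t, 0 ≤ h t) (hp : p ≠ 2) :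
    ∑ u ∈ univ.erase (-1 : ZMod p), h (u ^ 2 / (4 * (u + 1))) ≤ 2 * ∑ t, h t := by
  have h' : ringChar (ZMod p) ≠ 2 := by rwa [ZMod.ringChar_zmod_n]
  have h2 : (2 : ZMod p) ≠ 0 := Ring.two_ne_zero h'
  have h4 : (4 : ZMod p) ≠ 0 := by
    rw [show (4 : ZMod p) = 2 * 2 by norm_num]; exact mul_ne_zero h2 h2
  rw [← sum_fiberwise (univ.erase (-1 : ZMod p)) (fun u => u ^ 2 / (4 * (u + 1))), mul_sum]
  refine sum_le_sum fun t _ => ?_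
  rw [sum_congr rfl (g := fun _ => h t) fun u hu => by rw [(mem_filter.1 hu).2], sum_const,
    nsmul_eq_mul]
  refine mul_le_mul_of_nonneg_right ?_ (hh t)
  rcases (filter (fun u => u ^ 2 / (4 * (u + 1)) = t) (univ.erase (-1 : ZMod p))).eq_empty_or_nonempty
    with he | ⟨v, hv⟩
  · rw [he]; simp
  · have hroot : ∀ u ∈ filter (fun u => u ^ 2 / (4 * (u + 1)) = t) (univ.erase (-1 : ZMod p)),
        u ^ 2 = 4 * t * (u + 1) := by
      intro u hu
      simp only [mem_filter, mem_erase, mem_univ, and_true] at hu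
      have : u + 1 ≠ 0 := fun h => hu.1 (eq_neg_of_add_eq_zero_left h)
      rw [← hu.2]; field_simp
    have hsub : filter (fun u => u ^ 2 / (4 * (u + 1)) = t) (univ.erase (-1 : ZMod p)) ⊆
        {v, 4 * t - v} := by
      intro u hu
      have e1 := hroot u hu
      have e2 := hroot v hv
      have : (u - v) * (u - (4 * t - v)) = 0 := by linear_combination e1 - e2
      rcases mul_eq_zero.1 this with h | h
      · simp [sub_eq_zero.1 h]
      · simp [sub_eq_zero.1 h]
    exact_mod_cast (card_le_card hsub).trans card_le_two

theorem sum_norm_shiftQuot_conv_sq_le {χ : DirichletCharacter ℂ p} (hχ : χ ≠ 1) (hp : p ≠ 2) :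
    ∑ u : ZMod p, ‖∑ x, shiftQuot χ x * shiftQuot χ (u - x)‖ ^ 2 ≤ 7 * (p : ℝ) ^ 2 := by
  have hpp : p.Prime := Fact.out
  have hF : ∀ u x : ZMod p, shiftQuot χ x * shiftQuot χ (u - x) =
      χ (x * (u - x) + (u + 1)) * conj (χ (x * (u - x))) := by
    intro u x
    simp only [shiftQuot, map_mul]
    rw [show x * (u - x) + (u + 1) = (x + 1) * (u - x + 1) by ring, map_mul]
    ring
  set J : ZMod p → ℂ := fun u => ∑ x, shiftQuot χ x * shiftQuot χ (u - x) with hJ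
  set H : ZMod p → ℂ := fun t => ∑ b, shiftQuot χ (-b) * quadC p (t + b) with hH
  have hJ' : ∀ u, J u = ∑ q, (1 + quadC p (u ^ 2 - 4 * q)) *
      (χ (q + (u + 1)) * conj (χ q)) := by
    intro u
    rw [hJ]
    simp only [hF]
    rw [← sum_fiberwise univ (fun x => x * (u - x))]
    refine sum_congr rfl fun q _ => ?_
    rw [sum_congr rfl (g := fun _ => χ (q + (u + 1)) * conj (χ q))
      fun x hx => by rw [(mem_filter.1 hx).2], sum_const, nsmul_eq_mul, card_mul_sub_eq hp]
  have hJm : ‖J (-1)‖ ≤ p := by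
    refine (norm_sum_le _ _).trans ?_
    calc _ ≤ ∑ x : ZMod p, (1:ℝ) := sum_le_sum fun x _ => by
          rw [norm_mul]
          exact mul_le_one₀ (norm_shiftQuot_le _ _) (norm_nonneg _) (norm_shiftQuot_le _ _)
      _ = p := by simp [ZMod.card]
  have hJu : ∀ u ∈ univ.erase (-1 : ZMod p), ‖J u‖ ^ 2 ≤ 2 + 2 * ‖H (u ^ 2 / (4 * (u + 1)))‖ ^ 2 := by
    intro u hu
    have hu1 : u + 1 ≠ 0 := fun h => ne_of_mem_erase hu (eq_neg_of_add_eq_zero_left h)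
    have h' : ringChar (ZMod p) ≠ 2 := by rwa [ZMod.ringChar_zmod_n]
    have h2 : (2 : ZMod p) ≠ 0 := Ring.two_ne_zero h'
    have h4 : (4 : ZMod p) ≠ 0 := by
      rw [show (4 : ZMod p) = 2 * 2 by norm_num]; exact mul_ne_zero h2 h2
    have e1 : ∑ q, χ (q + (u + 1)) * conj (χ q) = -1 := by
      have := sum_shift_mul_conj hχ (a := u + 1) (b := 0) hu1
      simpa using this
    have e2 : ∑ q, quadC p (u ^ 2 - 4 * q) * (χ (q + (u + 1)) * conj (χ q)) =
        quadC p (4 * (u + 1)) * H (u ^ 2 / (4 * (u + 1))) := by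
      rw [hH, mul_sum]
      refine (Fintype.sum_equiv (Equiv.mulRight₀ (-(u + 1)) (neg_ne_zero.2 hu1)) _ _ fun b => ?_).symm
      simp only [shiftQuot]
      rw [← mul_assoc, mul_comm (quadC p (4 * (u + 1))), mul_assoc, ← map_mul]
      have a1 : 4 * (u + 1) * (u ^ 2 / (4 * (u + 1)) + b) = u ^ 2 - 4 * (b * -(u + 1)) := by
        field_simp; ring
      have a2 : b * -(u + 1) + (u + 1) = (u + 1) * (-b + 1) := by ring
      have a3 : b * -(u + 1) = (u + 1) * (-b) := by ring
      rw [a1]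
      change _ = quadC p (u ^ 2 - 4 * (b * -(u + 1))) *
        (χ (b * -(u + 1) + (u + 1)) * conj (χ (b * -(u + 1))))
      rw [a2, show χ (b * -(u + 1)) = χ (u + 1) * χ (-b) by rw [a3, map_mul], map_mul χ,
        map_mul conj]
      have : χ (u + 1) * conj (χ (u + 1)) = 1 := by
        rw [Complex.mul_conj', char_norm_eq_one χ hu1]; simp
      linear_combination -(χ (-b + 1) * conj (χ (-b)) * quadC p (u ^ 2 - 4 * (b * -(u + 1)))) * this
    have e3 : J u = -1 + quadC p (4 * (u + 1)) * H (u ^ 2 / (4 * (u + 1))) := by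
      rw [hJ', ← e2, ← e1, ← sum_add_distrib]
      exact sum_congr rfl fun q _ => by ring
    have e4 : ‖J u‖ ≤ 1 + ‖H (u ^ 2 / (4 * (u + 1)))‖ := by
      rw [e3]
      refine (norm_add_le _ _).trans ?_
      rw [norm_neg, norm_one, norm_mul, char_norm_eq_one _ (mul_ne_zero h4 hu1), one_mul]
    nlinarith [norm_nonneg (J u), norm_nonneg (H (u ^ 2 / (4 * (u + 1)))),
      sq_nonneg (1 - ‖H (u ^ 2 / (4 * (u + 1)))‖)]
  have hHs : ∑ t, ‖H t‖ ^ 2 ≤ (p:ℝ) ^ 2 := by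
    refine (sum_shift_normSq_le (quadC_ne_one hp) _).trans ?_
    rw [pow_two]
    refine mul_le_mul_of_nonneg_left ?_ (Nat.cast_nonneg _)
    calc _ ≤ ∑ x : ZMod p, (1:ℝ) := sum_le_sum fun x _ =>
          pow_le_one₀ (norm_nonneg _) (norm_shiftQuot_le _ _)
      _ = p := by simp [ZMod.card]
  rw [← add_sum_erase univ _ (mem_univ (-1 : ZMod p))]
  have h5 := sum_le_sum hJu
  rw [sum_add_distrib, ← mul_sum] at h5
  have h6 := sum_comp_le_two (h := fun t => ‖H t‖ ^ 2) (fun t => by positivity) hp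
  have h7 : ∑ u ∈ univ.erase (-1 : ZMod p), (2:ℝ) ≤ 2 * p := by
    rw [sum_const, nsmul_eq_mul, mul_comm]
    have : #(univ.erase (-1 : ZMod p)) ≤ p := by
      refine (card_le_univ _).trans ?_
      rw [ZMod.card]
    have : (#(univ.erase (-1 : ZMod p)) : ℝ) ≤ p := by exact_mod_cast this
    linarith
  have h8 : (2:ℝ) ≤ p := by exact_mod_cast hpp.two_le
  have h9 : ‖J (-1)‖ ^ 2 ≤ (p:ℝ) ^ 2 := pow_le_pow_left₀ (norm_nonneg _) hJm 2
  nlinarith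

theorem sum_shiftQuotSum_pow_four_le {χ : DirichletCharacter ℂ p} (hχ : χ ≠ 1) (hp : p ≠ 2) :
    ∑ s : ZMod p, ‖shiftQuotSum χ s‖ ^ 4 ≤ 7 * (p : ℝ) ^ 3 := by
  have h : ∀ s : ZMod p, ‖shiftQuotSum χ s‖ ^ 4 =
      ‖∑ u, (∑ x, shiftQuot χ x * shiftQuot χ (u - x)) * ee (s * u)‖ ^ 2 := by
    intro s
    rw [show (4:ℕ) = 2 * 2 from rfl, pow_mul, ← norm_pow]
    congr 2
    rw [pow_two, shiftQuotSum, sum_mul_sum]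
    simp_rw [sum_mul]
    conv_rhs => rw [sum_comm]
    refine sum_congr rfl fun x _ => ?_
    refine Fintype.sum_equiv (Equiv.addLeft x) _ _ fun y => ?_
    simp only [Equiv.coe_addLeft, add_sub_cancel_left, mul_add, ee_add]
    ring
  rw [sum_congr rfl fun s _ => h s, parseval]
  have := sum_norm_shiftQuot_conv_sq_le hχ hp
  nlinarith [(Nat.cast_nonneg p : (0:ℝ) ≤ p)]
end fourth

section fejer
variable {p : ℕ} [Fact p.Prime]

/-- Fejér-type nonnegative weight on `ZMod p`. -/
noncomputable def fej (T : ℕ) (x : ZMod p) : ℝ := ‖∑ j ∈ range T, ee ((j : ZMod p) * x)‖ ^ 2 / T ^ 2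

theorem fej_nonneg (T : ℕ) (x : ZMod p) : 0 ≤ fej T x := by unfold fej; positivity

theorem norm_ee_natCast_sub_one_le (m : ℕ) : ‖ee (m : ZMod p) - 1‖ ≤ 2 * Real.pi * m / p := by
  have := ZMod.stdAddChar_coe (N := p) (m : ℤ)
  rw [Int.cast_natCast] at this
  rw [ee, this]
  have h := Real.norm_exp_I_mul_ofReal_sub_one_le (x := 2 * Real.pi * m / p)
  rw [Real.norm_of_nonneg (by positivity)] at h
  convert h using 4
  push_cast; ring

theorem fej_ge {T m : ℕ} (hT : 1 ≤ T) (h : T = 1 ∨ 16 * T * m ≤ p) :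
    1 / 4 ≤ fej T (m : ZMod p) := by
  have hp : p.Prime := Fact.out
  have hp0 : (0:ℝ) < p := by exact_mod_cast hp.pos
  have hT0 : (0:ℝ) < T := by exact_mod_cast hT
  rcases h with rfl | h
  · simp [fej]; norm_num
  · have h' : (16:ℝ) * T * m ≤ p := by exact_mod_cast h
    have h1 : ‖(T : ℂ) - ∑ j ∈ range T, ee ((j : ZMod p) * (m : ZMod p))‖ ≤ T / 2 := by
      have : (T : ℂ) - ∑ j ∈ range T, ee ((j : ZMod p) * (m : ZMod p)) =
          - ∑ j ∈ range T, (ee (((j * m : ℕ)) : ZMod p) - 1) := by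
        rw [sum_sub_distrib]; simp
      rw [this, norm_neg]
      calc _ ≤ ∑ j ∈ range T, (1/2 : ℝ) := by
            refine (norm_sum_le _ _).trans (sum_le_sum fun j hj => ?_)
            refine (norm_ee_natCast_sub_one_le _).trans ?_
            rw [div_le_iff₀ hp0]
            have hj' : (j : ℝ) ≤ T := by exact_mod_cast (mem_range.1 hj).le
            have : (j:ℝ) * m ≤ T * m := mul_le_mul_of_nonneg_right hj' (Nat.cast_nonneg _)
            push_cast
            have h0 : (0:ℝ) ≤ (j:ℝ) * m := by positivity
            nlinarith [Real.pi_lt_four, Real.pi_pos]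
        _ = T / 2 := by simp; ring
    have h2 : (T : ℝ) / 2 ≤ ‖∑ j ∈ range T, ee ((j : ZMod p) * (m : ZMod p))‖ := by
      have := norm_sub_norm_le (T : ℂ) (∑ j ∈ range T, ee ((j : ZMod p) * (m : ZMod p)))
      rw [Complex.norm_natCast] at this
      linarith
    rw [fej, le_div_iff₀ (by positivity)]
    nlinarith

theorem fej_eq (T : ℕ) (x : ZMod p) : (fej T x : ℂ) =
    (1 / (T : ℂ) ^ 2) * ∑ i ∈ range T, ∑ j ∈ range T, ee (((i : ZMod p) - (j : ZMod p)) * x) := by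
  have : (∑ i ∈ range T, ∑ j ∈ range T, ee (((i : ZMod p) - (j : ZMod p)) * x)) =
      (‖∑ j ∈ range T, ee ((j : ZMod p) * x)‖ : ℂ) ^ 2 := by
    rw [← Complex.mul_conj', map_sum, sum_mul_sum]
    refine sum_congr rfl fun i _ => sum_congr rfl fun j _ => ?_
    rw [conj_ee, ← ee_add]; congr 1; ring
  rw [this, fej]; push_cast; ring

/-- Sums against the Fejér weight. -/
theorem norm_sum_fej_mul_le (T : ℕ) (f : ZMod p → ℂ) :
    ‖∑ x, (fej T x : ℂ) * f x‖ ≤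
      (1 / (T : ℝ) ^ 2) * ∑ i ∈ range T, ∑ j ∈ range T, ‖∑ x, f x * ee (((i : ZMod p) - (j : ZMod p)) * x)‖ := by
  have : ∑ x, (fej T x : ℂ) * f x = (1 / (T : ℂ) ^ 2) *
      ∑ i ∈ range T, ∑ j ∈ range T, ∑ x, f x * ee (((i : ZMod p) - (j : ZMod p)) * x) := by
    simp_rw [fej_eq, mul_assoc, ← mul_sum]
    congr 1
    simp_rw [sum_mul]
    rw [sum_comm]
    refine sum_congr rfl fun i _ => ?_
    rw [sum_comm]
    exact sum_congr rfl fun j _ => sum_congr rfl fun x _ => by ring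
  rw [this, norm_mul]
  have h1 : ‖(1 / (T : ℂ) ^ 2)‖ = 1 / (T : ℝ) ^ 2 := by simp
  rw [h1]
  refine mul_le_mul_of_nonneg_left ?_ (by positivity)
  exact (norm_sum_le _ _).trans (sum_le_sum fun i _ => norm_sum_le _ _)

end fejer

section bilinear
variable {p : ℕ} [Fact p.Prime]

theorem norm_sum_two_linear (χ : DirichletCharacter ℂ p) {n n' k : ZMod p} (hn : n ≠ 0)
    (hn' : n' ≠ 0) (hk : k ≠ 0) (hnn : n ≠ n') (s : ZMod p) :
    ‖∑ x : ZMod p, χ (x * n + k) * conj (χ (x * n' + k)) * ee (s * x)‖ =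
      ‖shiftQuotSum χ (s * (k * (n⁻¹ - n'⁻¹)))‖ := by
  set d := k * (n⁻¹ - n'⁻¹) with hd
  have hd0 : d ≠ 0 := mul_ne_zero hk (sub_ne_zero.2 fun h => hnn (inv_injective h))
  let e : ZMod p ≃ ZMod p := (Equiv.mulLeft₀ d hd0).trans (Equiv.subRight (k * n'⁻¹))
  have he : ∀ z, e z = d * z - k * n'⁻¹ := fun z => rfl
  have hd1 : χ d * conj (χ d) = 1 := by rw [Complex.mul_conj', char_norm_eq_one χ hd0]; simp
  have key : ∑ x : ZMod p, χ (x * n + k) * conj (χ (x * n' + k)) * ee (s * x) =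
      (χ n * conj (χ n') * ee (- (s * (k * n'⁻¹)))) * shiftQuotSum χ (s * d) := by
    rw [shiftQuotSum, mul_sum]
    refine (Fintype.sum_equiv e _ _ fun z => ?_).symm
    rw [he]
    have a1 : (d * z - k * n'⁻¹) * n + k = n * (d * (z + 1)) := by
      rw [hd]; field_simp; ring
    have a2 : (d * z - k * n'⁻¹) * n' + k = n' * (d * z) := by
      field_simp; ring
    have a3 : s * (d * z - k * n'⁻¹) = -(s * (k * n'⁻¹)) + s * d * z := by ring
    rw [a1, a2, a3, ee_add, shiftQuot]
    simp only [map_mul]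
    linear_combination (-(χ n * conj (χ n') * ee (- (s * (k * n'⁻¹))) * χ (z + 1) * conj (χ z) * ee (s * d * z))) * hd1
  rw [key, norm_mul, norm_mul, norm_mul, RCLike.norm_conj, char_norm_eq_one χ hn,
    char_norm_eq_one χ hn', norm_ee]
  simp

theorem norm_sum_one_linear_le (χ : DirichletCharacter ℂ p) {n k : ZMod p} (hn : n ≠ 0)
    (s : ZMod p) :
    ‖∑ x : ZMod p, χ (x * n + k) * conj (χ (x * n + k)) * ee (s * x)‖ ≤
      if s = 0 then (p : ℝ) + 1 else 1 := by
  have h1 : ∀ x : ZMod p, χ (x * n + k) * conj (χ (x * n + k)) * ee (s * x) =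
      ee (s * x) - if x = -k * n⁻¹ then ee (s * x) else 0 := by
    intro x
    by_cases hx : x * n + k = 0
    · rw [if_pos]
      · rw [hx, MulChar.map_zero χ]; simp
      · field_simp; exact eq_neg_of_add_eq_zero_left hx
    · rw [if_neg, Complex.mul_conj', char_norm_eq_one χ hx]
      · simp
      · rintro rfl; apply hx; field_simp; ring
  simp_rw [h1]
  rw [sum_sub_distrib, sum_ee]
  simp only [sum_ite_eq', mem_univ, if_true]
  refine (norm_sub_le _ _).trans ?_
  rw [norm_ee]
  split_ifs <;> simp

theorem natCast_ne_zero_of_lt {n : ℕ} (h0 : 0 < n) (h : n < p) : (n : ZMod p) ≠ 0 := by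
  rw [Ne, ZMod.natCast_eq_zero_iff]
  exact fun hd => absurd (Nat.le_of_dvd h0 hd) (not_le.2 h)

theorem natCast_inj_of_lt {n m : ℕ} (hn : n < p) (hm : m < p) (h : (n : ZMod p) = m) : n = m := by
  rw [ZMod.natCast_eq_natCast_iff] at h
  exact Nat.ModEq.eq_of_lt_of_lt h hn hm

theorem sum_range_sub_le {T : ℕ} (h : ZMod p → ℝ) (hh : ∀ x, 0 ≤ h x) :
    ∑ i ∈ range T, ∑ j ∈ range T, h ((i : ZMod p) - (j : ZMod p)) ≤
      T * h 0 + T * ∑ t ∈ Ico 1 T, (h (t : ZMod p) + h (-(t : ZMod p))) := by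
  have key : ∀ i ∈ range T, ∑ j ∈ range T, h ((i : ZMod p) - (j : ZMod p)) ≤
      h 0 + ∑ t ∈ Ico 1 T, (h (t : ZMod p) + h (-(t : ZMod p))) := by
    intro i hi
    have hi' := mem_range.1 hi
    have e : range T = Ico 0 i ∪ ({i} ∪ Ico (i + 1) T) := by
      ext j; simp; omega
    rw [e, sum_union, sum_union, sum_singleton, sub_self, sum_add_distrib]
    · have a1 : ∑ j ∈ Ico 0 i, h ((i : ZMod p) - (j : ZMod p)) ≤ ∑ t ∈ Ico 1 T, h (t : ZMod p) := by
        have : ∑ j ∈ Ico 0 i, h ((i : ZMod p) - (j : ZMod p)) = ∑ t ∈ Ico 1 (i + 1), h (t : ZMod p) := by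
          refine sum_nbij' (fun j => i - j) (fun t => i - t) ?_ ?_ ?_ ?_ ?_
          all_goals intro j hj; simp only [mem_Ico] at hj ⊢
          any_goals omega
          rw [Nat.cast_sub (by omega)]
        rw [this]
        exact sum_le_sum_of_subset_of_nonneg (Ico_subset_Ico le_rfl (by omega)) fun _ _ _ => hh _
      have a2 : ∑ j ∈ Ico (i + 1) T, h ((i : ZMod p) - (j : ZMod p)) ≤ ∑ t ∈ Ico 1 T, h (-(t : ZMod p)) := by
        have : ∑ j ∈ Ico (i + 1) T, h ((i : ZMod p) - (j : ZMod p)) = ∑ t ∈ Ico 1 (T - i), h (-(t : ZMod p)) := by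
          refine sum_nbij' (fun j => j - i) (fun t => i + t) ?_ ?_ ?_ ?_ ?_
          all_goals intro j hj; simp only [mem_Ico] at hj ⊢
          any_goals omega
          rw [Nat.cast_sub (by omega), neg_sub]
        rw [this]
        exact sum_le_sum_of_subset_of_nonneg (Ico_subset_Ico le_rfl (by omega)) fun _ _ _ => hh _
      linarith
    · rw [disjoint_left]; intro a; simp; omega
    · rw [disjoint_left]; intro a; simp; omega
  refine (sum_le_sum key).trans ?_
  rw [sum_const, card_range, nsmul_eq_mul, mul_add]

/-- Bilinear mean square in terms of fourth-moment controlled sums. -/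
theorem sum_normSq_linear_le {χ : DirichletCharacter ℂ p} (hχ : χ ≠ 1) {k : ZMod p} (hk : k ≠ 0)
    {T M : ℕ} (hT : 1 ≤ T) (hTp : T < p) (hTM : T = 1 ∨ 16 * T * M ≤ p) (hM : M < p) (S : Finset ℕ)
    (hS : ∀ n ∈ S, 0 < n ∧ n < p) (β : ℕ → ℂ) (hβ : ∀ n ∈ S, ‖β n‖ ≤ 1) :
    ∑ m ∈ Icc 1 M, ‖∑ n ∈ S, β n * χ ((m : ZMod p) * n + k)‖ ^ 2 ≤
      4 * ((#S : ℝ) * (p + 1) / T + 2 * #S + (#S : ℝ) ^ 2 / T +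
        (2 / T) * ∑ x ∈ (S ×ˢ S ×ˢ Ico 1 T) with x.1 ≠ x.2.1,
          ‖shiftQuotSum χ ((x.2.2 : ZMod p) * (k * ((x.1 : ZMod p)⁻¹ - (x.2.1 : ZMod p)⁻¹)))‖) := by
  have hT0 : (0:ℝ) < T := by exact_mod_cast hT
  have step1 : ∑ m ∈ Icc 1 M, ‖∑ n ∈ S, β n * χ ((m : ZMod p) * n + k)‖ ^ 2 ≤
      4 * ∑ x : ZMod p, fej T x * ‖∑ n ∈ S, β n * χ (x * n + k)‖ ^ 2 := by
    have : ∑ m ∈ Icc 1 M, ‖∑ n ∈ S, β n * χ ((m : ZMod p) * n + k)‖ ^ 2 ≤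
        ∑ m ∈ Icc 1 M, 4 * (fej T (m : ZMod p) * ‖∑ n ∈ S, β n * χ ((m : ZMod p) * n + k)‖ ^ 2) := by
      refine sum_le_sum fun m hm => ?_
      have hm' := mem_Icc.1 hm
      have := fej_ge (p := p) (m := m) hT (hTM.imp id fun h => le_trans (by gcongr; exact hm'.2) h)
      nlinarith [sq_nonneg ‖∑ n ∈ S, β n * χ ((m : ZMod p) * n + k)‖]
    refine this.trans ?_
    rw [← mul_sum]
    refine mul_le_mul_of_nonneg_left ?_ (by norm_num)
    have hinj : Set.InjOn (fun m : ℕ => (m : ZMod p)) (Icc 1 M) := by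
      intro a ha b hb hab
      simp only [coe_Icc, Set.mem_Icc] at ha hb
      exact natCast_inj_of_lt (by omega) (by omega) hab
    rw [← sum_image (f := fun x : ZMod p => fej T x * ‖∑ n ∈ S, β n * χ (x * n + k)‖ ^ 2) hinj]
    exact sum_le_sum_of_subset_of_nonneg (subset_univ _) fun x _ _ =>
      mul_nonneg (fej_nonneg _ _) (by positivity)
  refine step1.trans (mul_le_mul_of_nonneg_left ?_ (by norm_num))
  have h := congrArg norm (sum_weighted_normSq univ (fej (p := p) T) S β fun n x => χ (x * n + k))
  rw [Complex.norm_real, Real.norm_of_nonneg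
    (sum_nonneg fun x _ => mul_nonneg (fej_nonneg _ _) (by positivity))] at h
  rw [h]
  set G : ZMod p → ℝ := fun s => ‖shiftQuotSum χ s‖ with hG
  set d : ℕ → ℕ → ZMod p := fun n n' => k * ((n : ZMod p)⁻¹ - (n' : ZMod p)⁻¹) with hd
  have hpair : ∀ n ∈ S, ∀ n' ∈ S, ‖β n * conj (β n') * ∑ x : ZMod p, (fej T x : ℂ) *
      (χ (x * n + k) * conj (χ (x * n' + k)))‖ ≤
      (if n = n' then ((p + 1 : ℝ) / T + 2) else 1 / T) +
        (1 / T) * ∑ t ∈ Ico 1 T, if n ≠ n' then G (t * d n n') + G (t * d n' n) else 0 := by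
    intro n hn n' hn'
    rw [norm_mul, norm_mul, RCLike.norm_conj]
    have hb : ‖β n‖ * ‖β n'‖ ≤ 1 := mul_le_one₀ (hβ n hn) (norm_nonneg _) (hβ n' hn')
    have h1 := norm_sum_fej_mul_le (p := p) T fun x => χ (x * n + k) * conj (χ (x * n' + k))
    refine le_trans (mul_le_mul hb h1 (norm_nonneg _) zero_le_one) ?_
    rw [one_mul]
    have h2 := sum_range_sub_le (p := p) (T := T) (fun s => ‖∑ x : ZMod p,
      χ (x * n + k) * conj (χ (x * n' + k)) * ee (s * x)‖) fun _ => norm_nonneg _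
    have hn0 := natCast_ne_zero_of_lt (hS n hn).1 (hS n hn).2
    have hn0' := natCast_ne_zero_of_lt (hS n' hn').1 (hS n' hn').2
    refine (mul_le_mul_of_nonneg_left h2 (by positivity)).trans ?_
    by_cases hnn : n = n'
    · subst hnn
      simp only [ne_eq, not_true_eq_false, if_false, sum_const_zero, mul_zero, add_zero, if_true]
      have h3 := norm_sum_one_linear_le χ (k := k) hn0 0
      rw [if_pos rfl] at h3
      have h4 : ∀ t ∈ Ico 1 T, ‖∑ x : ZMod p, χ (x * n + k) * conj (χ (x * n + k)) * ee ((t : ZMod p) * x)‖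
          + ‖∑ x : ZMod p, χ (x * n + k) * conj (χ (x * n + k)) * ee (-(t : ZMod p) * x)‖ ≤ 2 := by
        intro t ht
        have ht' := mem_Ico.1 ht
        have ht0 : (t : ZMod p) ≠ 0 := natCast_ne_zero_of_lt (by omega) (by omega)
        have a := norm_sum_one_linear_le χ (k := k) hn0 t
        have b := norm_sum_one_linear_le χ (k := k) hn0 (-t)
        rw [if_neg ht0] at a
        rw [if_neg (neg_ne_zero.2 ht0)] at b
        linarith
      have h5 := sum_le_sum h4
      rw [sum_const, nsmul_eq_mul, Nat.card_Ico] at h5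
      have h6 : ((T - 1 : ℕ) : ℝ) ≤ T := by exact_mod_cast Nat.sub_le _ _
      rw [one_div, inv_mul_le_iff₀ (by positivity)]
      have : (T:ℝ) ^ 2 * ((p + 1 : ℝ) / T + 2) = T * (p + 1) + T * (2 * T) := by field_simp
      rw [this]
      gcongr
      linarith
    · have hnn2 : (n : ZMod p) ≠ n' := fun h => hnn (natCast_inj_of_lt (hS n hn).2 (hS n' hn').2 h)
      rw [if_neg hnn]
      simp only [ne_eq, hnn, not_false_eq_true, if_true]
      simp_rw [norm_sum_two_linear χ hn0 hn0' hk hnn2]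
      have h0 : ‖shiftQuotSum χ (0 * (k * ((n : ZMod p)⁻¹ - (n' : ZMod p)⁻¹)))‖ = 1 := by
        rw [zero_mul, norm_shiftQuotSum_zero hχ]
      rw [h0]
      have h7 : ∀ t : ZMod p, -t * (k * ((n : ZMod p)⁻¹ - (n' : ZMod p)⁻¹)) = t * d n' n := by
        intro t; simp only [hd]; ring
      simp_rw [h7]
      have hA : ∀ A : ℝ, 1 / (T:ℝ) ^ 2 * (T * 1 + T * A) = 1 / T + 1 / T * A := by
        intro A; field_simp
      rw [hA]
  refine (norm_sum_le _ _).trans ((sum_le_sum fun n hn => (norm_sum_le _ _).trans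
    (sum_le_sum fun n' hn' => hpair n hn n' hn')).trans ?_)
  simp_rw [sum_add_distrib, ← mul_sum]
  have e1 : ∑ n ∈ S, ∑ n' ∈ S, (if n = n' then ((p + 1 : ℝ) / T + 2) else 1 / T) ≤
      (#S : ℝ) * (p + 1) / T + 2 * #S + (#S : ℝ) ^ 2 / T := by
    have : ∀ n ∈ S, ∑ n' ∈ S, (if n = n' then ((p + 1 : ℝ) / T + 2) else 1 / T) ≤
        ((p + 1 : ℝ) / T + 2) + #S / T := by
      intro n hn
      calc _ ≤ ∑ n' ∈ S, ((if n = n' then ((p + 1 : ℝ) / T + 2) else 0) + 1 / T) := by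
            refine sum_le_sum fun n' _ => ?_
            split_ifs
            · have : (0:ℝ) ≤ 1 / T := by positivity
              linarith
            · simp
        _ = _ := by
            rw [sum_add_distrib]
            simp [hn]; ring
    refine (sum_le_sum this).trans (le_of_eq ?_)
    simp; ring
  have e2 : ∑ n ∈ S, ∑ n' ∈ S, ∑ t ∈ Ico 1 T, (if n ≠ n' then G (t * d n n') + G (t * d n' n) else 0) =
      2 * ∑ x ∈ (S ×ˢ S ×ˢ Ico 1 T) with x.1 ≠ x.2.1, G (x.2.2 * d x.1 x.2.1) := by
    rw [sum_filter, sum_product]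
    simp_rw [sum_product]
    have e3 : ∀ n n' t : ℕ, (if n ≠ n' then G (t * d n n') + G (t * d n' n) else 0) =
        (if n ≠ n' then G (t * d n n') else 0) + (if n' ≠ n then G (t * d n' n) else 0) := by
      intro n n' t
      by_cases h : n = n'
      · simp [h]
      · simp [h, Ne.symm h]
    simp_rw [e3, sum_add_distrib]
    rw [sum_comm (f := fun n n' => ∑ t ∈ Ico 1 T, if n' ≠ n then G (t * d n' n) else 0)]
    ring
  rw [e2]
  have : (1 / (T:ℝ)) * (2 * ∑ x ∈ (S ×ˢ S ×ˢ Ico 1 T) with x.1 ≠ x.2.1, G (x.2.2 * d x.1 x.2.1)) =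
    (2 / T) * ∑ x ∈ (S ×ˢ S ×ˢ Ico 1 T) with x.1 ≠ x.2.1, G (x.2.2 * d x.1 x.2.1) := by ring
  rw [this]
  exact add_le_add_left e1 _

/-- Hölder: a sum of `‖G(f z)‖` in terms of the collision number of `f`. -/
theorem sum_shiftQuotSum_pow_four_le' {χ : DirichletCharacter ℂ p} (hχ : χ ≠ 1) (hp : p ≠ 2)
    {ι : Type*} (Z : Finset ι) (f : ι → ZMod p) :
    (∑ z ∈ Z, ‖shiftQuotSum χ (f z)‖) ^ 4 ≤
      (#Z : ℝ) ^ 2 * #{x ∈ Z ×ˢ Z | f x.1 = f x.2} * (7 * (p : ℝ) ^ 3) := by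
  set ν : ZMod p → ℝ := fun s => #{z ∈ Z | f z = s} with hν
  set G : ZMod p → ℝ := fun s => ‖shiftQuotSum χ s‖ with hG
  have a1 : ∑ z ∈ Z, G (f z) ^ 2 = ∑ s, ν s * G s ^ 2 := by
    rw [← sum_fiberwise Z f]
    refine sum_congr rfl fun s _ => ?_
    rw [sum_congr rfl (g := fun _ => G s ^ 2) fun z hz => by rw [(mem_filter.1 hz).2], sum_const,
      nsmul_eq_mul]
  have a2 : ∑ s, ν s ^ 2 = #{x ∈ Z ×ˢ Z | f x.1 = f x.2} := by
    have : #{x ∈ Z ×ˢ Z | f x.1 = f x.2} = ∑ s, #{z ∈ Z | f z = s} ^ 2 := by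
      rw [card_eq_sum_card_fiberwise (f := fun x => f x.1) (t := univ) (fun _ _ => mem_coe.2 (mem_univ _))]
      refine sum_congr rfl fun s _ => ?_
      rw [pow_two, ← card_product]
      congr 1; ext ⟨x, y⟩
      simp only [mem_filter, mem_product]
      constructor
      · rintro ⟨⟨⟨h1, h2⟩, h3⟩, h4⟩; exact ⟨⟨h1, h4⟩, h2, h3 ▸ h4⟩
      · rintro ⟨⟨h1, h4⟩, h2, h3⟩; exact ⟨⟨⟨h1, h2⟩, h4.trans h3.symm⟩, h4⟩
    rw [this]; push_cast; rfl
  have c1 : (∑ z ∈ Z, G (f z)) ^ 2 ≤ #Z * ∑ z ∈ Z, G (f z) ^ 2 := sq_sum_le_card_mul_sum_sq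
  have c2 : (∑ s, ν s * G s ^ 2) ^ 2 ≤ (∑ s, ν s ^ 2) * ∑ s, (G s ^ 2) ^ 2 :=
    sum_mul_sq_le_sq_mul_sq _ _ _
  have c3 : ∑ s, (G s ^ 2) ^ 2 ≤ 7 * (p:ℝ) ^ 3 := by
    simp_rw [← pow_mul]; exact sum_shiftQuotSum_pow_four_le hχ hp
  rw [a1] at c1
  have hn : (0:ℝ) ≤ ∑ s, ν s * G s ^ 2 := sum_nonneg fun s _ => by simp only [hν]; positivity
  calc (∑ z ∈ Z, G (f z)) ^ 4 = ((∑ z ∈ Z, G (f z)) ^ 2) ^ 2 := by ring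
    _ ≤ (#Z * ∑ s, ν s * G s ^ 2) ^ 2 := pow_le_pow_left₀ (sq_nonneg _) c1 2
    _ = (#Z : ℝ) ^ 2 * (∑ s, ν s * G s ^ 2) ^ 2 := by ring
    _ ≤ (#Z : ℝ) ^ 2 * ((∑ s, ν s ^ 2) * ∑ s, (G s ^ 2) ^ 2) :=
      mul_le_mul_of_nonneg_left c2 (sq_nonneg _)
    _ ≤ (#Z : ℝ) ^ 2 * ((∑ s, ν s ^ 2) * (7 * (p:ℝ) ^ 3)) :=
      mul_le_mul_of_nonneg_left (mul_le_mul_of_nonneg_left c3 (sum_nonneg fun s _ => sq_nonneg _))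
        (sq_nonneg _)
    _ = _ := by rw [a2]; ring
end bilinear

theorem exists_card_divisors_le {ε : ℝ} (hε : 0 < ε) :
    ∃ C : ℝ, 1 ≤ C ∧ ∀ n : ℕ, n ≠ 0 → (#n.divisors : ℝ) ≤ C * (n : ℝ) ^ ε := by
  obtain ⟨B, hB⟩ := exists_nat_gt ((2:ℝ) ^ (1 / ε))
  have hl2 : 0 < Real.log 2 := Real.log_pos one_lt_two
  set C0 : ℝ := 1 + 1 / (ε * Real.log 2) with hC0
  have hC1 : 1 ≤ C0 := by rw [hC0]; have : 0 < 1 / (ε * Real.log 2) := by positivity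
                          linarith
  have hlocal : ∀ q a : ℕ, 2 ≤ q → ((a:ℝ) + 1) ≤ (if q < B then C0 else 1) * ((q:ℝ) ^ a) ^ ε := by
    intro q a hq
    have hq' : (2:ℝ) ≤ q := by exact_mod_cast hq
    split_ifs with h
    · have h1 : ((2:ℝ) ^ a) ^ ε ≤ ((q:ℝ) ^ a) ^ ε := by gcongr
      have h2 : 1 + (a:ℝ) * (ε * Real.log 2) ≤ ((2:ℝ) ^ a) ^ ε := by
        rw [Real.rpow_def_of_pos (by positivity), Real.log_pow]
        have := Real.add_one_le_exp ((a:ℝ) * Real.log 2 * ε)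
        linarith
      have h3 : (a:ℝ) + 1 ≤ C0 * (1 + (a:ℝ) * (ε * Real.log 2)) := by
        have hx : 0 < ε * Real.log 2 := by positivity
        have : C0 * (1 + (a:ℝ) * (ε * Real.log 2)) =
          1 + a + 1 / (ε * Real.log 2) + a * (ε * Real.log 2) := by rw [hC0]; field_simp; ring
        rw [this]
        have : 0 ≤ 1 / (ε * Real.log 2) + a * (ε * Real.log 2) := by positivity
        linarith
      exact h3.trans (mul_le_mul_of_nonneg_left (h2.trans h1) (by linarith))
    · have hqB : (2:ℝ) ^ (1 / ε) ≤ q := by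
        have : (B:ℝ) ≤ q := by exact_mod_cast not_lt.1 h
        linarith
      have h1 : (2:ℝ) ≤ (q:ℝ) ^ ε := by
        calc (2:ℝ) = ((2:ℝ) ^ (1 / ε)) ^ ε := by
              rw [← Real.rpow_mul (by norm_num), one_div, inv_mul_cancel₀ hε.ne', Real.rpow_one]
          _ ≤ _ := by gcongr
      have h2 : ((q:ℝ) ^ a) ^ ε = ((q:ℝ) ^ ε) ^ a := by
        rw [← Real.rpow_natCast, ← Real.rpow_mul (by positivity), mul_comm, Real.rpow_mul (by positivity),
          Real.rpow_natCast]
      rw [one_mul, h2]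
      have h3 : (a:ℝ) + 1 ≤ 2 ^ a := by
        have : a + 1 ≤ 2 ^ a := a.lt_two_pow_self
        exact_mod_cast this
      exact h3.trans (by gcongr)
  refine ⟨C0 ^ B, one_le_pow₀ hC1, fun n hn => ?_⟩
  have e1 : (#n.divisors : ℝ) = ∏ q ∈ n.primeFactors, ((n.factorization q : ℝ) + 1) := by
    rw [Nat.card_divisors hn]; push_cast; rfl
  have e2 : (n:ℝ) ^ ε = ∏ q ∈ n.primeFactors, ((q:ℝ) ^ (n.factorization q)) ^ ε := by
    rw [Real.finsetProd_rpow _ _ (fun i _ => by positivity)]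
    congr 1
    conv_lhs => rw [← Nat.prod_factorization_pow_eq_self hn]
    rw [Finsupp.prod, Nat.support_factorization]; push_cast; rfl
  rw [e1, e2]
  calc _ ≤ ∏ q ∈ n.primeFactors, ((if q < B then C0 else 1) * ((q:ℝ) ^ (n.factorization q)) ^ ε) :=
        prod_le_prod (fun q _ => by positivity) fun q hq =>
          hlocal q _ (Nat.prime_of_mem_primeFactors hq).two_le
    _ = (∏ q ∈ n.primeFactors, if q < B then C0 else 1) *
          ∏ q ∈ n.primeFactors, ((q:ℝ) ^ (n.factorization q)) ^ ε := prod_mul_distrib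
    _ ≤ _ := by
        refine mul_le_mul_of_nonneg_right ?_ (prod_nonneg fun q _ => by positivity)
        rw [prod_ite, prod_const, prod_const_one, mul_one]
        refine pow_le_pow_right₀ hC1 ?_
        calc _ ≤ #(range B) := card_le_card fun q hq => by simp at hq ⊢; exact hq.2
          _ = B := card_range _

section moments
variable {p : ℕ} [Fact p.Prime]

theorem card_pi_prod_eq_le {s : Finset ℕ} (j n : ℕ) (hn : n ≠ 0) :
    #{τ ∈ Fintype.piFinset (fun _ : Fin j => s) | ∏ i, τ i = n} ≤ #n.divisors ^ j := by
  calc _ ≤ #(Fintype.piFinset (fun _ : Fin j => n.divisors)) := by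
        refine card_le_card fun τ hτ => ?_
        rw [mem_filter] at hτ
        rw [Fintype.mem_piFinset]
        intro i
        rw [Nat.mem_divisors]
        exact ⟨hτ.2 ▸ dvd_prod_of_mem τ (mem_univ i), hn⟩
    _ = _ := by simp

theorem card_range_modEq_le (n : ℕ) (v : ZMod p) : #{x ∈ Icc 1 n | ((x:ℕ) : ZMod p) = v} ≤ n / p + 1 := by
  have hp : p.Prime := Fact.out
  refine (card_le_card_of_injOn (t := range (n / p + 1)) (fun x => x / p) ?_ ?_).trans (card_range _).le
  · intro x hx
    simp only [coe_filter, mem_Icc, Set.mem_ofPred_eq] at hx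
    simp only [coe_range, Set.mem_Iio]
    exact Nat.lt_succ_of_le (Nat.div_le_div_right hx.1.2)
  · intro x hx y hy hxy
    simp only [coe_filter, mem_Icc, Set.mem_ofPred_eq] at hx hy
    have h := (ZMod.natCast_eq_natCast_iff x y p).1 (hx.2.trans hy.2.symm)
    rw [← Nat.div_add_mod x p, ← Nat.div_add_mod y p, show x / p = y / p from hxy, h]

/-- Number of coincidences mod `p` among products of `j` small integers. -/
theorem card_prod_congr_le {X j : ℕ} {D : ℝ} (hD0 : 0 ≤ D)
    (hD : ∀ n, n ≠ 0 → n ≤ X ^ j → (#n.divisors : ℝ) ≤ D) :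
    (#{x ∈ Fintype.piFinset (fun _ : Fin j => Icc 1 X) ×ˢ Fintype.piFinset (fun _ : Fin j => Icc 1 X) |
      (∏ i, (x.1 i : ZMod p)) = ∏ i, (x.2 i : ZMod p)} : ℝ) ≤
      (X:ℝ) ^ j * (((X:ℝ) ^ j / p + 1) * D ^ j) := by
  have hp : p.Prime := Fact.out
  set P := Fintype.piFinset (fun _ : Fin j => Icc 1 X) with hP
  have hPc : (#P : ℝ) = (X:ℝ) ^ j := by simp [hP]
  have hprod : ∀ τ ∈ P, ∏ i, τ i ∈ Icc 1 (X ^ j) := by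
    intro τ hτ
    rw [hP, Fintype.mem_piFinset] at hτ
    rw [mem_Icc]
    refine ⟨Nat.one_le_iff_ne_zero.2 (prod_ne_zero_iff.2 fun i _ => ?_), ?_⟩
    · have := mem_Icc.1 (hτ i); omega
    · calc _ ≤ ∏ i : Fin j, X := prod_le_prod' fun i _ => (mem_Icc.1 (hτ i)).2
        _ = _ := by simp
  have key : ∀ v : ZMod p, (#{τ ∈ P | ∏ i, (τ i : ZMod p) = v} : ℝ) ≤ ((X:ℝ) ^ j / p + 1) * D ^ j := by
    intro v
    have h1 : #{τ ∈ P | ∏ i, (τ i : ZMod p) = v} ≤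
        ∑ n ∈ (Icc 1 (X ^ j)) with ((n:ℕ) : ZMod p) = v, #{τ ∈ P | ∏ i, τ i = n} := by
      rw [card_eq_sum_card_fiberwise (f := fun τ => ∏ i, τ i)
        (t := ({n ∈ Icc 1 (X ^ j) | ((n:ℕ) : ZMod p) = v}))]
      · refine sum_le_sum fun n _ => card_le_card fun τ hτ => ?_
        simp only [mem_filter] at hτ ⊢
        exact ⟨hτ.1.1, hτ.2⟩
      · intro τ hτ
        simp only [coe_filter, Set.mem_ofPred_eq] at hτ ⊢
        exact ⟨hprod τ hτ.1, by push_cast; exact hτ.2⟩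
    have h2 : ((∑ n ∈ (Icc 1 (X ^ j)) with ((n:ℕ) : ZMod p) = v, #{τ ∈ P | ∏ i, τ i = n} : ℕ) : ℝ) ≤
        ∑ n ∈ (Icc 1 (X ^ j)) with ((n:ℕ) : ZMod p) = v, D ^ j := by
      push_cast
      refine sum_le_sum fun n hn => ?_
      have hn' := mem_Icc.1 (mem_filter.1 hn).1
      calc (#{τ ∈ P | ∏ i, τ i = n} : ℝ) ≤ (#n.divisors : ℝ) ^ j := by
            exact_mod_cast card_pi_prod_eq_le j n (by omega)
        _ ≤ D ^ j := pow_le_pow_left₀ (Nat.cast_nonneg _) (hD n (by omega) hn'.2) j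
    rw [sum_const, nsmul_eq_mul] at h2
    have h3 : (#{n ∈ Icc 1 (X ^ j) | ((n:ℕ) : ZMod p) = v} : ℝ) ≤ (X:ℝ) ^ j / p + 1 := by
      calc _ ≤ ((X ^ j / p + 1 : ℕ) : ℝ) := by exact_mod_cast card_range_modEq_le (X ^ j) v
        _ ≤ _ := by
          push_cast
          have := Nat.cast_div_le (α := ℝ) (m := X ^ j) (n := p)
          push_cast at this
          linarith
    exact (Nat.cast_le.2 h1).trans (h2.trans (mul_le_mul_of_nonneg_right h3 (by positivity)))
  rw [card_filter, Nat.cast_sum, sum_product]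
  have : ∀ τ ∈ P, (∑ x ∈ P, ((if ∏ i, (τ i : ZMod p) = ∏ i, (x i : ZMod p) then 1 else 0 : ℕ) : ℝ)) ≤
      ((X:ℝ) ^ j / p + 1) * D ^ j := by
    intro τ _
    refine le_trans (le_of_eq ?_) (key (∏ i, (τ i : ZMod p)))
    rw [card_filter, Nat.cast_sum]
    exact sum_congr rfl fun x _ => by simp only [eq_comm]
  refine (sum_le_sum this).trans ?_
  rw [sum_const, nsmul_eq_mul, hPc]

/-- Even moments of character sums over short intervals. -/
theorem sum_char_pow_le {X j : ℕ} {D A : ℝ} (hA : 0 ≤ A) (hD0 : 0 ≤ D)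
    (hD : ∀ n, n ≠ 0 → n ≤ X ^ j → (#n.divisors : ℝ) ≤ D) (a : ℕ → ℂ) (ha : ∀ t ∈ Icc 1 X, ‖a t‖ ≤ A) :
    ∑ χ : DirichletCharacter ℂ p, ‖∑ t ∈ Icc 1 X, a t * χ t‖ ^ (2 * j) ≤
      p * A ^ (2 * j) * ((X:ℝ) ^ j * (((X:ℝ) ^ j / p + 1) * D ^ j)) := by
  set P := Fintype.piFinset (fun _ : Fin j => Icc 1 X) with hP
  have h1 : ∀ χ : DirichletCharacter ℂ p, ‖∑ t ∈ Icc 1 X, a t * χ t‖ ^ (2 * j) =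
      ‖∑ τ ∈ P, (∏ i, a (τ i)) * χ (∏ i, (τ i : ZMod p))‖ ^ 2 := by
    intro χ
    rw [mul_comm 2 j, pow_mul, ← norm_pow]
    congr 2
    have := prod_univ_sum (fun _ : Fin j => Icc 1 X) (fun _ t => a t * χ t)
    rw [prod_const, card_univ, Fintype.card_fin] at this
    rw [this]
    refine sum_congr rfl fun τ _ => ?_
    rw [prod_mul_distrib, map_prod]
  rw [sum_congr rfl fun χ _ => h1 χ]
  refine (sum_char_normSq_le P _ _).trans ?_
  have hpp : (p:ℝ) - 1 ≤ p := by linarith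
  have h2 : ∀ τ ∈ P, ‖∏ i, a (τ i)‖ ≤ A ^ j := by
    intro τ hτ
    rw [norm_prod]
    calc _ ≤ ∏ i : Fin j, A := prod_le_prod (fun _ _ => norm_nonneg _) fun i _ =>
          ha _ ((Fintype.mem_piFinset.1 hτ) i)
      _ = _ := by simp
  have h3 : ∑ i ∈ P, ∑ k ∈ P, (if (∏ l, (i l : ZMod p)) = ∏ l, (k l : ZMod p) ∧ (∏ l, (i l : ZMod p)) ≠ 0
      then ‖∏ l, a (i l)‖ * ‖∏ l, a (k l)‖ else 0) ≤
      A ^ (2 * j) * #{x ∈ P ×ˢ P | (∏ i, (x.1 i : ZMod p)) = ∏ i, (x.2 i : ZMod p)} := by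
    rw [card_filter, Nat.cast_sum, mul_sum, ← sum_product']
    refine sum_le_sum fun x hx => ?_
    rw [mem_product] at hx
    split_ifs with h4 h5 h5
    · rw [two_mul, pow_add]; simp
      exact mul_le_mul (by simpa using h2 _ hx.1) (by simpa using h2 _ hx.2) (by positivity) (by positivity)
    · exact absurd h4.1 h5
    · positivity
    · simp
  refine (mul_le_mul_of_nonneg_left h3 one_le_p_real).trans ?_
  rw [mul_assoc]
  refine mul_le_mul hpp ?_ (by positivity) (by positivity)
  exact mul_le_mul_of_nonneg_left (card_prod_congr_le hD0 hD) (by positivity)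
end moments

section repcount
variable {p : ℕ} [Fact p.Prime]

/-- Number of representations of `c ≠ 0` as a difference of inverses of small integers. -/
theorem card_inv_sub_inv_le {Y : ℕ} (hYp : Y < p) (hY : Y ^ 3 ≤ 8 * p) {D : ℝ}
    (hD : ∀ n : ℕ, n ≠ 0 → n ≤ 24 * p ^ 2 → (#n.divisors : ℝ) ≤ D) {c : ZMod p} (hc : c ≠ 0) :
    (#{x ∈ Icc 1 Y ×ˢ Icc 1 Y | (x.1 : ZMod p)⁻¹ - (x.2 : ZMod p)⁻¹ = c} : ℝ) ≤ 68 * D := by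
  have hp : p.Prime := Fact.out
  have hp0 : 0 < p := hp.pos
  have hD1 : 1 ≤ D := by
    have := hD 1 one_ne_zero (by nlinarith)
    simpa using this
  set R := {x ∈ Icc 1 Y ×ˢ Icc 1 Y | (x.1 : ZMod p)⁻¹ - (x.2 : ZMod p)⁻¹ = c} with hR
  rcases R.eq_empty_or_nonempty with he | ⟨⟨u, v⟩, huv⟩
  · rw [he]; simp; linarith
  have hmem : ∀ x y : ℕ, (x, y) ∈ R → (1 ≤ x ∧ x ≤ Y) ∧ (1 ≤ y ∧ y ≤ Y) ∧
      (x : ZMod p)⁻¹ - (y : ZMod p)⁻¹ = c ∧ (x : ZMod p) ≠ 0 ∧ (y : ZMod p) ≠ 0 := by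
    intro x y h
    simp only [hR, mem_filter, mem_product, mem_Icc] at h
    exact ⟨h.1.1, h.1.2, h.2, natCast_ne_zero_of_lt (by omega) (by omega),
      natCast_ne_zero_of_lt (by omega) (by omega)⟩
  have hfst : ∀ z ∈ R, ∀ z' ∈ R, z.1 = z'.1 → z = z' := by
    rintro ⟨x, y⟩ h ⟨x', y'⟩ h' (rfl : x = x')
    obtain ⟨_, h2, h3, _⟩ := hmem _ _ h
    obtain ⟨_, h2', h3', _⟩ := hmem _ _ h'
    have : (y : ZMod p)⁻¹ = (y' : ZMod p)⁻¹ := by linear_combination h3' - h3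
    rw [natCast_inj_of_lt (by omega) (by omega) (inv_injective this)]
  have hsnd : ∀ z ∈ R, ∀ z' ∈ R, z.2 = z'.2 → z = z' := by
    rintro ⟨x, y⟩ h ⟨x', y'⟩ h' (rfl : y = y')
    obtain ⟨h2, _, h3, _⟩ := hmem _ _ h
    obtain ⟨h2', _, h3', _⟩ := hmem _ _ h'
    have : (x : ZMod p)⁻¹ = (x' : ZMod p)⁻¹ := by linear_combination h3 - h3'
    rw [natCast_inj_of_lt (by omega) (by omega) (inv_injective this)]
  obtain ⟨hu, hv, huvc, hu0, hv0⟩ := hmem u v huv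
  set a : ℤ := (v : ℤ) - u with ha
  set b : ℤ := (u : ℤ) * v with hb
  have ha0 : a ≠ 0 := by
    intro h
    have : u = v := by omega
    subst this
    apply hc; rw [← huvc, sub_self]
  have hb0 : 0 < b := by rw [hb]; have := hu.1; have := hv.1; positivity
  have haY : |a| ≤ Y := by rw [abs_le]; constructor <;> omega
  have hbY : b ≤ (Y:ℤ) * Y := by rw [hb]; gcongr <;> omega
  have hY3 : (Y:ℤ) ^ 3 ≤ 8 * p := by exact_mod_cast hY
  have hYp' : (Y:ℤ) ≤ p := by exact_mod_cast hYp.le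
  -- every representation gives a small multiple of `p`
  have hE : ∀ x y : ℕ, (x, y) ∈ R → ∃ m ∈ Icc (-16 : ℤ) 16, a * x * y - b * (y - x) = p * m := by
    intro x y h
    obtain ⟨hx, hy, hxyc, hx0, hy0⟩ := hmem x y h
    have h1 : ((a * x * y - b * (y - x) : ℤ) : ZMod p) = 0 := by
      have e1 : ((v : ZMod p) - u) = c * (u * v) := by rw [← huvc]; field_simp
      have e2 : ((y : ZMod p) - x) = c * (x * y) := by rw [← hxyc]; field_simp
      rw [ha, hb]; push_cast
      linear_combination (x:ZMod p) * y * e1 - (u:ZMod p) * v * e2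
    obtain ⟨m, hm⟩ := (ZMod.intCast_zmod_eq_zero_iff_dvd _ p).1 h1
    have hxy : |(y:ℤ) - x| ≤ Y := by rw [abs_le]; constructor <;> omega
    have h2 : |a * x * y - b * (y - x)| ≤ 16 * p := by
      have b1 : |a * x * y| ≤ (Y:ℤ) ^ 3 := by
        rw [abs_mul, abs_mul, Nat.abs_cast, Nat.abs_cast]
        calc |a| * x * y ≤ Y * Y * Y := by gcongr <;> omega
          _ = _ := by ring
      have b2 : |b * (y - x)| ≤ (Y:ℤ) ^ 3 := by
        rw [abs_mul, abs_of_pos hb0]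
        calc b * |(y:ℤ) - x| ≤ Y * Y * Y := by gcongr
          _ = _ := by ring
      have := abs_sub (a * x * y) (b * (y - x))
      linarith
    refine ⟨m, ?_, hm⟩
    rw [hm, abs_mul, Nat.abs_cast] at h2
    have hpz : (0:ℤ) < p := by exact_mod_cast hp0
    have : |m| ≤ 16 := by nlinarith
    rw [mem_Icc]; exact abs_le.1 this
  set R1 := {z ∈ R | a * z.1 = b}
  set R2 := {z ∈ R | a * z.2 = -b}
  set R3 : ℤ → Finset (ℕ × ℕ) := fun m => {z ∈ R | a * p * m - b ^ 2 ≠ 0 ∧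
    a * z.1 * z.2 - b * (z.2 - z.1) = p * m} with hR3
  have hcov : R ⊆ (R1 ∪ R2) ∪ (Icc (-16 : ℤ) 16).biUnion R3 := by
    rintro ⟨x, y⟩ h
    obtain ⟨m, hm, hm2⟩ := hE x y h
    have hfac : (a * x - b) * (a * y + b) = a * p * m - b ^ 2 := by
      linear_combination a * hm2
    by_cases h0 : a * p * m - b ^ 2 = 0
    · rw [h0] at hfac
      refine mem_union_left _ ?_
      rcases mul_eq_zero.1 hfac with h1 | h1
      · exact mem_union_left _ (mem_filter.2 ⟨h, by simpa using sub_eq_zero.1 h1⟩)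
      · exact mem_union_right _ (mem_filter.2 ⟨h, by simpa using eq_neg_of_add_eq_zero_left h1⟩)
    · exact mem_union_right _ (mem_biUnion.2 ⟨m, hm, mem_filter.2 ⟨h, h0, hm2⟩⟩)
  have c1 : #R1 ≤ 1 := card_le_one.2 fun z hz z' hz' => by
    simp only [R1, mem_filter] at hz hz'
    refine hfst z hz.1 z' hz'.1 ?_
    have := mul_left_cancel₀ ha0 (hz.2.trans hz'.2.symm)
    exact_mod_cast this
  have c2 : #R2 ≤ 1 := card_le_one.2 fun z hz z' hz' => by
    simp only [R2, mem_filter] at hz hz'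
    refine hsnd z hz.1 z' hz'.1 ?_
    have := mul_left_cancel₀ ha0 (hz.2.trans hz'.2.symm)
    exact_mod_cast this
  have c3 : ∀ m ∈ Icc (-16 : ℤ) 16, (#(R3 m) : ℝ) ≤ 2 * D := by
    intro m hm
    rw [mem_Icc, ← abs_le] at hm
    by_cases h0 : a * p * m - b ^ 2 = 0
    · have : R3 m = ∅ := filter_false_of_mem fun z _ h => h.1 h0
      rw [this]; simp; linarith
    set h := (a * p * m - b ^ 2).natAbs with hh
    have hle : #(R3 m) ≤ #(h.divisors ×ˢ (univ : Finset Bool)) := by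
      refine card_le_card_of_injOn (fun z => ((a * z.1 - b).natAbs, decide (0 ≤ a * z.1 - b))) ?_ ?_
      · rintro ⟨x, y⟩ hz
        rw [mem_coe, hR3, mem_filter] at hz
        simp only [mem_coe, mem_product, mem_univ, and_true, Nat.mem_divisors]
        refine ⟨?_, by rw [hh]; exact Int.natAbs_ne_zero.2 h0⟩
        rw [hh, Int.natAbs_dvd_natAbs]
        refine ⟨a * y + b, ?_⟩
        have := hz.2.2
        simp only at this
        linear_combination -a * this
      · rintro z hz z' hz' heq
        rw [mem_coe, hR3, mem_filter] at hz hz'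
        refine hfst z hz.1 z' hz'.1 ?_
        simp only [Prod.mk.injEq, decide_eq_decide] at heq
        have : a * z.1 - b = a * z'.1 - b := by omega
        have := mul_left_cancel₀ ha0 (sub_left_injective this)
        exact_mod_cast this
    rw [card_product] at hle
    have hle' : (#(R3 m) : ℝ) ≤ #h.divisors * 2 := by
      have : #(R3 m) ≤ #h.divisors * 2 := by simpa using hle
      exact_mod_cast this
    have hsz : h ≤ 24 * p ^ 2 := by
      have hz : (h : ℤ) ≤ 24 * p ^ 2 := by
        rw [hh, Int.natCast_natAbs]
        have b1 : |a * p * m| ≤ 16 * (p:ℤ) ^ 2 := by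
          rw [abs_mul, abs_mul, Nat.abs_cast]
          calc |a| * p * |m| ≤ p * p * 16 := by gcongr; exact haY.trans hYp'
            _ = _ := by ring
        have b2 : |b ^ 2| ≤ 8 * (p:ℤ) ^ 2 := by
          rw [abs_of_nonneg (sq_nonneg _)]
          calc b ^ 2 ≤ ((Y:ℤ) * (Y:ℤ)) ^ (2:ℕ) := pow_le_pow_left₀ hb0.le hbY 2
            _ = (Y:ℤ) ^ 3 * (Y:ℤ) := by ring
            _ ≤ (8 * (p:ℤ)) * (p:ℤ) := by gcongr
            _ = 8 * (p:ℤ) ^ 2 := by ring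
        have := abs_sub (a * p * m) (b ^ 2)
        linarith
      exact_mod_cast hz
    have := hD h (by rw [hh]; exact Int.natAbs_ne_zero.2 h0) hsz
    linarith
  have c4 : (#((Icc (-16 : ℤ) 16).biUnion R3) : ℝ) ≤ 33 * (2 * D) := by
    calc _ ≤ ((∑ m ∈ Icc (-16 : ℤ) 16, #(R3 m) : ℕ) : ℝ) := by exact_mod_cast card_biUnion_le
      _ ≤ ∑ m ∈ Icc (-16 : ℤ) 16, 2 * D := by push_cast; exact sum_le_sum c3
      _ = _ := by rw [sum_const]; simp
  have c5 : (#R : ℝ) ≤ 2 + 33 * (2 * D) := by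
    have h1 := card_le_card hcov
    have h2 := card_union_le (R1 ∪ R2) ((Icc (-16 : ℤ) 16).biUnion R3)
    have h3 := card_union_le R1 R2
    have h4 : #R ≤ 2 + #((Icc (-16 : ℤ) 16).biUnion R3) := by omega
    have h5 : (#R : ℝ) ≤ 2 + #((Icc (-16 : ℤ) 16).biUnion R3) := by exact_mod_cast h4
    linarith
  linarith
end repcount

section Qbound

theorem card_filter_product_le_mul {α β : Type*} (s : Finset α) (t : Finset β)
    (r : α → β → Prop) [DecidableRel r] {B : ℝ}
    (h : ∀ x ∈ s, (#{y ∈ t | r x y} : ℝ) ≤ B) :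
    (#{z ∈ s ×ˢ t | r z.1 z.2} : ℝ) ≤ #s * B := by
  have : #{z ∈ s ×ˢ t | r z.1 z.2} = ∑ x ∈ s, #{y ∈ t | r x y} := by
    rw [card_filter, sum_product]
    exact sum_congr rfl fun x _ => by rw [card_filter]
  rw [this]; push_cast
  calc _ ≤ ∑ x ∈ s, B := sum_le_sum h
    _ = _ := by rw [sum_const, nsmul_eq_mul]

theorem sum_sq_mul_sq_le {ι : Type*} (s : Finset ι) (a b : ι → ℝ)
    {A₁ A₂ A₃ R : ℝ} (h₁ : 0 < A₁) (h₂ : 0 < A₂) (h₃ : 0 < A₃) (hR : 0 < R)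
    (hR3 : A₁ * A₂ * A₃ ≤ R ^ 3) (e₁ : ∑ i ∈ s, a i ^ 2 ≤ A₁) (e₂ : ∑ i ∈ s, a i ^ 4 ≤ A₂)
    (e₃ : ∑ i ∈ s, b i ^ 6 ≤ A₃) : ∑ i ∈ s, a i ^ 2 * b i ^ 2 ≤ R := by
  have amgm : ∀ u v w : ℝ, 0 ≤ u → 0 ≤ v → 0 ≤ w → u * v * w ≤ ((u + v + w) / 3) ^ 3 := by
    intro u v w hu hv hw
    nlinarith [mul_nonneg hu (sq_nonneg (v - w)), mul_nonneg hv (sq_nonneg (u - w)),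
      mul_nonneg hw (sq_nonneg (u - v)), mul_nonneg (add_nonneg (add_nonneg hu hv) hw)
        (add_nonneg (add_nonneg (sq_nonneg (u - v)) (sq_nonneg (v - w))) (sq_nonneg (u - w)))]
  have key : ∀ i, a i ^ 2 * b i ^ 2 ≤ R * ((a i ^ 2 / A₁ + a i ^ 4 / A₂ + b i ^ 6 / A₃) / 3) := by
    intro i
    have hu : 0 ≤ a i ^ 2 / A₁ := by positivity
    have hv : 0 ≤ a i ^ 4 / A₂ := by positivity
    have hw : 0 ≤ b i ^ 6 / A₃ := by positivity
    refine le_of_pow_le_pow_left₀ three_ne_zero (by positivity) ?_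
    calc (a i ^ 2 * b i ^ 2) ^ 3 = (A₁ * A₂ * A₃) * (a i ^ 2 / A₁ * (a i ^ 4 / A₂) * (b i ^ 6 / A₃)) := by
          field_simp
      _ ≤ R ^ 3 * (a i ^ 2 / A₁ * (a i ^ 4 / A₂) * (b i ^ 6 / A₃)) := by gcongr
      _ ≤ R ^ 3 * ((a i ^ 2 / A₁ + a i ^ 4 / A₂ + b i ^ 6 / A₃) / 3) ^ 3 := by
          gcongr; exact amgm _ _ _ hu hv hw
      _ = _ := (mul_pow _ _ _).symm
  calc _ ≤ ∑ i ∈ s, R * ((a i ^ 2 / A₁ + a i ^ 4 / A₂ + b i ^ 6 / A₃) / 3) :=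
        sum_le_sum fun i _ => key i
    _ = R * (((∑ i ∈ s, a i ^ 2) / A₁ + (∑ i ∈ s, a i ^ 4) / A₂ + (∑ i ∈ s, b i ^ 6) / A₃) / 3) := by
        rw [← mul_sum, ← sum_div, sum_add_distrib, sum_add_distrib, sum_div, sum_div, sum_div]
    _ ≤ R * ((1 + 1 + 1) / 3) := by
        gcongr <;> rw [div_le_one (by assumption)] <;> assumption
    _ = R := by ring

variable {p : ℕ} [Fact p.Prime]

/-- Pairs of distinct elements. -/
def offPairs (S : Finset ℕ) : Finset (ℕ × ℕ) := {x ∈ S ×ˢ S | x.1 ≠ x.2}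

/-- Difference of inverses modulo `p`. -/
def invSub (p : ℕ) (x : ℕ × ℕ) : ZMod p := (x.1 : ZMod p)⁻¹ - (x.2 : ZMod p)⁻¹

theorem invSub_ne_zero {Y : ℕ} (hYp : Y < p) {S : Finset ℕ} (hS : S ⊆ Icc 1 Y) {x : ℕ × ℕ}
    (hx : x ∈ offPairs S) : invSub p x ≠ 0 := by
  simp only [offPairs, mem_filter, mem_product] at hx
  intro h
  have h1 := mem_Icc.1 (hS hx.1.1)
  have h2 := mem_Icc.1 (hS hx.1.2)
  exact hx.2 (natCast_inj_of_lt (by omega) (by omega) (inv_injective (sub_eq_zero.1 h)))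

theorem card_offPairs_le (S : Finset ℕ) : #(offPairs S) ≤ #S ^ 2 := by
  rw [sq, ← card_product]; exact card_filter_le _ _

section moments
variable {Y : ℕ} (hYp : Y < p) {S : Finset ℕ} (hS : S ⊆ Icc 1 Y) {B : ℝ}
  (hB : ∀ c : ZMod p, c ≠ 0 → (#{x ∈ offPairs S | invSub p x = c} : ℝ) ≤ B)
include hYp hS hB

theorem sum_invSub_pow_two_le :
    ∑ χ : DirichletCharacter ℂ p, ‖∑ x ∈ offPairs S, χ (invSub p x)‖ ^ 2
      ≤ ((p : ℝ) - 1) * ((#S : ℝ) ^ 2 * B) := by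
  rw [sum_char_normSq_count]
  have hp1 := one_le_p_real (p := p)
  refine mul_le_mul_of_nonneg_left ?_ hp1
  refine (card_filter_product_le_mul (offPairs S) (offPairs S)
    (fun x y => invSub p x = invSub p y ∧ invSub p x ≠ 0) (B := B) ?_).trans ?_
  · intro x hx
    refine le_trans ?_ (hB _ (invSub_ne_zero hYp hS hx))
    refine Nat.cast_le.2 (card_le_card fun y hy => ?_)
    rw [mem_filter] at hy ⊢
    exact ⟨hy.1, hy.2.1.symm⟩
  · have hB0 : 0 ≤ B := le_trans (Nat.cast_nonneg _) (hB 1 one_ne_zero)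
    gcongr
    exact_mod_cast card_offPairs_le S

theorem sum_invSub_pow_four_le :
    ∑ χ : DirichletCharacter ℂ p, ‖∑ x ∈ offPairs S, χ (invSub p x)‖ ^ 4
      ≤ ((p : ℝ) - 1) * ((#S : ℝ) ^ 6 * B) := by
  have hp1 := one_le_p_real (p := p)
  have h1 : ∀ χ : DirichletCharacter ℂ p, ‖∑ x ∈ offPairs S, χ (invSub p x)‖ ^ 4
      = ‖∑ z ∈ offPairs S ×ˢ offPairs S, χ (invSub p z.1 * invSub p z.2)‖ ^ 2 := by
    intro χ
    simp_rw [map_mul]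
    rw [sum_product]
    dsimp only
    rw [← sum_mul_sum, norm_mul]; ring
  rw [sum_congr rfl fun χ _ => h1 χ, sum_char_normSq_count]
  refine mul_le_mul_of_nonneg_left ?_ hp1
  have hB0 : 0 ≤ B := le_trans (Nat.cast_nonneg _) (hB 1 one_ne_zero)
  have hcard : (#(offPairs S) : ℝ) ≤ (#S : ℝ) ^ 2 := by exact_mod_cast card_offPairs_le S
  refine (card_filter_product_le_mul (offPairs S ×ˢ offPairs S) (offPairs S ×ˢ offPairs S)
    (fun x y => invSub p x.1 * invSub p x.2 = invSub p y.1 * invSub p y.2 ∧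
      invSub p x.1 * invSub p x.2 ≠ 0) (B := (#S : ℝ) ^ 2 * B) ?_).trans ?_
  · intro x hx
    refine (card_filter_product_le_mul (offPairs S) (offPairs S)
      (fun u v => invSub p x.1 * invSub p x.2 = invSub p u * invSub p v ∧
      invSub p x.1 * invSub p x.2 ≠ 0) (B := B) ?_).trans (by gcongr)
    intro u hu
    have hu0 := invSub_ne_zero hYp hS hu
    rw [mem_product] at hx
    have hx0 := mul_ne_zero (invSub_ne_zero hYp hS hx.1) (invSub_ne_zero hYp hS hx.2)
    refine le_trans ?_ (hB (invSub p x.1 * invSub p x.2 / invSub p u) (div_ne_zero hx0 hu0))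
    refine Nat.cast_le.2 (card_le_card fun y hy => ?_)
    rw [mem_filter] at hy ⊢
    refine ⟨hy.1, ?_⟩
    rw [eq_div_iff hu0, hy.2.1]; ring
  · rw [card_product]; push_cast
    calc (#(offPairs S) : ℝ) * #(offPairs S) * ((#S : ℝ) ^ 2 * B)
        ≤ (#S : ℝ) ^ 2 * (#S : ℝ) ^ 2 * ((#S : ℝ) ^ 2 * B) := by gcongr
      _ = _ := by ring

/-- Solutions of `d t = d' t'` with `t, t' ≤ X`. -/
theorem card_ratio_le {D : ℝ} (hD1 : 1 ≤ D) (hB1 : 1 ≤ B) {X : ℕ}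
    (hX1 : 1 ≤ X)
    (hD : ∀ n : ℕ, n ≠ 0 → n ≤ X ^ 3 → (#n.divisors : ℝ) ≤ D) {κ q : ℝ} (hκ : 0 < κ)
    (hκS : κ ^ 3 = #S) (hq : 0 < q) (hqp : q ^ 6 * p = 1) :
    (#{x ∈ (offPairs S ×ˢ Icc 1 X) ×ˢ (offPairs S ×ˢ Icc 1 X) |
      invSub p x.1.1 * (x.1.2 : ZMod p) = invSub p x.2.1 * (x.2.2 : ZMod p) ∧
      invSub p x.1.1 * (x.1.2 : ZMod p) ≠ 0} : ℝ)
      ≤ 2 * B * D * κ ^ 8 * (X + X ^ 2 * q ^ 2) := by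
  have hp : p.Prime := Fact.out
  have hp2 : (2:ℝ) ≤ p := by exact_mod_cast hp.two_le
  have hcount := sum_char_normSq_count (p := p) (offPairs S ×ˢ Icc 1 X)
    (fun z => invSub p z.1 * (z.2 : ZMod p))
  have h1 : ∀ χ : DirichletCharacter ℂ p,
      ‖∑ z ∈ offPairs S ×ˢ Icc 1 X, χ (invSub p z.1 * (z.2 : ZMod p))‖ ^ 2
      = ‖∑ x ∈ offPairs S, χ (invSub p x)‖ ^ 2 * ‖∑ t ∈ Icc 1 X, χ (t : ZMod p)‖ ^ 2 := by
    intro χ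
    simp_rw [map_mul]
    rw [sum_product]
    dsimp only
    rw [← sum_mul_sum, norm_mul]; ring
  rw [sum_congr rfl fun χ _ => h1 χ] at hcount
  have hS0 : (0:ℝ) < #S := by rw [← hκS]; positivity
  have hX1' : (1:ℝ) ≤ X := by exact_mod_cast hX1
  have m6 := sum_char_pow_le (p := p) (X := X) (j := 3) (A := 1) zero_le_one (by linarith) hD (fun _ => 1)
    (by simp)
  simp only [one_mul, one_pow, mul_one] at m6
  have hpX : (X:ℝ) ^ 3 * q ^ 6 = (X:ℝ) ^ 3 / p := by
    rw [eq_div_iff (by linarith), mul_assoc, hqp, mul_one]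
  set R : ℝ := p * (B * D * κ ^ 8 * (X + X ^ 2 * q ^ 2)) with hR
  have hfin := sum_sq_mul_sq_le univ (fun χ : DirichletCharacter ℂ p => ‖∑ x ∈ offPairs S, χ (invSub p x)‖)
    (fun χ => ‖∑ t ∈ Icc 1 X, χ (t : ZMod p)‖) (A₁ := p * ((#S : ℝ) ^ 2 * B))
    (A₂ := p * ((#S : ℝ) ^ 6 * B)) (A₃ := p * ((X:ℝ) ^ 3 * ((X:ℝ) ^ 3 / p + 1) * D ^ 3))
    (R := R) (by positivity) (by positivity) (by positivity) (by positivity) ?_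
    ((sum_invSub_pow_two_le hYp hS hB).trans (by gcongr; linarith))
    ((sum_invSub_pow_four_le hYp hS hB).trans (by gcongr; linarith)) ?_
  · rw [hcount] at hfin
    have : (p:ℝ) / 2 ≤ (p:ℝ) - 1 := by linarith
    have h3 := (mul_le_mul_of_nonneg_right this (Nat.cast_nonneg _)).trans hfin
    rw [hR] at h3
    have hp0 : (0:ℝ) < p := by linarith
    refine le_of_mul_le_mul_left ?_ (half_pos hp0)
    refine h3.trans (le_of_eq (by ring))
  · rw [hR, ← hpX, ← hκS]
    have e1 : (X:ℝ) ^ 3 * q ^ 6 + 1 ≤ (1 + X * q ^ 2) ^ 3 := by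
      have : 0 ≤ X * q ^ 2 := by positivity
      nlinarith [sq_nonneg (X * q ^ 2)]
    calc p * ((κ ^ 3) ^ 2 * B) * (p * ((κ ^ 3) ^ 6 * B)) * (p * ((X:ℝ) ^ 3 * ((X:ℝ) ^ 3 * q ^ 6 + 1) * D ^ 3))
        ≤ p * ((κ ^ 3) ^ 2 * B) * (p * ((κ ^ 3) ^ 6 * B)) * (p * ((X:ℝ) ^ 3 * ((1 + X * q ^ 2) ^ 3) * D ^ 3)) := by
          gcongr
      _ = (p ^ 3 * κ ^ 24 * B ^ 2 * (X:ℝ) ^ 3 * (1 + X * q ^ 2) ^ 3 * D ^ 3) * 1 := by ring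
      _ ≤ (p ^ 3 * κ ^ 24 * B ^ 2 * (X:ℝ) ^ 3 * (1 + X * q ^ 2) ^ 3 * D ^ 3) * B := by gcongr
      _ = _ := by ring
  · refine m6.trans (le_of_eq ?_)
    ring

end moments
end Qbound

section Qbound2
variable {p : ℕ} [Fact p.Prime]

theorem sum_inv_Icc_le (n : ℕ) : ∑ g ∈ Icc 1 n, ((g:ℝ))⁻¹ ≤ 1 + Real.log n := by
  have := harmonic_le_one_add_log n
  rw [harmonic_eq_sum_Icc] at this
  push_cast at this
  exact this

/-- Solutions of `d t = d' t'` with `t, t' < T`, for differences of inverses `d, d'`. -/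
theorem card_invSub_mul_eq_le {Y : ℕ} (hYp : Y < p) {S : Finset ℕ} (hS : S ⊆ Icc 1 Y) {B : ℝ}
    (hB : ∀ c : ZMod p, c ≠ 0 → (#{x ∈ offPairs S | invSub p x = c} : ℝ) ≤ B) (hB1 : 1 ≤ B)
    {D : ℝ} (hD1 : 1 ≤ D) {T : ℕ} (hT1 : 1 ≤ T) (hT : T ^ 2 ≤ p)
    (hD : ∀ n : ℕ, n ≠ 0 → n ≤ T ^ 3 → (#n.divisors : ℝ) ≤ D) {κ q : ℝ} (hκ : 0 < κ)
    (hκS : κ ^ 3 = #S) (hq : 0 < q) (hqp : q ^ 6 * p = 1) :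
    (#{x ∈ (offPairs S ×ˢ Ico 1 T) ×ˢ (offPairs S ×ˢ Ico 1 T) |
      invSub p x.1.1 * (x.1.2 : ZMod p) = invSub p x.2.1 * (x.2.2 : ZMod p)} : ℝ)
      ≤ 2 * B * D * (κ ^ 8 + κ ^ 10 * q) * (T * (1 + Real.log T)) := by
  set W := {x ∈ (offPairs S ×ˢ Ico 1 T) ×ˢ (offPairs S ×ˢ Ico 1 T) |
      invSub p x.1.1 * (x.1.2 : ZMod p) = invSub p x.2.1 * (x.2.2 : ZMod p)} with hW
  have hp : p.Prime := Fact.out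
  have hTp : T ≤ p := by nlinarith
  set V : ℕ → Finset (((ℕ × ℕ) × ℕ) × ((ℕ × ℕ) × ℕ)) := fun X =>
    {x ∈ (offPairs S ×ˢ Icc 1 X) ×ˢ (offPairs S ×ˢ Icc 1 X) |
      invSub p x.1.1 * (x.1.2 : ZMod p) = invSub p x.2.1 * (x.2.2 : ZMod p) ∧
      invSub p x.1.1 * (x.1.2 : ZMod p) ≠ 0} with hV
  set U : ℕ → Finset (((ℕ × ℕ) × ℕ) × ((ℕ × ℕ) × ℕ)) := fun X =>
    {x ∈ V X | Nat.Coprime x.1.2 x.2.2} with hU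
  have hmaps : ∀ x ∈ W, Nat.gcd x.1.2 x.2.2 ∈ Icc 1 (T - 1) := by
    intro x hx
    simp only [hW, mem_filter, mem_product, mem_Ico] at hx
    rw [mem_Icc]
    have h1 := Nat.gcd_pos_of_pos_left x.2.2 (show 0 < x.1.2 by omega)
    have h2 := Nat.gcd_le_left x.2.2 (show 0 < x.1.2 by omega)
    omega
  have h1 : #W = ∑ g ∈ Icc 1 (T - 1), #{x ∈ W | Nat.gcd x.1.2 x.2.2 = g} :=
    card_eq_sum_card_fiberwise hmaps
  have h2 : ∀ g ∈ Icc 1 (T - 1), #{x ∈ W | Nat.gcd x.1.2 x.2.2 = g} ≤ #(U ((T - 1) / g)) := by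
    intro g hg
    rw [mem_Icc] at hg
    refine card_le_card_of_injOn (fun x => ((x.1.1, x.1.2 / g), (x.2.1, x.2.2 / g))) ?_ ?_
    · rintro ⟨⟨x, t⟩, ⟨y, s⟩⟩ hx
      simp only [hW, coe_filter, mem_filter, mem_product, mem_Ico, Set.mem_ofPred_eq] at hx
      obtain ⟨⟨⟨⟨hxP, ht⟩, hyP, hs⟩, he⟩, hgcd⟩ := hx
      have hgt : g ∣ t := hgcd ▸ Nat.gcd_dvd_left t s
      have hgs : g ∣ s := hgcd ▸ Nat.gcd_dvd_right t s
      obtain ⟨t', rfl⟩ := hgt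
      obtain ⟨s', rfl⟩ := hgs
      have hg0 : 0 < g := hg.1
      have ht0 : 0 < t' := Nat.pos_of_mul_pos_left (show 0 < g * t' by omega)
      have hs0 : 0 < s' := Nat.pos_of_mul_pos_left (show 0 < g * s' by omega)
      have hgp : (g : ZMod p) ≠ 0 := natCast_ne_zero_of_lt hg0 (by omega)
      have htle : t' ≤ (T - 1) / g := by rw [Nat.le_div_iff_mul_le hg0, mul_comm]; omega
      have hsle : s' ≤ (T - 1) / g := by rw [Nat.le_div_iff_mul_le hg0, mul_comm]; omega
      have htp : (t' : ZMod p) ≠ 0 := natCast_ne_zero_of_lt ht0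
        (by have := Nat.le_mul_of_pos_left t' hg0; omega)
      simp only [hU, hV, coe_filter, mem_filter, mem_product, mem_Icc, Set.mem_ofPred_eq,
        Nat.mul_div_cancel_left _ hg0]
      push_cast at he
      refine ⟨⟨⟨⟨hxP, ht0, htle⟩, hyP, hs0, hsle⟩, ?_, ?_⟩, ?_⟩
      · apply mul_left_cancel₀ hgp
        linear_combination he
      · exact mul_ne_zero (invSub_ne_zero hYp hS hxP) htp
      · rw [Nat.gcd_mul_left] at hgcd
        exact Nat.eq_of_mul_eq_mul_left hg0 (by rw [hgcd, mul_one])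
    · rintro ⟨⟨x, t⟩, ⟨y, s⟩⟩ hx ⟨⟨x', t'⟩, ⟨y', s'⟩⟩ hx' heq
      simp only [coe_filter, Set.mem_ofPred_eq] at hx hx'
      simp only [Prod.mk.injEq] at heq ⊢
      obtain ⟨⟨e1, e2⟩, e3, e4⟩ := heq
      have a1 : g ∣ t := hx.2 ▸ Nat.gcd_dvd_left t s
      have a2 : g ∣ s := hx.2 ▸ Nat.gcd_dvd_right t s
      have a3 : g ∣ t' := hx'.2 ▸ Nat.gcd_dvd_left t' s'
      have a4 : g ∣ s' := hx'.2 ▸ Nat.gcd_dvd_right t' s'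
      exact ⟨⟨e1, Nat.div_left_inj a1 a3 |>.1 e2⟩, e3, Nat.div_left_inj a2 a4 |>.1 e4⟩
  have h3 : ∀ X < T, (#(U X) : ℝ) ≤ κ ^ 12 := by
    intro X hX
    have : #(U X) ≤ #(offPairs S ×ˢ offPairs S) := by
      refine card_le_card_of_injOn (fun x => (x.1.1, x.2.1)) ?_ ?_
      · rintro ⟨⟨x, t⟩, ⟨y, s⟩⟩ hx
        simp only [hU, hV, coe_filter, mem_filter, mem_product, Set.mem_ofPred_eq] at hx
        simp only [mem_coe, mem_product]
        exact ⟨hx.1.1.1.1, hx.1.1.2.1⟩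
      · rintro ⟨⟨x, t⟩, ⟨y, s⟩⟩ hx ⟨⟨x', t'⟩, ⟨y', s'⟩⟩ hx' heq
        simp only [Prod.mk.injEq] at heq
        obtain ⟨rfl, rfl⟩ := heq
        simp only [hU, hV, coe_filter, mem_filter, mem_product, mem_Icc, Set.mem_ofPred_eq] at hx hx'
        obtain ⟨⟨⟨⟨hxP, ht⟩, hyP, hs⟩, he, -⟩, hgcd⟩ := hx
        obtain ⟨⟨⟨⟨-, ht'⟩, -, hs'⟩, he', -⟩, hgcd'⟩ := hx'
        have hx0 := invSub_ne_zero hYp hS hxP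
        have hy0 := invSub_ne_zero hYp hS hyP
        have hm : ((t * s' : ℕ) : ZMod p) = ((t' * s : ℕ) : ZMod p) := by
          push_cast
          apply mul_left_cancel₀ (mul_ne_zero hx0 hy0)
          linear_combination (invSub p y * (s' : ZMod p)) * he - (invSub p y * (s : ZMod p)) * he'
        have hm' : t * s' = t' * s := by
          refine natCast_inj_of_lt ?_ ?_ hm <;> nlinarith
        have d1 : t ∣ t' := (hgcd.dvd_of_dvd_mul_right (hm' ▸ Dvd.intro _ rfl))
        have d2 : t' ∣ t := (hgcd'.dvd_of_dvd_mul_right (hm' ▸ Dvd.intro _ rfl))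
        have htt := Nat.dvd_antisymm d1 d2
        subst htt
        have : s' = s := Nat.eq_of_mul_eq_mul_left (show 0 < t by omega) hm'
        subst this
        rfl
    have h4 := card_offPairs_le S
    rw [card_product] at this
    have h5 : (#(U X) : ℝ) ≤ (#S : ℝ) ^ 2 * (#S : ℝ) ^ 2 := by
      exact_mod_cast this.trans (Nat.mul_le_mul h4 h4)
    rw [← hκS] at h5
    refine h5.trans (le_of_eq (by ring))
  have h4 : ∀ g ∈ Icc 1 (T - 1), (#(U ((T - 1) / g)) : ℝ) ≤
      2 * B * D * (κ ^ 8 + κ ^ 10 * q) * (T * (g:ℝ)⁻¹) := by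
    intro g hg
    rw [mem_Icc] at hg
    set X := (T - 1) / g with hX
    have hX1 : 1 ≤ X := by rw [hX, Nat.le_div_iff_mul_le (by omega)]; omega
    have hXT : X < T := lt_of_le_of_lt (Nat.div_le_self _ _) (by omega)
    have hg0 : (0:ℝ) < g := by exact_mod_cast hg.1
    have hXg : (X:ℝ) ≤ T * (g:ℝ)⁻¹ := by
      rw [← div_eq_mul_inv, le_div_iff₀ hg0]
      have : X * g ≤ T - 1 := Nat.div_mul_le_self _ _
      have : X * g ≤ T := by omega
      exact_mod_cast this
    have hc := card_ratio_le hYp hS hB hD1 hB1 hX1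
      (fun n h0 hn => hD n h0 (hn.trans (Nat.pow_le_pow_left hXT.le 3))) hκ hκS hq hqp
    have hUV : (#(U X) : ℝ) ≤ #(V X) := Nat.cast_le.2 (card_le_card (filter_subset _ _))
    have hb := hUV.trans hc
    have hX0 : (0:ℝ) < X := by exact_mod_cast hX1
    have hE : (1:ℝ) ≤ 2 * B * D := by nlinarith
    set E := 2 * B * D
    have key : (#(U X) : ℝ) ≤ E * (κ ^ 8 + κ ^ 10 * q) * X := by
      rcases le_total (κ ^ 2) (E * X * q) with hle | hle
      · refine (h3 X hXT).trans ?_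
        calc κ ^ 12 = κ ^ 10 * κ ^ 2 := by ring
          _ ≤ κ ^ 10 * (E * X * q) := by gcongr
          _ ≤ E * (κ ^ 8 + κ ^ 10 * q) * X := by
            have : 0 ≤ E * κ ^ 8 * X := by positivity
            linarith
      · refine hb.trans ?_
        have : E * κ ^ 8 * X ^ 2 * q ^ 2 ≤ E * (κ ^ 10 * q) * X := by
          calc E * κ ^ 8 * X ^ 2 * q ^ 2 = κ ^ 8 * X * q * (E * X * q) := by ring
            _ ≤ κ ^ 8 * X * q * κ ^ 2 := by gcongr
            _ = 1 * (κ ^ 10 * q) * X := by ring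
            _ ≤ _ := by gcongr
        linarith
    refine key.trans ?_
    gcongr
  have hlog : (∑ g ∈ Icc 1 (T - 1), (g:ℝ)⁻¹) ≤ 1 + Real.log T := by
    refine (sum_inv_Icc_le (T - 1)).trans ?_
    rcases Nat.eq_zero_or_pos (T - 1) with h0 | h0
    · rw [h0]; simp; exact Real.log_nonneg (by exact_mod_cast hT1)
    · have : Real.log ((T - 1 : ℕ) : ℝ) ≤ Real.log T :=
        Real.log_le_log (by exact_mod_cast h0) (by exact_mod_cast Nat.sub_le _ _)
      linarith
  calc (#W : ℝ) = ∑ g ∈ Icc 1 (T - 1), (#{x ∈ W | Nat.gcd x.1.2 x.2.2 = g} : ℝ) := by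
        rw [h1]; push_cast; rfl
    _ ≤ ∑ g ∈ Icc 1 (T - 1), 2 * B * D * (κ ^ 8 + κ ^ 10 * q) * (T * (g:ℝ)⁻¹) :=
        sum_le_sum fun g hg => (Nat.cast_le.2 (h2 g hg)).trans (h4 g hg)
    _ = 2 * B * D * (κ ^ 8 + κ ^ 10 * q) * (T * ∑ g ∈ Icc 1 (T - 1), (g:ℝ)⁻¹) := by
        rw [← mul_sum, ← mul_sum]
    _ ≤ _ := by gcongr
end Qbound2

section growth

theorem exists_log_pow_le_rpow (C : ℝ) (j : ℕ) {ε : ℝ} (hε : 0 < ε) :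
    ∃ P : ℕ, ∀ p : ℕ, P ≤ p → C * (1 + Real.log p) ^ j ≤ (p : ℝ) ^ ε := by
  have h1 : (fun x : ℝ => C * (1 + Real.log x) ^ j) =o[Filter.atTop] fun x : ℝ => x ^ ε := by
    refine Asymptotics.IsLittleO.const_mul_left ?_ C
    have h2 : (fun x : ℝ => (1 + Real.log x)) =O[Filter.atTop] fun x : ℝ => Real.log x := by
      refine Asymptotics.IsBigO.add ?_ (Asymptotics.isBigO_refl _ _)
      exact (Real.isLittleO_const_log_atTop (c := 1)).isBigO
    have h3 := h2.pow j
    refine h3.trans_isLittleO ?_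
    have := isLittleO_log_rpow_rpow_atTop (j : ℝ) hε
    simpa using this
  have h2 := (h1.bound zero_lt_one)
  have h3 := tendsto_natCast_atTop_atTop (R := ℝ) |>.eventually h2
  obtain ⟨P, hP⟩ := Filter.eventually_atTop.1 h3
  refine ⟨P, fun p hp => ?_⟩
  have := hP p hp
  rw [one_mul, Real.norm_of_nonneg (Real.rpow_nonneg (Nat.cast_nonneg p) ε)] at this
  exact (le_abs_self _).trans this

theorem exists_card_divisors_le_rpow {ε : ℝ} (hε : 0 < ε) :
    ∃ P : ℕ, ∀ p : ℕ, P ≤ p → ∀ n : ℕ, n ≠ 0 → n ≤ 24 * p ^ 2 →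
      (#n.divisors : ℝ) ≤ (p : ℝ) ^ ε := by
  obtain ⟨C, hC, h⟩ := exists_card_divisors_le (show 0 < ε / 4 by linarith)
  obtain ⟨P, hP⟩ := exists_log_pow_le_rpow (C * (24:ℝ) ^ (ε / 4)) 0 (show 0 < ε / 2 by linarith)
  refine ⟨P + 1, fun p hp n hn0 hn => (h n hn0).trans ?_⟩
  have hp0 : (0:ℝ) < p := by exact_mod_cast (by omega : 0 < p)
  have h1 := hP p (by omega)
  rw [pow_zero, mul_one] at h1
  calc C * (n:ℝ) ^ (ε / 4) ≤ C * (24 * (p:ℝ) ^ (2:ℕ)) ^ (ε / 4) := by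
        gcongr; exact_mod_cast hn
    _ = (C * (24:ℝ) ^ (ε / 4)) * (p:ℝ) ^ (ε / 2) := by
        rw [Real.mul_rpow (by norm_num) (by positivity), ← Real.rpow_natCast, ← Real.rpow_mul hp0.le]
        rw [mul_assoc]; congr 3; push_cast; ring
    _ ≤ (p:ℝ) ^ (ε / 2) * (p:ℝ) ^ (ε / 2) := by gcongr
    _ = _ := by rw [← Real.rpow_add hp0]; congr 1; ring

end growth

section core
variable {p : ℕ} [Fact p.Prime]

theorem sum_normSq_linear_le_explicit {χ : DirichletCharacter ℂ p} (hχ : χ ≠ 1) (hp2 : p ≠ 2)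
    {k : ZMod p} (hk : k ≠ 0) {T M Y : ℕ} (hT : 1 ≤ T) (hT2 : T ^ 2 ≤ p)
    (hTM : T = 1 ∨ 16 * T * M ≤ p) (hM : M < p) (hYp : Y < p) (hY : Y ^ 3 ≤ 8 * p)
    {S : Finset ℕ} (hS : S ⊆ Icc 1 Y) (hS0 : S.Nonempty) {β : ℕ → ℂ} (hβ : ∀ n ∈ S, ‖β n‖ ≤ 1)
    {D : ℝ} (hD : ∀ n : ℕ, n ≠ 0 → n ≤ 24 * p ^ 2 → (#n.divisors : ℝ) ≤ D)
    {κ q : ℝ} (hκ : 0 < κ) (hκS : #S ≤ κ ^ 3) (hq : 0 < q) (hqp : q ^ 6 * p = 1) :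
    ∃ W : ℝ, 0 ≤ W ∧
      W ^ 4 ≤ 476 * D ^ 2 * p ^ 3 * κ ^ 12 * T ^ 3 * (κ ^ 8 + κ ^ 10 * q) * (1 + Real.log T) * 2 ∧
      ∑ m ∈ Icc 1 M, ‖∑ n ∈ S, β n * χ ((m : ZMod p) * (n : ZMod p) + k)‖ ^ 2 ≤
        4 * (κ ^ 3 * (p + 1) / T + 2 * κ ^ 3 + (κ ^ 3) ^ 2 / T + 2 / T * W) := by
  have hp : p.Prime := Fact.out
  have hp1 : 1 ≤ p := hp.one_le
  have hpR : (1:ℝ) ≤ p := by exact_mod_cast hp1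
  have hTp : T < p := by
    have := hp.two_le
    by_contra hc
    nlinarith
  have hD1 : 1 ≤ D := by simpa using hD 1 one_ne_zero (by nlinarith)
  have hTR : (1:ℝ) ≤ T := by exact_mod_cast hT
  have hcore := sum_normSq_linear_le hχ hk hT hTp hTM hM S
    (fun n hn => by have := mem_Icc.1 (hS hn); omega) β hβ
  set Z := {x ∈ S ×ˢ S ×ˢ Ico 1 T | x.1 ≠ x.2.1} with hZ
  set W := ∑ x ∈ Z, ‖shiftQuotSum χ ((x.2.2 : ZMod p) * (k * ((x.1 : ZMod p)⁻¹ - (x.2.1 : ZMod p)⁻¹)))‖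
    with hWdef
  have hsc : (0:ℝ) < #S := by exact_mod_cast hS0.card_pos
  set κ' : ℝ := (#S : ℝ) ^ ((1:ℝ) / 3) with hκ'
  have hκ'3 : κ' ^ 3 = #S := by
    rw [hκ', ← Real.rpow_natCast, ← Real.rpow_mul hsc.le]; norm_num
  have hκ'0 : 0 < κ' := Real.rpow_pos_of_pos hsc _
  have hκle : κ' ≤ κ := le_of_pow_le_pow_left₀ three_ne_zero hκ.le (by rw [hκ'3]; exact hκS)
  have hB : ∀ c : ZMod p, c ≠ 0 → (#{x ∈ offPairs S | invSub p x = c} : ℝ) ≤ 68 * D := by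
    intro c hc
    refine le_trans (Nat.cast_le.2 (card_le_card ?_)) (card_inv_sub_inv_le hYp hY hD hc)
    intro x hx
    simp only [offPairs, mem_filter, mem_product] at hx
    simp only [mem_filter, mem_product]
    exact ⟨⟨hS hx.1.1.1, hS hx.1.1.2⟩, hx.2⟩
  have hQ := card_invSub_mul_eq_le hYp hS hB (by linarith) hD1 hT hT2
    (fun n h0 hn => hD n h0 (hn.trans (by nlinarith))) hκ'0 hκ'3 hq hqp
  have hlog : 0 ≤ Real.log T := Real.log_nonneg hTR
  refine ⟨W, sum_nonneg fun _ _ => norm_nonneg _, ?_, ?_⟩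
  · have h4 := sum_shiftQuotSum_pow_four_le' hχ hp2 Z
      (fun x => (x.2.2 : ZMod p) * (k * ((x.1 : ZMod p)⁻¹ - (x.2.1 : ZMod p)⁻¹)))
    have hZc : (#Z : ℝ) ≤ κ ^ 6 * T := by
      have : #Z ≤ #S * (#S * T) := by
        refine (card_filter_le _ _).trans ?_
        rw [card_product, card_product]
        gcongr
        simp
      calc (#Z : ℝ) ≤ #S * (#S * T) := by exact_mod_cast this
        _ ≤ κ ^ 3 * (κ ^ 3 * T) := by gcongr
        _ = _ := by ring
    have hQ2 : (#{x ∈ Z ×ˢ Z | (x.1.2.2 : ZMod p) * (k * ((x.1.1 : ZMod p)⁻¹ - (x.1.2.1 : ZMod p)⁻¹)) =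
        (x.2.2.2 : ZMod p) * (k * ((x.2.1 : ZMod p)⁻¹ - (x.2.2.1 : ZMod p)⁻¹))} : ℝ) ≤
        2 * (68 * D) * D * (κ ^ 8 + κ ^ 10 * q) * (T * (1 + Real.log T)) := by
      refine le_trans (Nat.cast_le.2 ?_) (hQ.trans (by gcongr))
      refine card_le_card_of_injOn (fun x => (((x.1.1, x.1.2.1), x.1.2.2), ((x.2.1, x.2.2.1), x.2.2.2))) ?_ ?_
      · rintro ⟨⟨a, b, t⟩, ⟨a', b', t'⟩⟩ hx
        simp only [hZ, coe_filter, mem_product, mem_filter, Set.mem_ofPred_eq] at hx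
        rw [mem_coe, mem_filter]
        simp only [offPairs, mem_product, mem_filter, invSub]
        obtain ⟨⟨⟨⟨h1, h2, h3⟩, h4⟩, ⟨h5, h6, h7⟩, h8⟩, h9⟩ := hx
        refine ⟨⟨⟨⟨⟨h1, h2⟩, h4⟩, h3⟩, ⟨⟨h5, h6⟩, h8⟩, h7⟩, ?_⟩
        apply mul_left_cancel₀ hk
        linear_combination h9
      · rintro ⟨⟨a, b, t⟩, ⟨a', b', t'⟩⟩ _ ⟨⟨c, d, s⟩, ⟨c', d', s'⟩⟩ _ heq
        simp only [Prod.mk.injEq] at heq ⊢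
        tauto
    refine h4.trans ?_
    have e1 : (#Z : ℝ) ^ 2 ≤ (κ ^ 6 * T) ^ 2 := by gcongr
    calc _ ≤ (κ ^ 6 * T) ^ 2 * (2 * (68 * D) * D * (κ ^ 8 + κ ^ 10 * q) * (T * (1 + Real.log T)))
          * (7 * (p:ℝ) ^ 3) := by
          refine mul_le_mul_of_nonneg_right ?_ (by positivity)
          exact mul_le_mul e1 hQ2 (Nat.cast_nonneg _) (by positivity)
      _ = 476 * D ^ 2 * p ^ 3 * κ ^ 12 * T ^ 3 * (κ ^ 8 + κ ^ 10 * q) * (1 + Real.log T) * 2 := by ring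
  · refine hcore.trans ?_
    have hW0 : 0 ≤ W := sum_nonneg fun _ _ => norm_nonneg _
    have hT0 : (0:ℝ) < T := by linarith
    gcongr
end core

section dyadic

set_option maxHeartbeats 1000000 in
theorem exists_sum_norm_linear_le {δ : ℝ} (hδ : 0 < δ) (hδ1 : δ ≤ 1 / 1000) :
    ∃ P : ℕ, ∀ p : ℕ, [Fact p.Prime] → P ≤ p → ∀ N : ℕ, N < p → (p : ℝ) ^ ((63 : ℝ) / 76) < N →
      ∀ χ : DirichletCharacter ℂ p, χ ≠ 1 → ∀ k : ZMod p, k ≠ 0 →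
      ∀ M K Y : ℕ, (p : ℝ) ^ δ ≤ K → M * K ≤ N → Y ^ 3 ≤ 8 * N →
      ∀ S : Finset ℕ, S ⊆ Icc 1 Y → S ⊆ Ioc K (2 * K) → ∀ β : ℕ → ℂ, (∀ n ∈ S, ‖β n‖ ≤ 1) →
      ∑ m ∈ Icc 1 M, ‖∑ n ∈ S, β n * χ ((m : ZMod p) * (n : ZMod p) + k)‖ ≤
        N * (p : ℝ) ^ (-(δ / 4)) := by
  obtain ⟨P1, hP1⟩ := exists_card_divisors_le_rpow (show (0:ℝ) < 1 / 2000 by norm_num)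
  obtain ⟨P2, hP2⟩ := exists_log_pow_le_rpow (476 * 2 * 32 * 16) 1 (show (0:ℝ) < 1 / 1000 by norm_num)
  obtain ⟨P3, hP3⟩ := exists_log_pow_le_rpow 400 0 (show (0:ℝ) < δ / 2 by linarith)
  obtain ⟨P4, hP4⟩ := exists_log_pow_le_rpow 10 0 (show (0:ℝ) < 2 / 1000 by norm_num)
  refine ⟨P1 + P2 + P3 + P4 + 3, ?_⟩
  intro p hpF hp N hNp hN χ hχ k hk M K Y hK hMK hY S hSY hSK β hβ
  have hpp : p.Prime := Fact.out
  have hp3 : 3 ≤ p := by omega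
  have hpR : (1:ℝ) ≤ p := by exact_mod_cast hpp.one_le
  have hp0 : (0:ℝ) < p := by linarith
  rcases S.eq_empty_or_nonempty with rfl | hS0
  · simp; positivity
  have hYK : K < Y := by
    obtain ⟨n, hn⟩ := hS0
    have h1 := mem_Icc.1 (hSY hn)
    have h2 := mem_Ioc.1 (hSK hn)
    omega
  have hK1 : (1:ℝ) ≤ K := (Real.one_le_rpow hpR hδ.le).trans hK
  have hK0 : (0:ℝ) < K := by linarith
  have hK1' : 1 ≤ K := by exact_mod_cast hK1
  have hN1 : (1:ℝ) ≤ N := (Real.one_le_rpow hpR (by norm_num)).trans hN.le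
  have hN0 : (0:ℝ) < N := by linarith
  have hN1' : 1 ≤ N := by exact_mod_cast hN1
  have hNpR : (N:ℝ) ≤ p := by exact_mod_cast hNp.le
  have hK3 : K ^ 3 ≤ 8 * N := (Nat.pow_le_pow_left hYK.le 3).trans hY
  have hK3R : (K:ℝ) ^ 3 ≤ 8 * N := by exact_mod_cast hK3
  have hYp : Y < p := by
    by_contra hc
    have : p ^ 3 ≤ 8 * N := (Nat.pow_le_pow_left (not_lt.1 hc) 3).trans hY
    nlinarith [Nat.pow_le_pow_left hp3 2]
  have hKp : K < p := by omega
  have hMp : M < p := lt_of_le_of_lt ((Nat.le_mul_of_pos_right M hK1').trans hMK) hNp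
  set T := max 1 (p * K / (16 * N)) with hT
  have hT1 : 1 ≤ T := le_max_left _ _
  have hT1R : (1:ℝ) ≤ T := by exact_mod_cast hT1
  have hTM : T = 1 ∨ 16 * T * M ≤ p := by
    rcases le_total (p * K / (16 * N)) 1 with h | h
    · left; rw [hT, max_eq_left h]
    · right
      rw [hT, max_eq_right h]
      have h1 : p * K / (16 * N) * (16 * N) ≤ p * K := Nat.div_mul_le_self _ _
      have h2 : 16 * (p * K / (16 * N)) * M * K ≤ p * K := by
        calc 16 * (p * K / (16 * N)) * M * K = 16 * (p * K / (16 * N)) * (M * K) := by ring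
          _ ≤ 16 * (p * K / (16 * N)) * N := by gcongr
          _ = p * K / (16 * N) * (16 * N) := by ring
          _ ≤ _ := h1
      exact Nat.le_of_mul_le_mul_right h2 hK1'
  have hTinv : (1:ℝ) / T ≤ 32 * N / (p * K) := by
    rw [div_le_div_iff₀ (by linarith) (by positivity)]
    have h1 : p * K < (p * K / (16 * N) + 1) * (16 * N) := Nat.lt_mul_of_div_lt (Nat.lt_succ_self _) (by omega)
    have h2 : p * K / (16 * N) + 1 ≤ 2 * T := by omega
    have h3 : p * K ≤ 32 * N * T := by nlinarith
    rw [one_mul]; exact_mod_cast h3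
  have hN34 : (p:ℝ) ^ 3 ≤ (N:ℝ) ^ 4 := by
    calc (p:ℝ) ^ 3 = ((p:ℝ) ^ ((3:ℝ) / 4)) ^ 4 := by
          rw [← Real.rpow_natCast, ← Real.rpow_natCast, ← Real.rpow_mul hp0.le]; norm_num
      _ ≤ ((p:ℝ) ^ ((63:ℝ) / 76)) ^ 4 := by
          refine pow_le_pow_left₀ (by positivity) (Real.rpow_le_rpow_of_exponent_le hpR (by norm_num)) 4
      _ ≤ _ := by gcongr
  have hT2 : T ^ 2 ≤ p := by
    rcases le_total (p * K / (16 * N)) 1 with h | h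
    · rw [hT, max_eq_left h]; omega
    · rw [hT, max_eq_right h]
      set t := p * K / (16 * N)
      have h1 : t * (16 * N) ≤ p * K := Nat.div_mul_le_self _ _
      have h1R : (t:ℝ) * (16 * N) ≤ p * K := by exact_mod_cast h1
      have h2 : ((t:ℝ) ^ 2) ^ 3 ≤ (p:ℝ) ^ 3 := by
        have h3 : ((t:ℝ) * (16 * N)) ^ 6 ≤ ((p:ℝ) * (K:ℝ)) ^ 6 := by gcongr
        have h4 : ((K:ℝ) ^ 3) ^ 2 ≤ (8 * N) ^ 2 := by gcongr
        have h5 : ((t:ℝ) ^ 2) ^ 3 * (16 ^ 6 * N ^ 6) ≤ p ^ 3 * (16 ^ 6 * N ^ 6) := by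
          calc ((t:ℝ) ^ 2) ^ 3 * (16 ^ 6 * N ^ 6) = ((t:ℝ) * (16 * N)) ^ 6 := by ring
            _ ≤ ((p:ℝ) * (K:ℝ)) ^ 6 := h3
            _ = p ^ 3 * p ^ 3 * ((K:ℝ) ^ 3) ^ 2 := by ring
            _ ≤ p ^ 3 * N ^ 4 * (8 * N) ^ 2 := by gcongr
            _ = p ^ 3 * (64 * N ^ 6) := by ring
            _ ≤ p ^ 3 * (16 ^ 6 * N ^ 6) := by gcongr; norm_num
        exact le_of_mul_le_mul_right h5 (by positivity)
      have := le_of_pow_le_pow_left₀ three_ne_zero hp0.le h2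
      exact_mod_cast this
  have hTp : T ≤ p := by nlinarith
  -- parameters as real powers
  set κ : ℝ := (K:ℝ) ^ ((1:ℝ) / 3) with hκ
  have hκ0 : 0 < κ := Real.rpow_pos_of_pos hK0 _
  have hκ3 : κ ^ 3 = K := by rw [hκ, ← Real.rpow_natCast, ← Real.rpow_mul hK0.le]; norm_num
  set q : ℝ := (p:ℝ) ^ (-(1:ℝ) / 6) with hq
  have hq0 : 0 < q := Real.rpow_pos_of_pos hp0 _
  have hqp : q ^ 6 * p = 1 := by
    rw [hq, ← Real.rpow_natCast, ← Real.rpow_mul hp0.le]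
    norm_num
    rw [Real.rpow_neg_one, inv_mul_cancel₀ hp0.ne']
  set D : ℝ := (p:ℝ) ^ ((1:ℝ) / 2000) with hD
  have hSc : (#S : ℝ) ≤ κ ^ 3 := by
    rw [hκ3]
    have := card_le_card hSK
    rw [Nat.card_Ioc] at this
    exact_mod_cast (by omega : #S ≤ K)
  obtain ⟨W, hW0, hW4, hsum⟩ := sum_normSq_linear_le_explicit hχ (by omega) hk hT1 hT2 hTM hMp hYp
    (hY.trans (by omega)) hSY hS0 hβ (D := D) (hP1 p (by omega)) hκ0 hSc hq0 hqp
  set s : ℝ := (p:ℝ) ^ δ with hs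
  have hs1 : 1 ≤ s := Real.one_le_rpow hpR hδ.le
  have hs0 : 0 < s := by linarith
  have hsN : s ≤ N := by
    refine le_trans ?_ hN.le
    exact Real.rpow_le_rpow_of_exponent_le hpR (by linarith)
  have hsp : s ≤ p := hsN.trans hNpR
  have hMR : (M:ℝ) ≤ N / K := by rw [le_div_iff₀ hK0]; exact_mod_cast hMK
  -- the main term
  set a : ℝ := M * (1 / T) * W with ha
  have ha4 : a ^ 4 ≤ (N ^ 2 / s) ^ 4 := by
    have hlogT : 1 + Real.log T ≤ 1 + Real.log p := by
      have : Real.log T ≤ Real.log p := Real.log_le_log (by linarith) (by exact_mod_cast hTp)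
      linarith
    have hlogT0 : 0 ≤ 1 + Real.log T := by have := Real.log_nonneg hT1R; linarith
    have hκ9 : κ ^ 9 ≤ 8 * N := by
      calc κ ^ 9 = (κ ^ 3) ^ 3 := by ring
        _ ≤ _ := by rw [hκ3]; exact hK3R
    have hκN : κ ≤ 2 * (N:ℝ) ^ ((1:ℝ) / 9) := by
      refine le_of_pow_le_pow_left₀ (n := 9) (by norm_num) (by positivity) ?_
      rw [mul_pow, ← Real.rpow_natCast ((N:ℝ) ^ ((1:ℝ) / 9)), ← Real.rpow_mul hN0.le]
      norm_num
      linarith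
    set ν : ℝ := (N:ℝ) ^ ((1:ℝ) / 9) with hν
    have hν0 : 0 < ν := Real.rpow_pos_of_pos hN0 _
    have hν9 : ν ^ 9 = N := by rw [hν, ← Real.rpow_natCast, ← Real.rpow_mul hN0.le]; norm_num
    have hνp : (p:ℝ) ^ ((7:ℝ) / 76) ≤ ν := by
      rw [hν]
      calc (p:ℝ) ^ ((7:ℝ) / 76) = ((p:ℝ) ^ ((63:ℝ) / 76)) ^ ((1:ℝ) / 9) := by
            rw [← Real.rpow_mul hp0.le]; norm_num
        _ ≤ _ := by gcongr
    have f1 : (p:ℝ) ^ 2 ≤ ν ^ 22 * (p:ℝ) ^ (-(8:ℝ) / 1000) := by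
      calc (p:ℝ) ^ 2 = (p:ℝ) ^ (2:ℝ) := by norm_num
        _ ≤ (p:ℝ) ^ ((7:ℝ) / 76 * 22 + (-(8:ℝ) / 1000)) :=
            Real.rpow_le_rpow_of_exponent_le hpR (by norm_num)
        _ = ((p:ℝ) ^ ((7:ℝ) / 76)) ^ 22 * (p:ℝ) ^ (-(8:ℝ) / 1000) := by
            rw [Real.rpow_add hp0, Real.rpow_mul hp0.le]; norm_num
        _ ≤ _ := by gcongr
    have f2 : (p:ℝ) ^ 2 * q ≤ ν ^ 20 * (p:ℝ) ^ (-(8:ℝ) / 1000) := by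
      calc (p:ℝ) ^ 2 * q = (p:ℝ) ^ ((2:ℝ) + -1 / 6) := by
            rw [hq, Real.rpow_add hp0]; norm_num
        _ ≤ (p:ℝ) ^ ((7:ℝ) / 76 * 20 + (-(8:ℝ) / 1000)) :=
            Real.rpow_le_rpow_of_exponent_le hpR (by norm_num)
        _ = ((p:ℝ) ^ ((7:ℝ) / 76)) ^ 20 * (p:ℝ) ^ (-(8:ℝ) / 1000) := by
            rw [Real.rpow_add hp0, Real.rpow_mul hp0.le]; norm_num
        _ ≤ _ := by gcongr
    set r : ℝ := (p:ℝ) ^ (-(8:ℝ) / 1000) with hr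
    have hr0 : 0 < r := Real.rpow_pos_of_pos hp0 _
    have f3 : (p:ℝ) ^ 2 * (κ ^ 5 + κ ^ 7 * q) ≤ 160 * ν ^ 27 * r := by
      calc (p:ℝ) ^ 2 * (κ ^ 5 + κ ^ 7 * q) ≤ (p:ℝ) ^ 2 * ((2 * ν) ^ 5 + (2 * ν) ^ 7 * q) := by gcongr
        _ = 32 * ν ^ 5 * (p:ℝ) ^ 2 + 128 * ν ^ 7 * ((p:ℝ) ^ 2 * q) := by ring
        _ ≤ 32 * ν ^ 5 * (ν ^ 22 * r) + 128 * ν ^ 7 * (ν ^ 20 * r) := by gcongr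
        _ = _ := by ring
    have f4 : a ^ 4 ≤ 476 * 2 * 32 * 160 * (1 + Real.log p) * D ^ 2 * r * (N:ℝ) ^ 8 := by
      have hTT : (1 / (T:ℝ)) * T = 1 := by field_simp
      calc a ^ 4 = (M:ℝ) ^ 4 * (1 / T) ^ 4 * W ^ 4 := by rw [ha]; ring
        _ ≤ (N / K) ^ 4 * (1 / T) ^ 4 * (476 * D ^ 2 * p ^ 3 * κ ^ 12 * T ^ 3 * (κ ^ 8 + κ ^ 10 * q) *
              (1 + Real.log T) * 2) := by gcongr
        _ = (N / K) ^ 4 * (1 / T) * ((1 / T) * T) ^ 3 * (476 * D ^ 2 * p ^ 3 * κ ^ 12 * (κ ^ 8 + κ ^ 10 * q) *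
              (1 + Real.log T) * 2) := by ring
        _ ≤ (N / K) ^ 4 * (32 * N / (p * K)) * 1 ^ 3 * (476 * D ^ 2 * p ^ 3 * κ ^ 12 * (κ ^ 8 + κ ^ 10 * q) *
              (1 + Real.log p) * 2) := by rw [hTT]; gcongr
        _ = 476 * 2 * 32 * (1 + Real.log p) * D ^ 2 * N ^ 5 * (p ^ 2 * (κ ^ 5 + κ ^ 7 * q)) := by
          rw [← hκ3]; field_simp
        _ ≤ 476 * 2 * 32 * (1 + Real.log p) * D ^ 2 * N ^ 5 * (160 * ν ^ 27 * r) := by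
          have : 0 ≤ 1 + Real.log p := by linarith
          gcongr
        _ = 476 * 2 * 32 * 160 * (1 + Real.log p) * D ^ 2 * r * ((N:ℝ) ^ 5 * (ν ^ 9) ^ 3) := by ring
        _ = _ := by rw [hν9]; ring
    refine f4.trans ?_
    have g1 := hP2 p (by omega)
    rw [pow_one] at g1
    have hpow : (10:ℝ) * ((p:ℝ) ^ ((1:ℝ) / 1000) * D ^ 2 * r) ≤ 1 / s ^ 4 := by
      have g4 := hP4 p (by omega)
      rw [pow_zero, mul_one] at g4
      have hD2 : D ^ 2 = (p:ℝ) ^ ((1:ℝ) / 1000) := by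
        rw [hD, ← Real.rpow_natCast, ← Real.rpow_mul hp0.le]; norm_num
      have hs4 : 1 / s ^ 4 = (p:ℝ) ^ (-(δ * 4)) := by
        rw [hs, Real.rpow_neg hp0.le, Real.rpow_mul hp0.le, one_div]; norm_num
      rw [hD2, hs4, hr]
      calc (10:ℝ) * ((p:ℝ) ^ ((1:ℝ) / 1000) * (p:ℝ) ^ ((1:ℝ) / 1000) * (p:ℝ) ^ (-(8:ℝ) / 1000))
          ≤ (p:ℝ) ^ ((2:ℝ) / 1000) *
            ((p:ℝ) ^ ((1:ℝ) / 1000) * (p:ℝ) ^ ((1:ℝ) / 1000) * (p:ℝ) ^ (-(8:ℝ) / 1000)) := by gcongr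
        _ = (p:ℝ) ^ (-(4:ℝ) / 1000) := by
          rw [← Real.rpow_add hp0, ← Real.rpow_add hp0, ← Real.rpow_add hp0]; norm_num
        _ ≤ _ := Real.rpow_le_rpow_of_exponent_le hpR (by linarith)
    calc 476 * 2 * 32 * 160 * (1 + Real.log p) * D ^ 2 * r * (N:ℝ) ^ 8
        = 10 * ((476 * 2 * 32 * 16 * (1 + Real.log p)) * D ^ 2 * r) * (N:ℝ) ^ 8 := by ring
      _ ≤ 10 * ((p:ℝ) ^ ((1:ℝ) / 1000) * D ^ 2 * r) * (N:ℝ) ^ 8 := by gcongr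
      _ ≤ 1 / s ^ 4 * (N:ℝ) ^ 8 := by gcongr
      _ = _ := by ring
  have haN : a ≤ N ^ 2 / s := le_of_pow_le_pow_left₀ four_ne_zero (by positivity) ha4
  have htot : (∑ m ∈ Icc 1 M, ‖∑ n ∈ S, β n * χ ((m : ZMod p) * (n : ZMod p) + k)‖) ^ 2 ≤
      400 * ((N:ℝ) ^ 2 / s) := by
    have hcs := sq_sum_le_card_mul_sum_sq (s := Icc 1 M)
      (f := fun m => ‖∑ n ∈ S, β n * χ ((m : ZMod p) * (n : ZMod p) + k)‖)
    rw [Nat.card_Icc, Nat.add_sub_cancel] at hcs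
    refine hcs.trans ((mul_le_mul_of_nonneg_left hsum (Nat.cast_nonneg _)).trans ?_)
    rw [hκ3]
    have t1 : M * (K * (p + 1) * (1 / T)) ≤ 64 * ((N:ℝ) ^ 2 / s) := by
      calc (M:ℝ) * (K * (p + 1) * (1 / T)) ≤ ((N:ℝ) / K) * (K * (p + p) * (32 * (N:ℝ) / (p * K))) := by gcongr
        _ = 64 * ((N:ℝ) ^ 2 / K) := by field_simp; ring
        _ ≤ _ := by gcongr
    have t2 : (M:ℝ) * (2 * K) ≤ 2 * ((N:ℝ) ^ 2 / s) := by
      calc (M:ℝ) * (2 * K) ≤ ((N:ℝ) / K) * (2 * K) := by gcongr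
        _ = 2 * ((N:ℝ) ^ 2 / N) := by field_simp
        _ ≤ _ := by gcongr
    have t3 : (M:ℝ) * ((K:ℝ) ^ 2 * (1 / T)) ≤ 32 * ((N:ℝ) ^ 2 / s) := by
      calc (M:ℝ) * ((K:ℝ) ^ 2 * (1 / T)) ≤ ((N:ℝ) / K) * ((K:ℝ) ^ 2 * (32 * (N:ℝ) / (p * K))) := by gcongr
        _ = 32 * ((N:ℝ) ^ 2 / p) := by field_simp
        _ ≤ _ := by gcongr
    calc (M:ℝ) * (4 * (K * (p + 1) / T + 2 * K + (K:ℝ) ^ 2 / T + 2 / T * W))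
        = 4 * (M * (K * (p + 1) * (1 / T)) + M * (2 * K) + M * ((K:ℝ) ^ 2 * (1 / T)) + 2 * a) := by
          rw [ha]; ring
      _ ≤ 4 * (64 * ((N:ℝ) ^ 2 / s) + 2 * ((N:ℝ) ^ 2 / s) + 32 * ((N:ℝ) ^ 2 / s) + 2 * ((N:ℝ) ^ 2 / s)) := by gcongr
      _ = _ := by ring
  refine le_of_pow_le_pow_left₀ two_ne_zero (by positivity) (htot.trans ?_)
  have g3 := hP3 p (by omega)
  rw [pow_zero, mul_one] at g3
  calc 400 * ((N:ℝ) ^ 2 / s) ≤ (p:ℝ) ^ (δ / 2) * ((N:ℝ) ^ 2 / s) := by gcongr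
    _ = (N:ℝ) ^ 2 * ((p:ℝ) ^ (δ / 2) * (p:ℝ) ^ (-δ)) := by rw [Real.rpow_neg hp0.le]; ring
    _ = (N:ℝ) ^ 2 * (p:ℝ) ^ (-(δ / 4) * 2) := by rw [← Real.rpow_add hp0]; congr 2; ring
    _ = _ := by rw [mul_pow, Real.rpow_mul hp0.le]; norm_num
end dyadic

section separation
variable {p : ℕ} [Fact p.Prime]

/-- Majorant of the normalised Fourier transform of an initial segment. -/
noncomputable def sepWeight (t : ZMod p) : ℝ := if t = 0 then 1 else 2 / (p * ‖ee t - 1‖)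

theorem sepWeight_nonneg (t : ZMod p) : 0 ≤ sepWeight t := by
  unfold sepWeight; split_ifs <;> positivity

theorem norm_sum_range_ee_le {H : ℕ} (hH : H ≤ p) (t : ZMod p) :
    ‖∑ v ∈ range H, ee (-t * (v : ZMod p))‖ ≤ p * sepWeight t := by
  have hp : p.Prime := Fact.out
  have hp0 : (0:ℝ) < p := by exact_mod_cast hp.pos
  unfold sepWeight
  split_ifs with h
  · rw [mul_one]
    calc _ ≤ ∑ v ∈ range H, ‖ee (-t * (v : ZMod p))‖ := norm_sum_le _ _
      _ = H := by simp
      _ ≤ p := by exact_mod_cast hH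
  · have hne : ee t ≠ 1 := by
      intro h1
      apply h
      have : ee t = ee (0 : ZMod p) := by rw [h1, ee_zero]
      exact ZMod.injective_stdAddChar this
    have hnorm : 0 < ‖ee t - 1‖ := norm_pos_iff.2 (sub_ne_zero.2 hne)
    have hpow : ∀ v : ℕ, ee (-t * (v : ZMod p)) = ee (-t) ^ v := by
      intro v
      rw [mul_comm, ← nsmul_eq_mul]
      exact AddChar.map_nsmul_eq_pow _ _ _
    simp_rw [hpow]
    have hg := geom_sum_mul (ee (-t)) H
    have hn : ‖ee (-t) - 1‖ = ‖ee t - 1‖ := by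
      rw [← conj_ee, ← Complex.norm_conj (ee t - 1), map_sub, map_one]
    have h2 : ‖∑ v ∈ range H, ee (-t) ^ v‖ * ‖ee t - 1‖ ≤ 2 := by
      rw [← hn, ← norm_mul, hg]
      calc _ ≤ ‖ee (-t) ^ H‖ + ‖(1:ℂ)‖ := norm_sub_le _ _
        _ = 2 := by rw [norm_pow, norm_ee]; norm_num
    rw [mul_div_assoc', mul_div_mul_left _ _ hp0.ne', le_div_iff₀ hnorm]
    exact h2

theorem norm_sum_ite_le {ι : Type*} (S : Finset ι) (b : ι → ℂ) {ρ : ι → ℕ} (hρ : ∀ i ∈ S, ρ i < p)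
    (h : ℕ) :
    ‖∑ i ∈ S, if ρ i ≤ h then b i else 0‖ ≤
      ∑ t : ZMod p, sepWeight t * ‖∑ i ∈ S, b i * ee (t * (ρ i : ZMod p))‖ := by
  have hp : p.Prime := Fact.out
  have hp0 : (0:ℝ) < p := by exact_mod_cast hp.pos
  have hpC : (p:ℂ) ≠ 0 := by exact_mod_cast hp.ne_zero
  set H := min (h + 1) p with hH
  have h1 : ∀ i ∈ S, (p:ℂ) * (if ρ i ≤ h then b i else 0) =
      ∑ t : ZMod p, (∑ v ∈ range H, ee (-t * (v : ZMod p))) * (b i * ee (t * (ρ i : ZMod p))) := by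
    intro i hi
    have e1 : ∀ t : ZMod p, (∑ v ∈ range H, ee (-t * (v : ZMod p))) * (b i * ee (t * (ρ i : ZMod p)))
        = ∑ v ∈ range H, b i * ee (((ρ i : ZMod p) - (v : ZMod p)) * t) := by
      intro t
      rw [sum_mul]
      refine sum_congr rfl fun v _ => ?_
      rw [mul_left_comm, ← ee_add]; congr 2; ring
    simp_rw [e1]
    rw [sum_comm]
    simp_rw [← mul_sum, sum_ee]
    have e2 : ∀ v ∈ range H, (if (ρ i : ZMod p) - (v : ZMod p) = 0 then (p:ℂ) else 0) =
        if ρ i = v then (p:ℂ) else 0 := by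
      intro v hv
      rw [mem_range] at hv
      refine if_congr ?_ rfl rfl
      rw [sub_eq_zero]
      exact ⟨fun e => natCast_inj_of_lt (hρ i hi) (by omega) e, fun e => by rw [e]⟩
    rw [sum_congr rfl e2, sum_ite_eq]
    have e3 : ρ i ∈ range H ↔ ρ i ≤ h := by
      have := hρ i hi
      rw [mem_range]; omega
    simp only [e3]
    split_ifs <;> ring
  have h2 : (p:ℂ) * (∑ i ∈ S, if ρ i ≤ h then b i else 0) =
      ∑ t : ZMod p, (∑ v ∈ range H, ee (-t * (v : ZMod p))) * ∑ i ∈ S, b i * ee (t * (ρ i : ZMod p)) := by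
    rw [mul_sum, sum_congr rfl h1, sum_comm]
    simp_rw [mul_sum]
  have h3 : (p:ℝ) * ‖∑ i ∈ S, if ρ i ≤ h then b i else 0‖ ≤
      p * ∑ t : ZMod p, sepWeight t * ‖∑ i ∈ S, b i * ee (t * (ρ i : ZMod p))‖ := by
    have : (p:ℝ) = ‖(p:ℂ)‖ := by simp
    conv_lhs => rw [this, ← norm_mul, h2]
    rw [mul_sum]
    refine (norm_sum_le _ _).trans (sum_le_sum fun t _ => ?_)
    rw [norm_mul, ← mul_assoc]
    exact mul_le_mul_of_nonneg_right (norm_sum_range_ee_le (min_le_right _ _) t) (norm_nonneg _)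
  exact le_of_mul_le_mul_left h3 hp0

theorem sepWeight_natCast_le {j : ℕ} (h1 : 1 ≤ j) (h2 : j < p) :
    sepWeight (j : ZMod p) ≤ 1 / 2 * ((j:ℝ)⁻¹ + ((p - j : ℕ) : ℝ)⁻¹) := by
  have hp : p.Prime := Fact.out
  have hp0 : (0:ℝ) < p := by exact_mod_cast hp.pos
  have hj0 : (0:ℝ) < j := by exact_mod_cast h1
  have hjp : (0:ℝ) < ((p - j : ℕ) : ℝ) := by exact_mod_cast (by omega : 0 < p - j)
  rw [sepWeight, if_neg (natCast_ne_zero_of_lt h1 h2)]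
  have hee : ‖ee (j : ZMod p) - 1‖ = 2 * |Real.sin (Real.pi * j / p)| := by
    have h := ZMod.stdAddChar_coe (N := p) (j : ℤ)
    have h' : ee (j : ZMod p) = Complex.exp (Complex.I * ((2 * Real.pi * j / p : ℝ) : ℂ)) := by
      have hc : ((j : ℤ) : ZMod p) = (j : ZMod p) := by push_cast; rfl
      rw [← hc, ee, h]; congr 1; push_cast; ring
    rw [h', Complex.norm_exp_I_mul_ofReal_sub_one, norm_mul, Real.norm_eq_abs, Real.norm_eq_abs]
    congr 3
    · norm_num
    · ring
  have key : ∀ m : ℕ, 1 ≤ m → 2 * m ≤ p → 2 * (m:ℝ) / p ≤ Real.sin (Real.pi * m / p) := by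
    intro m hm hmp
    have hmp' : 2 * (m:ℝ) ≤ p := by exact_mod_cast hmp
    have := Real.mul_le_sin (x := Real.pi * m / p) (by positivity) (by
      rw [div_le_div_iff₀ hp0 two_pos]; nlinarith [Real.pi_pos])
    refine le_trans (le_of_eq ?_) this
    field_simp
  have fin : ∀ m : ℝ, 0 < m → 2 * m / p ≤ |Real.sin (Real.pi * j / p)| →
      2 / (p * ‖ee (j : ZMod p) - 1‖) ≤ 1 / 2 * m⁻¹ := by
    intro m hm h
    rw [hee]
    calc 2 / (p * (2 * |Real.sin (Real.pi * j / p)|)) ≤ 2 / (p * (2 * (2 * m / p))) := by gcongr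
      _ = _ := by field_simp
  rcases le_total (2 * j) p with h | h
  · have := fin j hj0 ((key j h1 h).trans (le_abs_self _))
    have hh : 0 ≤ (((p - j : ℕ) : ℝ))⁻¹ := by positivity
    linarith
  · have hs : Real.sin (Real.pi * j / p) = Real.sin (Real.pi * ((p - j : ℕ) : ℝ) / p) := by
      rw [← Real.sin_pi_sub]
      congr 1
      rw [Nat.cast_sub h2.le]
      field_simp
    have := fin ((p - j : ℕ) : ℝ) hjp (by
      rw [hs]; exact (key (p - j) (by omega) (by omega)).trans (le_abs_self _))
    have hh : 0 ≤ (j:ℝ)⁻¹ := by positivity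
    linarith

theorem sum_sepWeight_le : ∑ t : ZMod p, sepWeight t ≤ 2 * (1 + Real.log p) := by
  have hp : p.Prime := Fact.out
  have hl : 0 ≤ Real.log p := Real.log_nonneg (by exact_mod_cast hp.one_le)
  have h1 : ∑ t : ZMod p, sepWeight t = ∑ j ∈ range p, sepWeight (j : ZMod p) := by
    symm
    refine sum_bij (fun j _ => (j : ZMod p)) (fun _ _ => mem_univ _) ?_ ?_ (fun _ _ => rfl)
    · intro a ha b hb h
      exact natCast_inj_of_lt (mem_range.1 ha) (mem_range.1 hb) h
    · intro t _
      exact ⟨t.val, mem_range.2 (ZMod.val_lt t), ZMod.natCast_zmod_val t⟩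
  rw [h1, range_eq_Ico, sum_eq_sum_Ico_succ_bot hp.pos]
  have h0 : sepWeight ((0:ℕ) : ZMod p) = 1 := by simp [sepWeight]
  rw [h0]
  have h2 : ∑ j ∈ Ico (0 + 1) p, sepWeight (j : ZMod p) ≤
      ∑ j ∈ Ico 1 p, 1 / 2 * ((j:ℝ)⁻¹ + ((p - j : ℕ) : ℝ)⁻¹) :=
    sum_le_sum fun j hj => by
      rw [mem_Ico] at hj
      exact sepWeight_natCast_le (by omega) hj.2
  have h3 : ∑ j ∈ Ico 1 p, ((p - j : ℕ) : ℝ)⁻¹ = ∑ j ∈ Ico 1 p, (j:ℝ)⁻¹ := by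
    refine sum_nbij' (fun j => p - j) (fun j => p - j) ?_ ?_ ?_ ?_ ?_
    all_goals intro j hj; rw [mem_Ico] at hj
    · rw [mem_Ico]; omega
    · rw [mem_Ico]; omega
    · omega
    · omega
  have h4 : ∑ j ∈ Ico 1 p, (j:ℝ)⁻¹ ≤ 1 + Real.log p := by
    refine le_trans ?_ (sum_inv_Icc_le p)
    refine sum_le_sum_of_subset_of_nonneg ?_ (fun _ _ _ => by positivity)
    intro j hj; rw [mem_Ico] at hj; rw [mem_Icc]; omega
  rw [← mul_sum, sum_add_distrib, h3] at h2
  linarith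

/-- The Gauss sum twisted by `t` in terms of the Gauss sum. -/
theorem sum_char_mul_ee {χ : DirichletCharacter ℂ p} (hχ : χ ≠ 1) (t : ZMod p) :
    ∑ x : ZMod p, χ x * ee (t * x) = χ t⁻¹ * ∑ x : ZMod p, χ x * ee x := by
  rcases eq_or_ne t 0 with rfl | ht
  · simp only [zero_mul, ee_zero, mul_one, inv_zero, MulChar.map_zero]
    exact sum_char_eq_zero hχ
  · rw [mul_sum]
    refine Fintype.sum_bijective (fun x => t * x) (mulLeft_bijective₀ t ht) _ _ fun x => ?_
    rw [← mul_assoc, ← map_mul, inv_mul_cancel_left₀ ht]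

theorem norm_sum_char_ee {χ : DirichletCharacter ℂ p} (hχ : χ ≠ 1) :
    ‖∑ x : ZMod p, χ x * ee x‖ ^ 2 = p := by
  have hp : p.Prime := Fact.out
  have hn : ∑ x : ZMod p, ‖χ x‖ ^ 2 = (p:ℝ) - 1 := by
    rw [← Finset.add_sum_erase univ _ (mem_univ (0 : ZMod p))]
    rw [sum_congr rfl fun x hx => by rw [char_norm_eq_one χ (ne_of_mem_erase hx)]]
    simp [MulChar.map_zero, ZMod.card, Nat.cast_sub hp.one_le]
  have hn' : ∑ x : ZMod p, ‖χ x⁻¹‖ ^ 2 = (p:ℝ) - 1 := by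
    rw [← hn]
    exact Fintype.sum_bijective _ inv_involutive.bijective _ _ fun x => rfl
  have h := parseval (p := p) (fun x => χ x)
  rw [hn] at h
  have h2 : ∑ s : ZMod p, ‖∑ u, χ u * ee (s * u)‖ ^ 2 =
      ((p:ℝ) - 1) * ‖∑ x : ZMod p, χ x * ee x‖ ^ 2 := by
    rw [← hn', sum_mul]
    refine sum_congr rfl fun s _ => ?_
    rw [sum_char_mul_ee hχ, norm_mul, mul_pow]
  rw [h2] at h
  have h1 : (1:ℝ) < p := by exact_mod_cast hp.one_lt
  have : ((p:ℝ) - 1) ≠ 0 := by linarith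
  apply mul_left_cancel₀ this
  linarith

theorem norm_sum_char_mul_ee_le {χ : DirichletCharacter ℂ p} (hχ : χ ≠ 1) (t : ZMod p) :
    ‖∑ x : ZMod p, χ x * ee (t * x)‖ ≤ Real.sqrt p := by
  rw [sum_char_mul_ee hχ, norm_mul, ← norm_sum_char_ee hχ, Real.sqrt_sq (norm_nonneg _)]
  exact mul_le_of_le_one_left (norm_nonneg _) (norm_char_le_one χ _)

/-- Pólya–Vinogradov. -/
theorem norm_sum_Icc_char_le {χ : DirichletCharacter ℂ p} (hχ : χ ≠ 1) {X : ℕ} (hX : X < p) :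
    ‖∑ m ∈ Icc 1 X, χ (m : ZMod p)‖ ≤ 2 * (1 + Real.log p) * Real.sqrt p := by
  have hp : p.Prime := Fact.out
  have h0 : ∑ m ∈ Icc 1 X, χ (m : ZMod p) = ∑ m ∈ range p, if m ≤ X then χ (m : ZMod p) else 0 := by
    rw [← sum_filter]
    refine sum_subset_zero_on_sdiff ?_ ?_ (fun _ _ => rfl)
    · intro m hm; rw [mem_Icc] at hm; rw [mem_filter, mem_range]; omega
    · intro m hm
      rw [mem_sdiff, mem_filter, mem_range, mem_Icc] at hm
      have : m = 0 := by omega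
      subst this
      rw [Nat.cast_zero]; exact MulChar.map_zero χ
  rw [h0]
  refine (norm_sum_ite_le (p := p) (range p) (fun m => χ (m : ZMod p)) (ρ := fun m => m)
    (fun i hi => mem_range.1 hi) X).trans ?_
  have hg : ∀ t : ZMod p, ‖∑ i ∈ range p, χ (i : ZMod p) * ee (t * (i : ZMod p))‖ ≤ Real.sqrt p := by
    intro t
    have e1 : ∑ i ∈ range p, χ (i : ZMod p) * ee (t * (i : ZMod p)) = ∑ x : ZMod p, χ x * ee (t * x) := by
      refine sum_bij (fun j _ => (j : ZMod p)) (fun _ _ => mem_univ _) ?_ ?_ (fun _ _ => rfl)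
      · intro a ha b hb h
        exact natCast_inj_of_lt (mem_range.1 ha) (mem_range.1 hb) h
      · intro t _
        exact ⟨t.val, mem_range.2 (ZMod.val_lt t), ZMod.natCast_zmod_val t⟩
    rw [e1]
    exact norm_sum_char_mul_ee_le hχ t
  calc _ ≤ ∑ t : ZMod p, sepWeight t * Real.sqrt p := by
        refine sum_le_sum fun t _ => mul_le_mul_of_nonneg_left (hg t) (sepWeight_nonneg t)
    _ ≤ _ := by
      rw [← sum_mul]
      exact mul_le_mul_of_nonneg_right sum_sepWeight_le (Real.sqrt_nonneg _)
end separation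

section separatedTypeTwo
variable {p : ℕ} [Fact p.Prime]

theorem norm_sum_ite_ite_le {ι : Type*} (S : Finset ι) (b : ι → ℂ) {ρ₁ ρ₂ : ι → ℕ}
    (hρ₁ : ∀ i ∈ S, ρ₁ i < p) (hρ₂ : ∀ i ∈ S, ρ₂ i < p) (h₁ h₂ : ℕ) :
    ‖∑ i ∈ S, if ρ₁ i ≤ h₁ ∧ ρ₂ i ≤ h₂ then b i else 0‖ ≤
      ∑ t : ZMod p, ∑ u : ZMod p, sepWeight t * sepWeight u *
        ‖∑ i ∈ S, ee (t * (ρ₁ i : ZMod p)) * ee (u * (ρ₂ i : ZMod p)) * b i‖ := by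
  have e0 : ∑ i ∈ S, (if ρ₁ i ≤ h₁ ∧ ρ₂ i ≤ h₂ then b i else 0) =
      ∑ i ∈ S, if ρ₁ i ≤ h₁ then (if ρ₂ i ≤ h₂ then b i else 0) else 0 :=
    sum_congr rfl fun i _ => by rw [ite_and]
  rw [e0]
  refine (norm_sum_ite_le S _ hρ₁ h₁).trans (sum_le_sum fun t _ => ?_)
  have e1 : ∑ i ∈ S, (if ρ₂ i ≤ h₂ then b i else 0) * ee (t * (ρ₁ i : ZMod p)) =
      ∑ i ∈ S, if ρ₂ i ≤ h₂ then b i * ee (t * (ρ₁ i : ZMod p)) else 0 :=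
    sum_congr rfl fun i _ => by rw [ite_mul, zero_mul]
  rw [e1]
  refine (mul_le_mul_of_nonneg_left (norm_sum_ite_le S _ hρ₂ h₂) (sepWeight_nonneg t)).trans ?_
  rw [mul_sum]
  refine le_of_eq (sum_congr rfl fun u _ => ?_)
  rw [mul_assoc]
  congr 3
  exact sum_congr rfl fun i _ => by ring

theorem exists_sum_norm_linear_ite_le {δ : ℝ} (hδ : 0 < δ) (hδ1 : δ ≤ 1 / 1000) :
    ∃ P : ℕ, ∀ p : ℕ, [Fact p.Prime] → P ≤ p → ∀ N : ℕ, N < p → (p : ℝ) ^ ((63 : ℝ) / 76) < N →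
      ∀ χ : DirichletCharacter ℂ p, χ ≠ 1 → ∀ k : ZMod p, k ≠ 0 →
      ∀ M K Y : ℕ, (p : ℝ) ^ δ ≤ K → M * K ≤ N → Y ^ 3 ≤ 8 * N →
      ∀ S : Finset ℕ, S ⊆ Icc 1 Y → S ⊆ Ioc K (2 * K) → ∀ β : ℕ → ℂ, (∀ n ∈ S, ‖β n‖ ≤ 1) →
      ∀ ρ₁ ρ₂ : ℕ → ℕ, (∀ n ∈ S, ρ₁ n < p) → (∀ n ∈ S, ρ₂ n < p) → ∀ h₁ h₂ : ℕ → ℕ,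
      ∑ m ∈ Icc 1 M, ‖∑ n ∈ S, if ρ₁ n ≤ h₁ m ∧ ρ₂ n ≤ h₂ m then
        β n * χ ((m : ZMod p) * (n : ZMod p) + k) else 0‖ ≤
        N * (p : ℝ) ^ (-(δ / 5)) := by
  obtain ⟨P₁, h₁⟩ := exists_sum_norm_linear_le hδ hδ1
  obtain ⟨P₂, h₂⟩ := exists_log_pow_le_rpow 4 2 (by linarith : 0 < δ / 4 - δ / 5 + 0)
  refine ⟨max P₁ P₂, fun p hp hP N hN hNp χ hχ k hk M K Y hK hMK hY S hSY hSK β hβ ρ₁ ρ₂ hρ₁ hρ₂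
    f g => ?_⟩
  have hp0 : (0:ℝ) < p := by exact_mod_cast hp.out.pos
  have hl := h₂ p ((le_max_right _ _).trans hP)
  have hcore := h₁ p ((le_max_left _ _).trans hP) N hN hNp χ hχ k hk M K Y hK hMK hY S hSY hSK
  calc _ ≤ ∑ m ∈ Icc 1 M, ∑ t : ZMod p, ∑ u : ZMod p, sepWeight t * sepWeight u *
        ‖∑ n ∈ S, ee (t * (ρ₁ n : ZMod p)) * ee (u * (ρ₂ n : ZMod p)) *
          (β n * χ ((m : ZMod p) * (n : ZMod p) + k))‖ :=
        sum_le_sum fun m _ => norm_sum_ite_ite_le S _ hρ₁ hρ₂ _ _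
    _ = ∑ t : ZMod p, ∑ u : ZMod p, sepWeight t * sepWeight u * ∑ m ∈ Icc 1 M,
        ‖∑ n ∈ S, ee (t * (ρ₁ n : ZMod p)) * ee (u * (ρ₂ n : ZMod p)) * β n *
          χ ((m : ZMod p) * (n : ZMod p) + k)‖ := by
        rw [sum_comm]
        refine sum_congr rfl fun t _ => ?_
        rw [sum_comm]
        refine sum_congr rfl fun u _ => ?_
        rw [mul_sum]
        simp_rw [mul_assoc]
    _ ≤ ∑ t : ZMod p, ∑ u : ZMod p, sepWeight t * sepWeight u * (N * (p : ℝ) ^ (-(δ / 4))) := by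
        refine sum_le_sum fun t _ => sum_le_sum fun u _ => mul_le_mul_of_nonneg_left ?_
          (mul_nonneg (sepWeight_nonneg t) (sepWeight_nonneg u))
        refine hcore _ fun n hn => ?_
        rw [norm_mul, norm_mul, norm_ee, norm_ee, one_mul, one_mul]
        exact hβ n hn
    _ = (∑ t : ZMod p, sepWeight t) ^ 2 * (N * (p : ℝ) ^ (-(δ / 4))) := by
        rw [sq, sum_mul_sum, sum_mul]
        simp_rw [sum_mul]
    _ ≤ (2 * (1 + Real.log p)) ^ 2 * (N * (p : ℝ) ^ (-(δ / 4))) := by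
        refine mul_le_mul_of_nonneg_right ?_ (by positivity)
        exact pow_le_pow_left₀ (sum_nonneg fun t _ => sepWeight_nonneg t) sum_sepWeight_le 2
    _ ≤ (p:ℝ) ^ (δ / 4 - δ / 5 + 0) * (N * (p : ℝ) ^ (-(δ / 4))) := by
        refine mul_le_mul_of_nonneg_right (le_trans (le_of_eq (by ring)) hl) (by positivity)
    _ = N * ((p:ℝ) ^ (δ / 4 - δ / 5 + 0) * (p : ℝ) ^ (-(δ / 4))) := by ring
    _ = _ := by
        rw [← Real.rpow_add hp0]; congr 2; ring
end separatedTypeTwo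

section sieveIdentity
open ArithmeticFunction

/-- The indicator function of the integers without prime factors below `y`. -/
def roughInd (y r : ℕ) : ℤ := if ∀ q ∈ r.primeFactors, y ≤ q then 1 else 0

/-- The divisors at which the Legendre sieve of level `D` is cut. -/
def cutDivisors (D y : ℕ) : Finset ℕ :=
  (Ico 2 y).filter fun d => D < d ∧ d / d.minFac ≤ D ∧ d.minFac < y

theorem mem_cutDivisors {D y d : ℕ} (hDy : D * D < y) :
    d ∈ cutDivisors D y ↔ D < d ∧ d / d.minFac ≤ D ∧ d.minFac < y ∧ 2 ≤ d := by
  rw [cutDivisors, mem_filter, mem_Ico]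
  refine ⟨fun h => ⟨h.2.1, h.2.2.1, h.2.2.2, h.1.1⟩, fun h => ⟨⟨h.2.2.2, ?_⟩, h.1, h.2.1, h.2.2.1⟩⟩
  obtain ⟨h1, h2, h3, h4⟩ := h
  have hd : d.minFac * (d / d.minFac) = d := Nat.mul_div_cancel' d.minFac_dvd
  rcases eq_or_ne (d / d.minFac) 1 with h | h
  · rw [h, mul_one] at hd; omega
  · have hpr := Nat.minFac_prime h
    have h5 : d.minFac ≤ (d / d.minFac).minFac :=
      Nat.minFac_le_of_dvd hpr.two_le ((Nat.minFac_dvd _).trans (Nat.div_dvd_of_dvd d.minFac_dvd))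
    have hpos : 0 < d / d.minFac := Nat.div_pos (Nat.minFac_le (by omega)) (Nat.minFac_pos d)
    have h6 := Nat.minFac_le hpos
    nlinarith

theorem minFac_eq_minFac_iff_dvd {r d : ℕ} (hr : r ≠ 1) (hd : d ∣ r) (hd1 : d ≠ 1) :
    d.minFac = r.minFac ↔ r.minFac ∣ d := by
  constructor
  · intro h; rw [← h]; exact d.minFac_dvd
  · intro h
    refine le_antisymm (Nat.minFac_le_of_dvd (Nat.minFac_prime hr).two_le h) ?_
    exact Nat.minFac_le_of_dvd (Nat.minFac_prime hd1).two_le (d.minFac_dvd.trans hd)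

/-- The Legendre sieve cut at level `D`. -/
theorem roughInd_eq {D y r : ℕ} (hD : 1 ≤ D) (hDy : D * D < y) (hr : r ≠ 0) :
    roughInd y r = ∑ d ∈ r.divisors.filter (· ≤ D), moebius d +
      ∑ d ∈ (cutDivisors D y).filter (fun d => d ∣ r ∧ d.minFac = r.minFac), moebius d := by
  have hDy' : D < y := by nlinarith
  rcases eq_or_ne r 1 with rfl | hr1
  · have e1 : (Nat.divisors 1).filter (· ≤ D) = {1} := by
      ext d; simp only [mem_filter, Nat.mem_divisors, mem_singleton, Nat.dvd_one]; omega
    have e2 : (cutDivisors D y).filter (fun d => d ∣ 1 ∧ d.minFac = (1:ℕ).minFac) = ∅ := by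
      ext d
      simp only [mem_filter, mem_cutDivisors hDy, Nat.dvd_one, notMem_empty, iff_false]
      omega
    rw [e1, e2]
    simp [roughInd]
  have hl := Nat.minFac_prime hr1
  set l := r.minFac with hldef
  by_cases hly : l < y
  · have h0 : roughInd y r = 0 := by
      rw [roughInd, if_neg]
      intro h
      have := h l (Nat.mem_primeFactors.2 ⟨hl, r.minFac_dvd, hr⟩)
      omega
    have hdisj : Disjoint (r.divisors.filter (· ≤ D))
        ((cutDivisors D y).filter (fun d => d ∣ r ∧ d.minFac = l)) := by
      rw [disjoint_left]
      intro d h1 h2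
      simp only [mem_filter, mem_cutDivisors hDy] at h1 h2
      omega
    rw [h0, ← sum_union hdisj]
    set U := r.divisors.filter (· ≤ D) ∪
      (cutDivisors D y).filter (fun d => d ∣ r ∧ d.minFac = l) with hU
    have hmem : ∀ d, d ∈ U ↔ d ∣ r ∧ (if l ∣ d then d / l ≤ D else d ≤ D) := by
      intro d
      rw [hU, mem_union, mem_filter, mem_filter, Nat.mem_divisors, mem_cutDivisors hDy]
      by_cases hdr : d ∣ r
      · have hd0 : 0 < d := Nat.pos_of_dvd_of_pos hdr (Nat.pos_of_ne_zero hr)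
        rcases eq_or_ne d 1 with rfl | hd1
        · have : ¬ l ∣ 1 := hl.one_lt.ne' ∘ Nat.dvd_one.1
          rw [if_neg this]
          constructor
          · intro _; exact ⟨hdr, hD⟩
          · intro _; exact Or.inl ⟨⟨hdr, hr⟩, hD⟩
        · have hiff := minFac_eq_minFac_iff_dvd hr1 hdr hd1
          rw [← hldef] at hiff
          by_cases hld : l ∣ d
          · rw [if_pos hld, hiff.2 hld]
            have : d / l ≤ d := Nat.div_le_self _ _
            constructor
            · rintro (h | h)
              · exact ⟨hdr, by omega⟩
              · exact ⟨hdr, h.1.2.1⟩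
            · intro h
              by_cases hdD : d ≤ D
              · exact Or.inl ⟨⟨hdr, hr⟩, hdD⟩
              · exact Or.inr ⟨⟨by omega, h.2, hly, by omega⟩, hdr, rfl⟩
          · rw [if_neg hld]
            constructor
            · rintro (h | h)
              · exact ⟨hdr, h.2⟩
              · exact absurd (hiff.1 h.2.2) hld
            · intro h
              exact Or.inl ⟨⟨hdr, hr⟩, h.2⟩
      · simp [hdr]
    symm
    rw [← sum_filter_of_ne (p := fun d => Squarefree d)
      (fun d _ h => moebius_ne_zero_iff_squarefree.1 h)]
    refine sum_involution (fun d _ => if l ∣ d then d / l else l * d) ?_ ?_ ?_ ?_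
    · intro d hd
      rw [mem_filter] at hd
      split_ifs with h
      · obtain ⟨e, rfl⟩ := h
        rw [Nat.mul_div_cancel_left _ hl.pos]
        have hcop : Nat.Coprime l e := Nat.coprime_of_squarefree_mul hd.2
        rw [isMultiplicative_moebius.map_mul_of_coprime hcop, moebius_apply_prime hl]; ring
      · have hcop : Nat.Coprime l d := (Nat.Prime.coprime_iff_not_dvd hl).2 h
        rw [isMultiplicative_moebius.map_mul_of_coprime hcop, moebius_apply_prime hl]; ring
    · intro d hd _
      rw [mem_filter, hmem] at hd
      have hd0 : 0 < d := Nat.pos_of_dvd_of_pos hd.1.1 (Nat.pos_of_ne_zero hr)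
      split_ifs with h
      · exact (Nat.div_lt_self hd0 hl.one_lt).ne
      · have := hl.two_le
        nlinarith
    · intro d hd
      rw [mem_filter, hmem] at hd
      rw [mem_filter, hmem]
      split_ifs at hd ⊢ with h h1 h1
      · obtain ⟨e, rfl⟩ := h
        rw [Nat.mul_div_cancel_left _ hl.pos] at h1
        have hcop : Nat.Coprime l e := Nat.coprime_of_squarefree_mul hd.2
        exact absurd h1 ((Nat.Prime.coprime_iff_not_dvd hl).1 hcop)
      · exact ⟨⟨(Nat.div_dvd_of_dvd h).trans hd.1.1, hd.1.2⟩,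
          hd.2.squarefree_of_dvd (Nat.div_dvd_of_dvd h)⟩
      · rw [Nat.mul_div_cancel_left _ hl.pos]
        have hcop : Nat.Coprime l d := (Nat.Prime.coprime_iff_not_dvd hl).2 h
        exact ⟨⟨hcop.mul_dvd_of_dvd_of_dvd r.minFac_dvd hd.1.1, hd.1.2⟩,
          (Nat.squarefree_mul hcop).2 ⟨hl.squarefree, hd.2⟩⟩
      · exact absurd (dvd_mul_right l d) h1
    · intro d hd
      rw [mem_filter] at hd
      by_cases h : l ∣ d
      · rw [if_pos h]
        obtain ⟨e, rfl⟩ := h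
        rw [Nat.mul_div_cancel_left _ hl.pos]
        have hcop : Nat.Coprime l e := Nat.coprime_of_squarefree_mul hd.2
        rw [if_neg ((Nat.Prime.coprime_iff_not_dvd hl).1 hcop)]
      · rw [if_neg h, if_pos (dvd_mul_right l d), Nat.mul_div_cancel_left _ hl.pos]
  · have h0 : roughInd y r = 1 := by
      rw [roughInd, if_pos]
      intro q hq
      rw [Nat.mem_primeFactors] at hq
      have := Nat.minFac_le_of_dvd hq.1.two_le hq.2.1
      omega
    have e1 : r.divisors.filter (· ≤ D) = {1} := by
      ext d
      rw [mem_filter, mem_singleton, Nat.mem_divisors]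
      constructor
      · rintro ⟨⟨h1, _⟩, h2⟩
        by_contra h3
        have h4 := Nat.minFac_le_of_dvd (Nat.minFac_prime h3).two_le (d.minFac_dvd.trans h1)
        have h5 := Nat.minFac_le (Nat.pos_of_dvd_of_pos h1 (Nat.pos_of_ne_zero hr))
        omega
      · rintro rfl; exact ⟨⟨one_dvd _, hr⟩, hD⟩
    have e2 : (cutDivisors D y).filter (fun d => d ∣ r ∧ d.minFac = l) = ∅ := by
      ext d
      simp only [mem_filter, mem_cutDivisors hDy, notMem_empty, iff_false]
      omega
    rw [h0, e1, e2]
    simp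

end sieveIdentity

section typeOne
variable {p : ℕ} [Fact p.Prime]

theorem card_Ico_dvd_mul_add_le {k : ℤ} (hk : k ≠ 0) {M m : ℕ} (hm : M ≤ m) (hm0 : 0 < m) (a : ℤ) :
    #((Ico M (2 * M)).filter fun x : ℕ => (m : ℤ) ∣ k * (x : ℤ) + a) ≤ 2 * k.natAbs + 1 := by
  set s := (Ico M (2 * M)).filter fun x : ℕ => (m : ℤ) ∣ k * (x : ℤ) + a with hs
  rcases s.eq_empty_or_nonempty with h | ⟨x₀, hx₀⟩
  · rw [h]; simp
  have hcard : #(Icc (-(k.natAbs : ℤ)) k.natAbs) = 2 * k.natAbs + 1 := by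
    rw [Int.card_Icc]; omega
  rw [← hcard]
  have hdvd : ∀ x ∈ s, (m : ℤ) ∣ k * ((x : ℤ) - x₀) := by
    intro x hx
    rw [hs, mem_filter] at hx hx₀
    have := dvd_sub hx.2 hx₀.2
    rwa [show k * (x:ℤ) + a - (k * (x₀:ℤ) + a) = k * ((x : ℤ) - x₀) by ring] at this
  refine card_le_card_of_injOn (fun x => k * ((x : ℤ) - x₀) / m) ?_ ?_
  · intro x hx
    have hx' := mem_coe.1 hx
    rw [coe_Icc, Set.mem_Icc, ← abs_le]
    obtain ⟨c, hc⟩ := hdvd x hx'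
    rw [hs, mem_filter, mem_Ico] at hx' hx₀
    have hm' : (0:ℤ) < m := by exact_mod_cast hm0
    dsimp only
    rw [hc, Int.mul_ediv_cancel_left _ hm'.ne']
    have h1 : |(m:ℤ) * c| ≤ k.natAbs * m := by
      rw [← hc, abs_mul, Int.natCast_natAbs]
      refine mul_le_mul_of_nonneg_left ?_ (abs_nonneg k)
      rw [abs_le]; constructor <;> omega
    rw [abs_mul, abs_of_pos hm', mul_comm] at h1
    exact le_of_mul_le_mul_right h1 hm'
  · intro x hx x' hx' h
    have hm' : (m:ℤ) ≠ 0 := by exact_mod_cast hm0.ne'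
    obtain ⟨c, hc⟩ := hdvd x hx
    obtain ⟨c', hc'⟩ := hdvd x' hx'
    simp only [hc, hc', Int.mul_ediv_cancel_left _ hm'] at h
    rw [h, ← hc'] at hc
    have := mul_left_cancel₀ hk hc
    omega

theorem card_add_div_eq_le {k : ℤ} (hk : k ≠ 0) {M L : ℕ} (hM : 0 < M) (hMp : 2 * M ≤ p) :
    #{z ∈ (Ico M (2 * M) ×ˢ Icc 1 L) ×ˢ (Ico M (2 * M) ×ˢ Icc 1 L) |
      ((z.1.2 : ℕ) : ZMod p) + (k : ZMod p) * ((z.1.1 : ℕ) : ZMod p)⁻¹ =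
        ((z.2.2 : ℕ) : ZMod p) + (k : ZMod p) * ((z.2.1 : ℕ) : ZMod p)⁻¹} ≤
      (2 * k.natAbs + 1) * (L * M * (2 * ((k.natAbs * M + 4 * L * M ^ 2) / p) + 1)) := by
  have hp : p.Prime := Fact.out
  set W := (k.natAbs * M + 4 * L * M ^ 2) / p with hW
  set s := {z ∈ (Ico M (2 * M) ×ˢ Icc 1 L) ×ˢ (Ico M (2 * M) ×ˢ Icc 1 L) |
      ((z.1.2 : ℕ) : ZMod p) + (k : ZMod p) * ((z.1.1 : ℕ) : ZMod p)⁻¹ =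
        ((z.2.2 : ℕ) : ZMod p) + (k : ZMod p) * ((z.2.1 : ℕ) : ZMod p)⁻¹} with hs
  -- the integer form of the congruence
  let E : (ℕ × ℕ) × (ℕ × ℕ) → ℤ := fun z =>
    k * ((z.1.1 : ℤ) - z.2.1) - ((z.1.2 : ℤ) - z.2.2) * z.1.1 * z.2.1
  have hmem : ∀ z ∈ s, (M ≤ z.1.1 ∧ z.1.1 < 2 * M) ∧ (1 ≤ z.1.2 ∧ z.1.2 ≤ L) ∧
      (M ≤ z.2.1 ∧ z.2.1 < 2 * M) ∧ (1 ≤ z.2.2 ∧ z.2.2 ≤ L) ∧ (p : ℤ) ∣ E z := by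
    intro z hz
    rw [hs, mem_filter] at hz
    simp only [mem_product, mem_Ico, mem_Icc] at hz
    obtain ⟨⟨⟨h1, h2⟩, h3, h4⟩, h5⟩ := hz
    refine ⟨h1, h2, h3, h4, ?_⟩
    rw [← ZMod.intCast_zmod_eq_zero_iff_dvd]
    have ha : ((z.1.1 : ℕ) : ZMod p) ≠ 0 := natCast_ne_zero_of_lt (by omega) (by omega)
    have hb : ((z.2.1 : ℕ) : ZMod p) ≠ 0 := natCast_ne_zero_of_lt (by omega) (by omega)
    simp only [E]
    push_cast
    field_simp at h5
    linear_combination -h5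
  let f : (ℕ × ℕ) × (ℕ × ℕ) → (ℕ × ℕ) × ℤ := fun z => ((z.1.2, z.1.1), E z / p)
  have hp' : (0:ℤ) < p := by exact_mod_cast hp.pos
  have himg : s.image f ⊆ (Icc 1 L ×ˢ Ico M (2 * M)) ×ˢ Icc (-(W:ℤ)) W := by
    intro y hy
    obtain ⟨z, hz, rfl⟩ := mem_image.1 hy
    obtain ⟨h1, h2, h3, h4, c, h5⟩ := hmem z hz
    simp only [f, mem_product, mem_Ico, mem_Icc]
    refine ⟨⟨h2, h1⟩, ?_⟩
    rw [← abs_le, h5, Int.mul_ediv_cancel_left _ hp'.ne']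
    have h6 : |E z| ≤ k.natAbs * M + 4 * L * M ^ 2 := by
      refine (abs_sub _ _).trans (add_le_add ?_ ?_)
      · rw [abs_mul, Int.natCast_natAbs]
        refine mul_le_mul_of_nonneg_left ?_ (abs_nonneg k)
        rw [abs_le]; constructor <;> omega
      · rw [abs_mul, abs_mul, Nat.abs_cast, Nat.abs_cast]
        have e1 : |((z.1.2 : ℤ) - z.2.2)| ≤ L := by rw [abs_le]; constructor <;> omega
        have e2 : (z.1.1 : ℤ) ≤ 2 * M := by omega
        have e3 : (z.2.1 : ℤ) ≤ 2 * M := by omega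
        calc _ ≤ (L:ℤ) * (2 * M) * (2 * M) := by gcongr
          _ = _ := by ring
    rw [h5, abs_mul, abs_of_pos hp'] at h6
    rw [hW, Int.natCast_ediv, Int.le_ediv_iff_mul_le hp']
    rw [Int.natCast_natAbs] at h6
    push_cast
    linarith
  have hfib : ∀ y ∈ s.image f, #{z ∈ s | f z = y} ≤ 2 * k.natAbs + 1 := by
    intro y hy
    obtain ⟨z₀, hz₀, rfl⟩ := mem_image.1 hy
    obtain ⟨g1, g2, g3, g4, g5⟩ := hmem z₀ hz₀
    refine le_trans ?_ (card_Ico_dvd_mul_add_le hk g1.1 (by omega) (E z₀))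
    have key : ∀ z ∈ s, f z = f z₀ → z.1 = z₀.1 ∧ E z = E z₀ := by
      intro z hz h
      simp only [f, Prod.mk.injEq] at h
      refine ⟨Prod.ext h.1.2 h.1.1, ?_⟩
      obtain ⟨-, -, -, -, c, h5⟩ := hmem z hz
      obtain ⟨c', g5'⟩ := g5
      rw [h5, g5', Int.mul_ediv_cancel_left _ hp'.ne', Int.mul_ediv_cancel_left _ hp'.ne'] at h
      rw [h5, g5', h.2]
    refine card_le_card_of_injOn (fun z => z.2.1) ?_ ?_
    · intro z hz
      rw [mem_coe, mem_filter] at hz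
      obtain ⟨h1, h2, h3, h4, -⟩ := hmem z hz.1
      obtain ⟨k1, k2⟩ := key z hz.1 hz.2
      rw [mem_coe, mem_filter, mem_Ico]
      refine ⟨h3, ?_⟩
      rw [← k2]
      simp only [E, k1]
      exact ⟨k - ((z₀.1.2 : ℤ) - z.2.2) * z.2.1, by ring⟩
    · intro z hz z' hz' h
      rw [mem_coe, mem_filter] at hz hz'
      obtain ⟨k1, k2⟩ := key z hz.1 hz.2
      obtain ⟨k1', k2'⟩ := key z' hz'.1 hz'.2
      obtain ⟨h1, h2, h3, h4, -⟩ := hmem z hz.1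
      have h6 : E z = E z' := by rw [k2, k2']
      simp only [E, k1, k1'] at h6
      dsimp only at h
      rw [← h] at h6
      have hne : (z₀.1.1 : ℤ) * z.2.1 ≠ 0 := by
        have : 0 < z₀.1.1 * z.2.1 := Nat.mul_pos (by omega) (by omega)
        exact_mod_cast this.ne'
      have h7 : ((z.2.2 : ℤ)) = z'.2.2 := by
        apply mul_right_cancel₀ hne
        linarith
      refine Prod.ext (by rw [k1, k1']) (Prod.ext h (by exact_mod_cast h7))
  refine (card_le_mul_card_image s _ hfib).trans (Nat.mul_le_mul_left _ ?_)
  refine (card_le_card himg).trans (le_of_eq ?_)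
  rw [card_product, card_product, Nat.card_Icc, Nat.card_Ico, Int.card_Icc]
  congr 1
  · congr 1; omega
  · omega

theorem sum_norm_shift_normSq_le {χ : DirichletCharacter ℂ p} (hχ : χ ≠ 1) {B : ℕ} (hB : B ≤ p) :
    ∑ x : ZMod p, ‖∑ b ∈ range B, χ (x + (b : ZMod p))‖ ^ 2 ≤ p * B := by
  classical
  set I := (range B).image fun b : ℕ => (b : ZMod p) with hI
  have hinj : Set.InjOn (fun b : ℕ => (b : ZMod p)) (range B) := by
    intro a ha b hb h
    rw [mem_coe, mem_range] at ha hb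
    exact natCast_inj_of_lt (by omega) (by omega) h
  have h := sum_shift_normSq_le hχ (fun b => if b ∈ I then 1 else 0)
  have e1 : ∀ x : ZMod p, ∑ b, (if b ∈ I then (1:ℂ) else 0) * χ (x + b) =
      ∑ b ∈ range B, χ (x + (b : ZMod p)) := by
    intro x
    simp_rw [ite_mul, one_mul, zero_mul]
    rw [← sum_filter, filter_mem_eq_inter, univ_inter, hI, sum_image hinj]
  simp_rw [e1] at h
  refine h.trans (le_of_eq ?_)
  congr 1
  have : ∀ b : ZMod p, ‖(if b ∈ I then (1:ℂ) else 0)‖ ^ 2 = if b ∈ I then (1:ℝ) else 0 := by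
    intro b; split_ifs <;> simp
  simp_rw [this]
  rw [sum_boole, filter_mem_eq_inter, univ_inter, hI, card_image_of_injOn hinj, card_range]

theorem norm_sum_Icc_shift_sub_le (f : ℕ → ℂ) (hf : ∀ n, ‖f n‖ ≤ 1) (l b : ℕ) :
    ‖∑ n ∈ Icc 1 l, f n - ∑ n ∈ Icc 1 l, f (n + b)‖ ≤ 2 * b := by
  induction b with
  | zero => simp
  | succ b ih =>
    have h : ∑ n ∈ Icc 1 l, f (n + b) - ∑ n ∈ Icc 1 l, f (n + (b + 1)) = f (1 + b) - f (l + 1 + b) := by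
      have : Icc 1 l = Ico 1 (l + 1) := by ext; simp only [mem_Icc, mem_Ico]; omega
      rw [← sum_sub_distrib, this, ← neg_inj, ← sum_neg_distrib]
      simp_rw [neg_sub]
      have := sum_Ico_sub (fun n => f (n + b)) (by omega : 1 ≤ l + 1)
      rw [← this]
      exact sum_congr rfl fun n _ => by rw [add_right_comm, add_assoc]
    rw [← sub_add_sub_cancel _ (∑ n ∈ Icc 1 l, f (n + b)), h]
    refine (norm_add_le _ _).trans ?_
    have := norm_sub_le (f (1 + b)) (f (l + 1 + b))
    have h1 := hf (1 + b)
    have h2 := hf (l + 1 + b)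
    push_cast
    linarith

theorem norm_sum_Icc_le_shift (f : ℕ → ℂ) (hf : ∀ n, ‖f n‖ ≤ 1) {l L B : ℕ} (hl : l ≤ L)
    (hB : 0 < B) :
    ‖∑ n ∈ Icc 1 l, f n‖ ≤ 2 * B + 1 / B * ∑ n ∈ Icc 1 L, ‖∑ b ∈ range B, f (n + b)‖ := by
  have hB' : (0:ℝ) < B := by exact_mod_cast hB
  have h1 : ‖∑ b ∈ range B, (∑ n ∈ Icc 1 l, f n - ∑ n ∈ Icc 1 l, f (n + b))‖ ≤ B * (2 * B) := by
    refine (norm_sum_le _ _).trans ((sum_le_card_nsmul _ _ (2 * B : ℝ) fun b hb => ?_).trans ?_)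
    · have : (b:ℝ) ≤ B := by exact_mod_cast (mem_range.1 hb).le
      exact (norm_sum_Icc_shift_sub_le f hf l b).trans (by linarith)
    · rw [card_range, nsmul_eq_mul]
  rw [sum_sub_distrib, sum_const, card_range, nsmul_eq_mul, sum_comm] at h1
  have h2 : ‖∑ n ∈ Icc 1 l, ∑ b ∈ range B, f (n + b)‖ ≤
      ∑ n ∈ Icc 1 L, ‖∑ b ∈ range B, f (n + b)‖ :=
    (norm_sum_le _ _).trans (sum_le_sum_of_subset_of_nonneg (Icc_subset_Icc_right hl)
      fun _ _ _ => norm_nonneg _)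
  have h3 := norm_sub_norm_le ((B:ℂ) * ∑ n ∈ Icc 1 l, f n) (∑ n ∈ Icc 1 l, ∑ b ∈ range B, f (n + b))
  rw [norm_mul, Complex.norm_natCast] at h3
  have h4 : (B:ℝ) * ‖∑ n ∈ Icc 1 l, f n‖ ≤ B * (2 * B) + ∑ n ∈ Icc 1 L, ‖∑ b ∈ range B, f (n + b)‖ := by
    linarith
  have h5 : (2 * B + 1 / B * ∑ n ∈ Icc 1 L, ‖∑ b ∈ range B, f (n + b)‖ : ℝ) =
      (B * (2 * B) + ∑ n ∈ Icc 1 L, ‖∑ b ∈ range B, f (n + b)‖) / B := by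
    field_simp
  rw [h5, le_div_iff₀ hB']
  linarith

/-- The Type I estimate on a dyadic range. -/
theorem sum_Ico_norm_sum_le {χ : DirichletCharacter ℂ p} (hχ : χ ≠ 1) {k : ℤ} (hk : k ≠ 0)
    {M L B : ℕ} (hM : 0 < M) (hMp : 2 * M ≤ p) (hB : 0 < B) (hBp : B ≤ p)
    (l : ℕ → ℕ) (hl : ∀ m ∈ Ico M (2 * M), l m ≤ L) :
    ∑ m ∈ Ico M (2 * M), ‖∑ n ∈ Icc 1 (l m), χ ((m : ZMod p) * (n : ZMod p) + k)‖ ≤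
      2 * M * B + Real.sqrt (((2 * k.natAbs + 1) *
        (L * M * (2 * ((k.natAbs * M + 4 * L * M ^ 2) / p) + 1))) * p / B) := by
  have hp : p.Prime := Fact.out
  have hp0 : (0:ℝ) < p := by exact_mod_cast hp.pos
  have hB' : (0:ℝ) < B := by exact_mod_cast hB
  let F : ZMod p → ℝ := fun x => ‖∑ b ∈ range B, χ (x + (b : ZMod p))‖
  let g : ℕ × ℕ → ZMod p := fun z => ((z.2 : ℕ) : ZMod p) + (k : ZMod p) * ((z.1 : ℕ) : ZMod p)⁻¹
  set s := Ico M (2 * M) ×ˢ Icc 1 L with hs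
  have h1 : ∀ m ∈ Ico M (2 * M), ‖∑ n ∈ Icc 1 (l m), χ ((m : ZMod p) * (n : ZMod p) + k)‖ ≤
      2 * B + 1 / B * ∑ n ∈ Icc 1 L, F (g (m, n)) := by
    intro m hm
    have hm' := mem_Ico.1 hm
    have hm0 : ((m : ℕ) : ZMod p) ≠ 0 := natCast_ne_zero_of_lt (by omega) (by omega)
    have e1 : ∀ n : ℕ, χ ((m : ZMod p) * (n : ZMod p) + k) = χ m * χ (g (m, n)) := by
      intro n
      rw [← map_mul]; congr 1; simp only [g]; field_simp
    simp_rw [e1]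
    rw [← mul_sum, norm_mul, char_norm_eq_one χ hm0, one_mul]
    refine (norm_sum_Icc_le_shift (fun n => χ (g (m, n))) (fun n => norm_char_le_one χ _)
      (hl m hm) hB).trans (le_of_eq ?_)
    simp only [F, g]
    congr 2
    refine sum_congr rfl fun n _ => ?_
    congr 1
    refine sum_congr rfl fun b _ => ?_
    congr 1
    push_cast
    ring
  have h2 : ∑ m ∈ Ico M (2 * M), ‖∑ n ∈ Icc 1 (l m), χ ((m : ZMod p) * (n : ZMod p) + k)‖ ≤
      2 * M * B + 1 / B * ∑ z ∈ s, F (g z) := by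
    refine (sum_le_sum h1).trans (le_of_eq ?_)
    rw [sum_add_distrib, sum_const, Nat.card_Ico, ← mul_sum, hs, sum_product, nsmul_eq_mul]
    have : 2 * M - M = M := by omega
    rw [this]; ring
  refine h2.trans (add_le_add_right ?_ _)
  have h3 : ∑ z ∈ s, F (g z) = ∑ x : ZMod p, (#{z ∈ s | g z = x} : ℝ) * F x := by
    rw [← sum_fiberwise s g]
    refine sum_congr rfl fun x _ => ?_
    rw [← nsmul_eq_mul, ← sum_const]
    exact sum_congr rfl fun z hz => by rw [(mem_filter.1 hz).2]
  have h4 : ∑ x : ZMod p, (#{z ∈ s | g z = x} : ℝ) ^ 2 =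
      (#{z ∈ s ×ˢ s | g z.1 = g z.2} : ℝ) := by
    have : #{z ∈ s ×ˢ s | g z.1 = g z.2} = ∑ x : ZMod p, #{z ∈ s | g z = x} ^ 2 := by
      rw [card_eq_sum_card_fiberwise (f := fun z => g z.1) (t := univ) (fun _ _ => mem_univ _)]
      refine sum_congr rfl fun x _ => ?_
      rw [sq, ← card_product]
      congr 1
      ext z
      simp only [mem_filter, mem_product]
      constructor
      · rintro ⟨⟨⟨a, b⟩, c⟩, d⟩; exact ⟨⟨a, d⟩, b, by rw [← c, d]⟩
      · rintro ⟨⟨a, d⟩, b, e⟩; exact ⟨⟨⟨a, b⟩, by rw [d, e]⟩, d⟩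
    rw [this]; push_cast; rfl
  have h5 := card_add_div_eq_le (p := p) (L := L) hk hM hMp
  have h6 : (∑ z ∈ s, F (g z)) ^ 2 ≤ (((2 * k.natAbs + 1) *
        (L * M * (2 * ((k.natAbs * M + 4 * L * M ^ 2) / p) + 1))) : ℝ) * (p * B) := by
    rw [h3]
    refine (sum_mul_sq_le_sq_mul_sq _ _ _).trans ?_
    refine mul_le_mul ?_ (sum_norm_shift_normSq_le hχ hBp) (sum_nonneg fun _ _ => sq_nonneg _) (by positivity)
    rw [h4]
    have h7 : (#{z ∈ s ×ˢ s | g z.1 = g z.2} : ℝ) ≤ (((2 * k.natAbs + 1) * (L * M * (2 * ((k.natAbs * M + 4 * L * M ^ 2) / p) + 1)) : ℕ) : ℝ) := by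
      exact_mod_cast h5
    refine h7.trans ?_
    have h8 : (((k.natAbs * M + 4 * L * M ^ 2) / p : ℕ) : ℝ) ≤ ((k.natAbs * M + 4 * L * M ^ 2) / p : ℝ) := by
      refine Nat.cast_div_le.trans (le_of_eq ?_)
      push_cast; ring
    push_cast at h8 ⊢
    gcongr
  refine Real.le_sqrt_of_sq_le ?_
  rw [mul_pow, div_pow, one_pow, one_div, inv_mul_le_iff₀ (by positivity)]
  refine h6.trans (le_of_eq ?_)
  field_simp
end typeOne

section typeOneTotal

theorem natLog_two_add_one_le {n p : ℕ} (hn : n ≤ p) (hp : 1 ≤ p) :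
    ((Nat.log 2 n + 1 : ℕ) : ℝ) ≤ 2 * (1 + Real.log p) := by
  have h1 : (Nat.log 2 p : ℝ) ≤ Real.logb 2 p := by exact_mod_cast Real.natLog_le_logb p 2
  have h2 : (Nat.log 2 n : ℝ) ≤ Nat.log 2 p := by exact_mod_cast Nat.log_mono_right hn
  have h3 : Real.logb 2 p ≤ 2 * Real.log p := by
    rw [Real.logb, div_le_iff₀ (Real.log_pos one_lt_two)]
    have := Real.log_two_gt_d9
    have h4 : 0 ≤ Real.log p := Real.log_nonneg (by exact_mod_cast hp)
    nlinarith
  push_cast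
  linarith

theorem sum_Icc_le_sum_dyadic (f : ℕ → ℝ) (hf : ∀ n, 0 ≤ f n) (W : ℕ) :
    ∑ m ∈ Icc 1 W, f m ≤
      ∑ j ∈ range (Nat.log 2 W + 1), ∑ m ∈ Ico (2 ^ j) (2 * 2 ^ j), f m := by
  rw [← sum_fiberwise_of_maps_to (s := Icc 1 W) (t := range (Nat.log 2 W + 1)) (g := Nat.log 2)]
  · refine sum_le_sum fun j _ => sum_le_sum_of_subset_of_nonneg ?_ fun _ _ _ => hf _
    intro m hm
    rw [mem_filter, mem_Icc] at hm
    obtain ⟨⟨h1, h2⟩, rfl⟩ := hm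
    rw [mem_Ico, ← pow_succ']
    exact ⟨Nat.pow_log_le_self 2 (by omega), Nat.lt_pow_succ_log_self one_lt_two m⟩
  · intro m hm
    rw [mem_Icc] at hm
    rw [mem_range]
    exact Nat.lt_succ_of_le (Nat.log_mono_right hm.2)

variable {p : ℕ} [Fact p.Prime]

theorem sum_Ico_norm_sum_div_le {χ : DirichletCharacter ℂ p} (hχ : χ ≠ 1) {k : ℤ} (hk : k ≠ 0)
    {M N : ℕ} {x : ℝ} (hx : 1 ≤ x) (hM : 0 < M) (hNp : N < p)
    (h1 : ((M:ℝ) * x) ^ 2 ≤ N) (h2 : (M:ℝ) * x ^ 2 * p ≤ (N:ℝ) ^ 2) (hMp : 2 * M ≤ p) :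
    ∑ m ∈ Ico M (2 * M), ‖∑ n ∈ Icc 1 (N / m), χ ((m : ZMod p) * (n : ZMod p) + k)‖ ≤
      (2 * k.natAbs + 13) * N / Real.sqrt x := by
  have hp : p.Prime := Fact.out
  have hp0 : (0:ℝ) < p := by exact_mod_cast hp.pos
  have hx0 : 0 < x := by linarith
  have hM1 : (1:ℝ) ≤ M := by exact_mod_cast hM
  have hMN : (M:ℝ) * x ≤ N := by
    refine le_trans ?_ h1
    nlinarith [mul_le_mul hM1 hx zero_le_one (by linarith : (0:ℝ) ≤ M)]
  have hMN' : M ≤ N := by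
    have : (M:ℝ) ≤ N := by nlinarith
    exact_mod_cast this
  set L := N / M with hL
  have hL1 : 1 ≤ L := (Nat.one_le_div_iff hM).2 hMN'
  have hLM : (L:ℝ) * M ≤ N := by exact_mod_cast Nat.div_mul_le_self N M
  have hxL : x ≤ 2 * L := by
    have : N < (L + 1) * M := by
      rw [hL, mul_comm]; exact Nat.lt_mul_div_succ N hM
    have h3 : (N:ℝ) < (L + 1) * M := by exact_mod_cast this
    have h4 : x < L + 1 := by
      by_contra h; push Not at h
      have : ((L:ℝ) + 1) * M ≤ x * M := by gcongr
      linarith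
    have : (1:ℝ) ≤ L := by exact_mod_cast hL1
    linarith
  set B := ⌈(L:ℝ) / x⌉₊ with hBdef
  have hLx : 0 < (L:ℝ) / x := div_pos (by exact_mod_cast hL1) hx0
  have hB0 : 0 < B := Nat.ceil_pos.2 hLx
  have hB0' : (0:ℝ) < B := by exact_mod_cast hB0
  have hBlow : (L:ℝ) / x ≤ B := Nat.le_ceil _
  have hBup : (B:ℝ) ≤ 3 * (L / x) := by
    have := (Nat.ceil_lt_add_one hLx.le).le
    have h3 : 1 ≤ 2 * ((L:ℝ) / x) := by rw [mul_div_assoc', le_div_iff₀ hx0]; linarith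
    linarith
  have hBp : B ≤ p := by
    rw [hBdef, Nat.ceil_le]
    refine (div_le_self (by positivity) hx).trans ?_
    have : L ≤ N := Nat.div_le_self _ _
    exact_mod_cast (by omega : L ≤ p)
  have hmain := sum_Ico_norm_sum_le (p := p) hχ hk hM hMp hB0 hBp (L := L) (fun m => N / m)
    (fun m hm => Nat.div_le_div_left (mem_Ico.1 hm).1 hM)
  refine hmain.trans ?_
  set κ : ℝ := (k.natAbs : ℝ) with hκ
  have hκ0 : 0 ≤ κ := Nat.cast_nonneg _
  have hN0 : (0:ℝ) ≤ N := Nat.cast_nonneg _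
  have hs0 : 0 < Real.sqrt x := Real.sqrt_pos.2 hx0
  have hsx : Real.sqrt x ≤ x := by
    rw [Real.sqrt_le_left hx0.le]; nlinarith
  have t1 : 2 * (M:ℝ) * B ≤ 6 * N / Real.sqrt x := by
    calc 2 * (M:ℝ) * B ≤ 2 * M * (3 * (L / x)) := by gcongr
      _ = 6 * (L * M) / x := by ring
      _ ≤ 6 * N / Real.sqrt x := by gcongr
  have hMB : (L:ℝ) * M / B ≤ M * x := by
    rw [div_le_iff₀ hB0']
    have : (L:ℝ) ≤ B * x := by rwa [div_le_iff₀ hx0] at hBlow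
    nlinarith
  have t2 : ((2 * κ + 1) * (L * M * (2 * ((κ * M + 4 * L * M ^ 2) / p) + 1))) * p / B ≤
      ((2 * κ + 7) * N / Real.sqrt x) ^ 2 := by
    have e : ((2 * κ + 1) * (L * M * (2 * ((κ * M + 4 * L * M ^ 2) / p) + 1))) * p / B =
        (2 * κ + 1) * (L * M / B) * (2 * κ * M + 8 * (L * M) * M + p) := by field_simp; ring
    have hM2 : (M:ℝ) ≤ N * M := by
      have : (1:ℝ) ≤ N := by linarith [hM1, (by exact_mod_cast hMN' : (M:ℝ) ≤ N)]
      nlinarith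
    have hx2 : (M:ℝ) * x * M ≤ N / x := by
      rw [le_div_iff₀ hx0]; linarith
    have hx3 : (M:ℝ) * x * p ≤ (N:ℝ) ^ 2 / x := by
      rw [le_div_iff₀ hx0]; linarith
    rw [e, div_pow, Real.sq_sqrt hx0.le]
    calc _ ≤ (2 * κ + 1) * (M * x) * (2 * κ * (N * M) + 8 * N * M + p) := by gcongr
      _ = (2 * κ + 1) * ((2 * κ + 8) * N * (M * x * M) + M * x * p) := by ring
      _ ≤ (2 * κ + 1) * ((2 * κ + 8) * N * (N / x) + (N:ℝ) ^ 2 / x) := by gcongr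
      _ = ((2 * κ + 1) * (2 * κ + 9)) * ((N:ℝ) ^ 2 / x) := by ring
      _ ≤ ((2 * κ + 7) ^ 2) * ((N:ℝ) ^ 2 / x) := by
        refine mul_le_mul_of_nonneg_right (by nlinarith) (by positivity)
      _ = _ := by ring
  have t3 := Real.sqrt_le_sqrt t2
  rw [Real.sqrt_sq (by positivity)] at t3
  calc _ ≤ 6 * N / Real.sqrt x + (2 * κ + 7) * N / Real.sqrt x := add_le_add t1 t3
    _ = _ := by ring

theorem exists_sum_norm_sum_div_le {k : ℤ} (hk : k ≠ 0) {η : ℝ} (hη : 0 < η) (hη1 : η ≤ 1 / 10) :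
    ∃ P : ℕ, ∀ p : ℕ, [Fact p.Prime] → P ≤ p → ∀ N : ℕ, N < p → (p : ℝ) ^ ((63 : ℝ) / 76) < N →
      ∀ χ : DirichletCharacter ℂ p, χ ≠ 1 → ∀ W : ℕ, ((W:ℝ) * (p:ℝ) ^ η) ^ 2 ≤ N →
      ∑ m ∈ Icc 1 W, ‖∑ n ∈ Icc 1 (N / m), χ ((m : ZMod p) * (n : ZMod p) + k)‖ ≤
        N * (p:ℝ) ^ (-(η / 4)) := by
  obtain ⟨P₁, h₁⟩ := exists_log_pow_le_rpow (2 * (2 * k.natAbs + 13)) 1 (by linarith : 0 < η / 4)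
  refine ⟨max P₁ 4, fun p hp hP N hN hNp χ hχ W hW => ?_⟩
  have hp0 : (0:ℝ) < p := by exact_mod_cast hp.out.pos
  have hp1 : (1:ℝ) ≤ p := by exact_mod_cast hp.out.one_le
  have hl := h₁ p ((le_max_left _ _).trans hP)
  have hp4 : 4 ≤ p := (le_max_right _ _).trans hP
  have hN0 : (0:ℝ) < N := lt_trans (Real.rpow_pos_of_pos hp0 _) hNp
  set x := (p:ℝ) ^ η with hx
  have hx1 : 1 ≤ x := Real.one_le_rpow hp1 hη.le
  have hx0 : 0 < x := by linarith
  have hNp' : (N:ℝ) ≤ p := by exact_mod_cast hN.le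
  have hsx : Real.sqrt x = (p:ℝ) ^ (η / 2) := by
    rw [hx, Real.sqrt_eq_rpow, ← Real.rpow_mul hp0.le]; congr 1; ring
  rcases Nat.eq_zero_or_pos W with hW0 | hW0
  · subst hW0
    simp only [show Icc 1 0 = (∅ : Finset ℕ) from rfl, sum_empty]
    positivity
  refine (sum_Icc_le_sum_dyadic _ (fun m => norm_nonneg _) W).trans ?_
  have hdy : ∀ j ∈ range (Nat.log 2 W + 1),
      ∑ m ∈ Ico (2 ^ j) (2 * 2 ^ j), ‖∑ n ∈ Icc 1 (N / m), χ ((m : ZMod p) * (n : ZMod p) + k)‖ ≤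
        (2 * k.natAbs + 13) * N / Real.sqrt x := by
    intro j hj
    have hjW : 2 ^ j ≤ W := by
      rw [mem_range] at hj
      exact (Nat.pow_le_pow_right two_pos (by omega)).trans (Nat.pow_log_le_self 2 hW0.ne')
    set M := 2 ^ j with hM
    have hMW : (M:ℝ) ≤ W := by exact_mod_cast hjW
    have hM1 : ((M:ℝ) * x) ^ 2 ≤ N := le_trans (by gcongr) hW
    refine sum_Ico_norm_sum_div_le hχ hk hx1 (by positivity) hN hM1 ?_ ?_
    · have h3 : (M:ℝ) * x ≤ (N:ℝ) ^ ((1:ℝ) / 2) := by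
        rw [← Real.sqrt_eq_rpow]; exact Real.le_sqrt_of_sq_le hM1
      have h4 : x * p ≤ (N:ℝ) ^ ((3:ℝ) / 2) := by
        calc x * p = (p:ℝ) ^ (η + 1) := by rw [Real.rpow_add hp0, Real.rpow_one]
          _ ≤ (p:ℝ) ^ ((63:ℝ) / 76 * (3 / 2)) :=
            Real.rpow_le_rpow_of_exponent_le hp1 (by linarith)
          _ = ((p:ℝ) ^ ((63:ℝ) / 76)) ^ ((3:ℝ) / 2) := by rw [Real.rpow_mul hp0.le]
          _ ≤ _ := Real.rpow_le_rpow (by positivity) hNp.le (by norm_num)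
      calc (M:ℝ) * x ^ 2 * p = (M * x) * (x * p) := by ring
        _ ≤ (N:ℝ) ^ ((1:ℝ) / 2) * (N:ℝ) ^ ((3:ℝ) / 2) := by gcongr
        _ = (N:ℝ) ^ 2 := by rw [← Real.rpow_add hN0, ← Real.rpow_natCast]; norm_num
    · have h5 : (M:ℝ) ^ 2 ≤ p := by
        refine le_trans ?_ (hM1.trans hNp')
        rw [mul_pow]
        exact le_mul_of_one_le_right (by positivity) (one_le_pow₀ hx1)
      have h6 : M ^ 2 ≤ p := by exact_mod_cast h5
      rcases Nat.lt_or_ge M 2 with h | h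
      · omega
      · nlinarith
  refine (sum_le_card_nsmul _ _ _ hdy).trans ?_
  rw [card_range, nsmul_eq_mul, hsx]
  have hWp : W ≤ p := by
    have : (W:ℝ) ≤ p := by
      refine le_trans ?_ (hW.trans hNp')
      have : (1:ℝ) ≤ W := by exact_mod_cast hW0
      nlinarith [mul_le_mul this hx1 zero_le_one (by linarith : (0:ℝ) ≤ W)]
    exact_mod_cast this
  calc _ ≤ 2 * (1 + Real.log p) * ((2 * k.natAbs + 13) * N / (p:ℝ) ^ (η / 2)) :=
        mul_le_mul_of_nonneg_right (natLog_two_add_one_le hWp (by omega)) (by positivity)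
    _ = (2 * (2 * k.natAbs + 13) * (1 + Real.log p) ^ 1) * (N * (p:ℝ) ^ (-(η / 2))) := by
        rw [Real.rpow_neg hp0.le]; ring
    _ ≤ (p:ℝ) ^ (η / 4) * (N * (p:ℝ) ^ (-(η / 2))) :=
        mul_le_mul_of_nonneg_right hl (by positivity)
    _ = N * ((p:ℝ) ^ (η / 4) * (p:ℝ) ^ (-(η / 2))) := by ring
    _ = _ := by rw [← Real.rpow_add hp0]; congr 2; ring
end typeOneTotal

section sieveWeight
open ArithmeticFunction

/-- The primes of `[y, w)`. -/
def midPrimes (y w : ℕ) : Finset ℕ := (Ico y w).filter Nat.Prime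

/-- One minus the number of prime factors in `[y, w)`. -/
def midCoeff (y w r : ℕ) : ℤ := 1 - #{q ∈ midPrimes y w | q ∣ r}

/-- The sieve weight. -/
def sieveWeight (y w r : ℕ) : ℤ := roughInd y r * midCoeff y w r

theorem sum_Icc_filter_dvd {E : Type*} [AddCommMonoid E] (f : ℕ → E) (N : ℕ) {d : ℕ} (hd : 0 < d) :
    ∑ r ∈ Icc 1 N with d ∣ r, f r = ∑ n ∈ Icc 1 (N / d), f (d * n) := by
  symm
  refine sum_bij (fun n _ => d * n) ?_ ?_ ?_ (fun _ _ => rfl)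
  · intro n hn
    rw [mem_Icc] at hn
    rw [mem_filter, mem_Icc]
    refine ⟨⟨Nat.mul_pos hd hn.1, ?_⟩, dvd_mul_right _ _⟩
    rw [mul_comm]; exact (Nat.le_div_iff_mul_le hd).1 hn.2
  · intro a _ b _ h
    exact Nat.eq_of_mul_eq_mul_left hd h
  · intro r hr
    rw [mem_filter, mem_Icc] at hr
    obtain ⟨⟨h1, h2⟩, n, rfl⟩ := hr
    refine ⟨n, ?_, rfl⟩
    rw [mem_Icc, Nat.le_div_iff_mul_le hd]
    exact ⟨Nat.pos_of_mul_pos_left h1, by rwa [mul_comm]⟩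

theorem midCoeff_mul {y w d n : ℕ} (hd : 0 < d) (hdy : d < y) :
    midCoeff y w (d * n) = midCoeff y w n := by
  rw [midCoeff, midCoeff]
  congr 3
  refine filter_congr fun q hq => ?_
  rw [midPrimes, mem_filter, mem_Ico] at hq
  refine ⟨fun h => ?_, fun h => h.mul_left d⟩
  refine (hq.2.dvd_mul.1 h).resolve_left fun h' => ?_
  have := Nat.le_of_dvd hd h'
  omega

theorem minFac_mul_eq_left_iff {d m : ℕ} (hd : d ≠ 1) :
    d.minFac = (d * m).minFac ↔ m = 1 ∨ d.minFac ≤ m.minFac := by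
  have hdm : d * m ≠ 1 := fun h => hd (Nat.eq_one_of_mul_eq_one_right h)
  constructor
  · intro h
    by_cases hm : m = 1
    · exact Or.inl hm
    · right
      rw [h]
      exact Nat.minFac_le_of_dvd (Nat.minFac_prime hm).two_le (m.minFac_dvd.mul_left d)
  · intro h
    have hle : (d * m).minFac ≤ d.minFac :=
      Nat.minFac_le_of_dvd (Nat.minFac_prime hd).two_le (d.minFac_dvd.mul_right m)
    refine le_antisymm ?_ hle
    have hp := Nat.minFac_prime hdm
    rcases hp.dvd_mul.1 (d * m).minFac_dvd with h1 | h1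
    · exact Nat.minFac_le_of_dvd hp.two_le h1
    · rcases h with rfl | h
      · exact absurd (Nat.dvd_one.1 h1) hp.ne_one
      · exact h.trans (Nat.minFac_le_of_dvd hp.two_le h1)

theorem norm_sum_filter_dvd_midCoeff_le (f : ℕ → ℂ) {N D y w d : ℕ} (hd : d ∈ Icc 1 D)
    (hDy : D < y) (hw : 0 < w) :
    ‖∑ r ∈ Icc 1 N with d ∣ r, (midCoeff y w r : ℂ) * f r‖ ≤
      2 * ∑ m ∈ Icc 1 (D * w), ‖∑ n ∈ Icc 1 (N / m), f (m * n)‖ := by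
  rw [mem_Icc] at hd
  rw [sum_Icc_filter_dvd _ N hd.1]
  have e1 : ∀ n : ℕ, (midCoeff y w (d * n) : ℂ) * f (d * n) =
      f (d * n) - ∑ q ∈ midPrimes y w, if q ∣ n then f (d * n) else 0 := by
    intro n
    rw [midCoeff_mul hd.1 (by omega), midCoeff]
    push_cast
    rw [sub_mul, one_mul, ← sum_filter, sum_const, nsmul_eq_mul]
  have e2 : ∑ n ∈ Icc 1 (N / d), (midCoeff y w (d * n) : ℂ) * f (d * n) =
      ∑ n ∈ Icc 1 (N / d), f (d * n) -
        ∑ q ∈ midPrimes y w, ∑ n ∈ Icc 1 (N / (d * q)), f (d * q * n) := by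
    rw [sum_congr rfl fun n _ => e1 n, sum_sub_distrib, sum_comm]
    congr 1
    refine sum_congr rfl fun q hq => ?_
    rw [midPrimes, mem_filter] at hq
    rw [← sum_filter, sum_Icc_filter_dvd (fun n => f (d * n)) (N / d) hq.2.pos, Nat.div_div_eq_div_mul]
    simp_rw [mul_assoc]
  rw [e2, two_mul]
  refine (norm_sub_le _ _).trans (add_le_add ?_ ?_)
  · refine single_le_sum (f := fun m => ‖∑ n ∈ Icc 1 (N / m), f (m * n)‖) (fun _ _ => norm_nonneg _) ?_
    rw [mem_Icc]
    exact ⟨hd.1, hd.2.trans (Nat.le_mul_of_pos_right _ hw)⟩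
  · refine (norm_sum_le _ _).trans ?_
    have hinj : Set.InjOn (fun q => d * q) (midPrimes y w) := fun a _ b _ h =>
      Nat.eq_of_mul_eq_mul_left hd.1 h
    rw [← sum_image (f := fun m => ‖∑ n ∈ Icc 1 (N / m), f (m * n)‖) hinj]
    refine sum_le_sum_of_subset_of_nonneg ?_ fun _ _ _ => norm_nonneg _
    intro m hm
    obtain ⟨q, hq, rfl⟩ := mem_image.1 hm
    rw [midPrimes, mem_filter, mem_Ico] at hq
    rw [mem_Icc]
    exact ⟨Nat.mul_pos hd.1 hq.2.pos, Nat.mul_le_mul hd.2 hq.1.2.le⟩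

/-- Decomposition into Type I and Type II sums. -/
theorem norm_sum_sieveWeight_le (f : ℕ → ℂ) {N D y w H : ℕ} (hD : 1 ≤ D) (hDy : D * D < y)
    (hw : 0 < w) (hH : y ≤ H) :
    ‖∑ r ∈ Icc 1 N, (sieveWeight y w r : ℂ) * f r‖ ≤
      2 * D * ∑ m ∈ Icc 1 (D * w), ‖∑ n ∈ Icc 1 (N / m), f (m * n)‖ +
      ∑ m ∈ Icc 1 N, |(midCoeff y w m : ℝ)| * ‖∑ d ∈ cutDivisors D y,
        if d ≤ N / m ∧ d.minFac ≤ (if m = 1 then H else m.minFac) then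
          (moebius d : ℂ) * f (m * d) else 0‖ := by
  have hDy' : D < y := by nlinarith
  have e1 : ∑ r ∈ Icc 1 N, (sieveWeight y w r : ℂ) * f r =
      ∑ d ∈ Icc 1 D, (moebius d : ℂ) * ∑ r ∈ Icc 1 N with d ∣ r, (midCoeff y w r : ℂ) * f r +
      ∑ d ∈ cutDivisors D y, (moebius d : ℂ) * ∑ r ∈ Icc 1 N with d ∣ r,
        if d.minFac = r.minFac then (midCoeff y w r : ℂ) * f r else 0 := by
    simp_rw [mul_sum, sum_filter]
    rw [sum_comm, sum_comm (s := cutDivisors D y), ← sum_add_distrib]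
    refine sum_congr rfl fun r hr => ?_
    rw [mem_Icc] at hr
    rw [sieveWeight, roughInd_eq hD hDy (by omega)]
    have e : r.divisors.filter (· ≤ D) = (Icc 1 D).filter (· ∣ r) := by
      ext d
      rw [mem_filter, mem_filter, Nat.mem_divisors, mem_Icc]
      constructor
      · rintro ⟨⟨h1, h2⟩, h3⟩
        exact ⟨⟨Nat.pos_of_dvd_of_pos h1 hr.1, h3⟩, h1⟩
      · rintro ⟨⟨h1, h2⟩, h3⟩
        exact ⟨⟨h3, by omega⟩, h2⟩
    rw [e, sum_filter, sum_filter]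
    push_cast
    rw [add_mul, add_mul, sum_mul, sum_mul, sum_mul, sum_mul]
    congr 1
    · refine sum_congr rfl fun d _ => ?_
      split_ifs <;> simp [mul_assoc]
    · refine sum_congr rfl fun d _ => ?_
      rw [ite_and]
      split_ifs <;> simp [mul_assoc]
  rw [e1]
  refine (norm_add_le _ _).trans (add_le_add ?_ ?_)
  · refine (norm_sum_le _ _).trans ?_
    have : ∀ d ∈ Icc 1 D, ‖(moebius d : ℂ) * ∑ r ∈ Icc 1 N with d ∣ r, (midCoeff y w r : ℂ) * f r‖ ≤
        2 * ∑ m ∈ Icc 1 (D * w), ‖∑ n ∈ Icc 1 (N / m), f (m * n)‖ := by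
      intro d hd
      rw [norm_mul]
      refine le_trans (mul_le_of_le_one_left (norm_nonneg _) ?_)
        (norm_sum_filter_dvd_midCoeff_le f hd hDy' hw)
      rw [Complex.norm_intCast]
      exact_mod_cast abs_moebius_le_one
    refine (sum_le_card_nsmul _ _ _ this).trans (le_of_eq ?_)
    rw [Nat.card_Icc, nsmul_eq_mul, Nat.add_sub_cancel]
    ring
  · have e2 : ∑ d ∈ cutDivisors D y, (moebius d : ℂ) * ∑ r ∈ Icc 1 N with d ∣ r,
        (if d.minFac = r.minFac then (midCoeff y w r : ℂ) * f r else 0) =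
        ∑ m ∈ Icc 1 N, (midCoeff y w m : ℂ) * ∑ d ∈ cutDivisors D y,
        if d ≤ N / m ∧ d.minFac ≤ (if m = 1 then H else m.minFac) then
          (moebius d : ℂ) * f (m * d) else 0 := by
      have e3 : ∀ d ∈ cutDivisors D y, ∑ r ∈ Icc 1 N with d ∣ r,
          (if d.minFac = r.minFac then (midCoeff y w r : ℂ) * f r else 0) =
          ∑ m ∈ Icc 1 N, if d ≤ N / m ∧ d.minFac ≤ (if m = 1 then H else m.minFac) then
            (midCoeff y w m : ℂ) * f (m * d) else 0 := by
        intro d hd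
        have hd' : 2 ≤ d ∧ d < y ∧ d.minFac < y := by
          rw [cutDivisors, mem_filter, mem_Ico] at hd; tauto
        rw [sum_Icc_filter_dvd _ N (by omega)]
        have e4 : Icc 1 (N / d) = (Icc 1 N).filter fun m => d ≤ N / m := by
          ext m
          rw [mem_filter, mem_Icc, mem_Icc, Nat.le_div_iff_mul_le (by omega)]
          constructor
          · rintro ⟨h1, h2⟩
            rw [Nat.le_div_iff_mul_le (by omega)]
            exact ⟨⟨h1, le_trans (Nat.le_mul_of_pos_right m (by omega)) h2⟩, by rwa [mul_comm]⟩
          · rintro ⟨⟨h1, h2⟩, h3⟩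
            rw [Nat.le_div_iff_mul_le (by omega)] at h3
            exact ⟨h1, by rwa [mul_comm]⟩
        rw [e4, sum_filter]
        refine sum_congr rfl fun m hm => ?_
        rw [ite_and]
        refine if_congr Iff.rfl ?_ rfl
        rw [midCoeff_mul (by omega) hd'.2.1, mul_comm m d]
        refine if_congr ?_ rfl rfl
        rw [minFac_mul_eq_left_iff (by omega)]
        split_ifs with h
        · simp only [h, true_or, true_iff]; omega
        · simp only [h, false_or]
      rw [sum_congr rfl fun d hd => by rw [e3 d hd]]
      simp_rw [mul_sum]
      rw [sum_comm]
      refine sum_congr rfl fun m _ => sum_congr rfl fun d _ => ?_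
      split_ifs <;> ring
    rw [e2]
    refine (norm_sum_le _ _).trans (le_of_eq (sum_congr rfl fun m _ => ?_))
    rw [norm_mul, Complex.norm_intCast]

theorem abs_midCoeff_le {y w m : ℕ} (hm : m ≠ 0) : |(midCoeff y w m : ℝ)| ≤ #m.divisors := by
  have h1 : #{q ∈ midPrimes y w | q ∣ m} ≤ #m.divisors := by
    refine card_le_card fun q hq => ?_
    rw [mem_filter] at hq
    exact Nat.mem_divisors.2 ⟨hq.2, hm⟩
  have h2 : 1 ≤ #m.divisors := card_pos.2 ⟨1, Nat.mem_divisors.2 ⟨one_dvd _, hm⟩⟩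
  have h1' : (#{q ∈ midPrimes y w | q ∣ m} : ℝ) ≤ #m.divisors := by exact_mod_cast h1
  have h2' : (1:ℝ) ≤ #m.divisors := by exact_mod_cast h2
  have h3 : (0:ℝ) ≤ #{q ∈ midPrimes y w | q ∣ m} := Nat.cast_nonneg _
  rw [midCoeff]
  push_cast
  rw [abs_le]; constructor <;> linarith

end sieveWeight

section sieveWeightSum
open ArithmeticFunction

theorem sum_eq_sum_log_pred {E : Type*} [AddCommMonoid E] (S : Finset ℕ) {y : ℕ} (hS : ∀ d ∈ S, d ≤ y)
    (g : ℕ → E) :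
    ∑ d ∈ S, g d = ∑ j ∈ range (Nat.log 2 y + 1), ∑ d ∈ S with Nat.log 2 (d - 1) = j, g d := by
  rw [sum_fiberwise_of_maps_to]
  intro d hd
  rw [mem_range]
  exact Nat.lt_succ_of_le (Nat.log_mono_right ((Nat.sub_le d 1).trans (hS d hd)))

variable {p : ℕ} [Fact p.Prime]

theorem exists_sum_midCoeff_cutDivisors_le {δ : ℝ} (hδ : 0 < δ) (hδ1 : δ ≤ 1 / 1000) :
    ∃ P : ℕ, ∀ p : ℕ, [Fact p.Prime] → P ≤ p → ∀ N : ℕ, N < p → (p : ℝ) ^ ((63 : ℝ) / 76) < N →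
      ∀ χ : DirichletCharacter ℂ p, χ ≠ 1 → ∀ k : ZMod p, k ≠ 0 →
      ∀ D y w H : ℕ, 2 * (p : ℝ) ^ δ ≤ D → y ^ 3 ≤ 8 * N →
      ∑ m ∈ Icc 1 N, |(midCoeff y w m : ℝ)| * ‖∑ d ∈ cutDivisors D y,
        if d ≤ N / m ∧ d.minFac ≤ (if m = 1 then H else m.minFac) then
          (moebius d : ℂ) * χ (((m * d : ℕ) : ZMod p) + k) else 0‖ ≤ N * (p : ℝ) ^ (-(δ / 10)) := by
  obtain ⟨P₁, h₁⟩ := exists_sum_norm_linear_ite_le hδ hδ1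
  obtain ⟨P₂, h₂⟩ := exists_log_pow_le_rpow 2 1 (by linarith : 0 < δ / 40)
  obtain ⟨P₃, h₃⟩ := exists_card_divisors_le_rpow (by linarith : 0 < δ / 40)
  refine ⟨max (max P₁ P₂) (max P₃ 4), fun p hp hP N hN hNp χ hχ k hk D y w H hD hy => ?_⟩
  have hP1 : P₁ ≤ p := ((le_max_left _ _).trans (le_max_left _ _)).trans hP
  have hP2 : P₂ ≤ p := ((le_max_right _ _).trans (le_max_left _ _)).trans hP
  have hP3 : P₃ ≤ p := ((le_max_left _ _).trans (le_max_right _ _)).trans hP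
  have hp4 : 4 ≤ p := ((le_max_right _ _).trans (le_max_right _ _)).trans hP
  have hp0 : (0:ℝ) < p := by exact_mod_cast hp.out.pos
  have hyp : y < p := by
    by_contra h; push Not at h
    have h1 : p ^ 3 ≤ y ^ 3 := Nat.pow_le_pow_left h 3
    nlinarith [Nat.mul_le_mul hp4 hp4]
  have hcut : ∀ d ∈ cutDivisors D y, D < d ∧ 2 ≤ d ∧ d < y := by
    intro d hd
    rw [cutDivisors, mem_filter, mem_Ico] at hd; tauto
  have hdiv : ∀ m ∈ Icc 1 N, |(midCoeff y w m : ℝ)| ≤ (p:ℝ) ^ (δ / 40) := by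
    intro m hm
    rw [mem_Icc] at hm
    refine (abs_midCoeff_le (by omega)).trans (h₃ p hP3 m (by omega) ?_)
    nlinarith
  let G : Finset ℕ → ℕ → ℂ := fun S m => ∑ d ∈ S,
        if d ≤ N / m ∧ d.minFac ≤ (if m = 1 then H else m.minFac) then
          (moebius d : ℂ) * χ (((m * d : ℕ) : ZMod p) + k) else 0
  let S : ℕ → Finset ℕ := fun j => (cutDivisors D y).filter fun d => Nat.log 2 (d - 1) = j
  have hS : ∀ j, ∑ m ∈ Icc 1 N, ‖G (S j) m‖ ≤ N * (p : ℝ) ^ (-(δ / 5)) := by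
    intro j
    rcases (S j).eq_empty_or_nonempty with h | ⟨d₀, hd₀⟩
    · simp only [G, h, sum_empty, norm_zero, sum_const_zero]; positivity
    have hSj : ∀ d ∈ S j, D < d ∧ 2 ≤ d ∧ d < y ∧ 2 ^ j < d ∧ d ≤ 2 * 2 ^ j := by
      intro d hd
      rw [mem_filter] at hd
      obtain ⟨g1, g2, g3⟩ := hcut d hd.1
      have g4 := Nat.pow_log_le_self 2 (by omega : d - 1 ≠ 0)
      have g5 := Nat.lt_pow_succ_log_self one_lt_two (d - 1)
      rw [hd.2] at g4 g5
      rw [pow_succ'] at g5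
      omega
    have hK : (p:ℝ) ^ δ ≤ ((2 ^ j : ℕ) : ℝ) := by
      obtain ⟨g1, g2, g3, g4, g5⟩ := hSj d₀ hd₀
      have : (D:ℝ) ≤ ((2 * 2 ^ j : ℕ) : ℝ) := by exact_mod_cast g1.le.trans g5
      push_cast at this ⊢
      linarith
    have hres : ∑ m ∈ Icc 1 N, ‖G (S j) m‖ = ∑ m ∈ Icc 1 (N / 2 ^ j), ‖G (S j) m‖ := by
      symm
      refine sum_subset (Icc_subset_Icc_right (Nat.div_le_self _ _)) fun m hm hm' => ?_
      rw [mem_Icc] at hm hm'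
      have h0 : G (S j) m = 0 := by
        refine sum_eq_zero fun d hd => if_neg ?_
        rintro ⟨a, -⟩
        apply hm'
        refine ⟨hm.1, ?_⟩
        obtain ⟨g1, g2, g3, g4, g5⟩ := hSj d hd
        rw [Nat.le_div_iff_mul_le (by omega)] at a
        rw [Nat.le_div_iff_mul_le (by positivity)]
        nlinarith
      rw [h0, norm_zero]
    rw [hres]
    have := h₁ p hP1 N hN hNp χ hχ k hk (N / 2 ^ j) (2 ^ j) y hK (Nat.div_mul_le_self _ _) hy (S j)
      (fun d hd => by obtain ⟨g1, g2, g3, g4, g5⟩ := hSj d hd; rw [mem_Icc]; omega)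
      (fun d hd => by obtain ⟨g1, g2, g3, g4, g5⟩ := hSj d hd; rw [mem_Ioc]; omega)
      (fun d => (moebius d : ℂ)) (fun d _ => by
        rw [Complex.norm_intCast]; exact_mod_cast abs_moebius_le_one)
      (fun d => d) (fun d => d.minFac)
      (fun d hd => by obtain ⟨g1, g2, g3, g4, g5⟩ := hSj d hd; omega)
      (fun d hd => by
        obtain ⟨g1, g2, g3, g4, g5⟩ := hSj d hd
        have := Nat.minFac_le (n := d) (by omega)
        omega)
      (fun m => N / m) (fun m => if m = 1 then H else m.minFac)
    simpa only [G, Nat.cast_mul] using this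
  calc _ ≤ ∑ m ∈ Icc 1 N, (p:ℝ) ^ (δ / 40) * ∑ j ∈ range (Nat.log 2 y + 1), ‖G (S j) m‖ := by
        refine sum_le_sum fun m hm => mul_le_mul (hdiv m hm) ?_ (norm_nonneg _) (by positivity)
        rw [sum_eq_sum_log_pred (cutDivisors D y) (fun d hd => (hcut d hd).2.2.le)]
        exact norm_sum_le _ _
    _ = (p:ℝ) ^ (δ / 40) * ∑ j ∈ range (Nat.log 2 y + 1), ∑ m ∈ Icc 1 N, ‖G (S j) m‖ := by
        rw [← mul_sum, sum_comm]
    _ ≤ (p:ℝ) ^ (δ / 40) * ∑ j ∈ range (Nat.log 2 y + 1), N * (p : ℝ) ^ (-(δ / 5)) := by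
        refine mul_le_mul_of_nonneg_left (sum_le_sum fun j _ => hS j) (by positivity)
    _ = (p:ℝ) ^ (δ / 40) * (((Nat.log 2 y + 1 : ℕ) : ℝ) * (N * (p : ℝ) ^ (-(δ / 5)))) := by
        rw [sum_const, card_range, nsmul_eq_mul]
    _ ≤ (p:ℝ) ^ (δ / 40) * ((p:ℝ) ^ (δ / 40) * (N * (p : ℝ) ^ (-(δ / 5)))) := by
        refine mul_le_mul_of_nonneg_left (mul_le_mul_of_nonneg_right ?_ (by positivity)) (by positivity)
        refine (natLog_two_add_one_le hyp.le (by omega)).trans ?_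
        have := h₂ p hP2
        rwa [pow_one] at this
    _ = N * ((p:ℝ) ^ (δ / 40) * (p:ℝ) ^ (δ / 40) * (p : ℝ) ^ (-(δ / 5))) := by ring
    _ ≤ _ := by
        rw [← Real.rpow_add hp0, ← Real.rpow_add hp0]
        refine mul_le_mul_of_nonneg_left ?_ (Nat.cast_nonneg _)
        exact Real.rpow_le_rpow_of_exponent_le (by exact_mod_cast hp.out.one_le) (by linarith)

/-- The bound for the sifted character sum. -/
theorem exists_norm_sum_sieveWeight_char_le {k : ℤ} (hk : k ≠ 0) {η : ℝ} (hη : 0 < η)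
    (hη1 : η ≤ 1 / 1000) :
    ∃ P : ℕ, ∀ p : ℕ, [Fact p.Prime] → P ≤ p → ∀ N : ℕ, N < p → (p : ℝ) ^ ((63 : ℝ) / 76) < N →
      ∀ χ : DirichletCharacter ℂ p, χ ≠ 1 → ∀ y w : ℕ, N < y ^ 3 → y ^ 3 ≤ 8 * N → 0 < w →
      ((w:ℝ) * (p:ℝ) ^ η) ^ 2 ≤ N →
      ‖∑ r ∈ Icc 1 N, (sieveWeight y w r : ℂ) * χ ((r : ZMod p) + k)‖ ≤
        N * (p : ℝ) ^ (-(η / 400)) := by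
  have hδ : 0 < η / 16 := by linarith
  obtain ⟨P₁, h₁⟩ := exists_sum_midCoeff_cutDivisors_le hδ (by linarith)
  obtain ⟨P₂, h₂⟩ := exists_sum_norm_sum_div_le hk (by linarith : 0 < η / 2) (by linarith)
  obtain ⟨P₃, h₃⟩ := exists_log_pow_le_rpow 9 0 (by linarith : 0 < η / 400)
  refine ⟨max (max P₁ P₂) (max P₃ (k.natAbs + 1)), fun p hp hP N hN hNp χ hχ y w hy1 hy2 hw hwη => ?_⟩
  have hP1 : P₁ ≤ p := ((le_max_left _ _).trans (le_max_left _ _)).trans hP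
  have hP2 : P₂ ≤ p := ((le_max_right _ _).trans (le_max_left _ _)).trans hP
  have hP3 : P₃ ≤ p := ((le_max_left _ _).trans (le_max_right _ _)).trans hP
  have hpk : k.natAbs < p := ((le_max_right _ _).trans (le_max_right _ _)).trans hP
  have hp0 : (0:ℝ) < p := by exact_mod_cast hp.out.pos
  have hp1 : (1:ℝ) ≤ p := by exact_mod_cast hp.out.one_le
  have hkp : (k : ZMod p) ≠ 0 := by
    rw [Ne, ZMod.intCast_zmod_eq_zero_iff_dvd]
    intro h
    have := Int.natAbs_dvd_natAbs.2 h
    rw [Int.natAbs_natCast] at this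
    exact absurd (Nat.le_of_dvd (Int.natAbs_pos.2 hk) this) (by omega)
  have h9 : (9:ℝ) ≤ (p:ℝ) ^ (η / 400) := by have := h₃ p hP3; rwa [pow_zero, mul_one] at this
  have hx1 : 1 ≤ (p:ℝ) ^ (η / 16) := Real.one_le_rpow hp1 hδ.le
  set D := ⌈2 * (p:ℝ) ^ (η / 16)⌉₊ with hD
  have hDlow : 2 * (p:ℝ) ^ (η / 16) ≤ D := Nat.le_ceil _
  have hDup : (D:ℝ) ≤ 3 * (p:ℝ) ^ (η / 16) := by
    have := (Nat.ceil_lt_add_one (by positivity : 0 ≤ 2 * (p:ℝ) ^ (η / 16))).le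
    linarith
  have hD1 : 1 ≤ D := by
    have : (1:ℝ) ≤ D := by linarith
    exact_mod_cast this
  have hDup' : (D:ℝ) ≤ (p:ℝ) ^ (η / 8) := by
    calc (D:ℝ) ≤ 9 * (p:ℝ) ^ (η / 16) := by linarith
      _ ≤ (p:ℝ) ^ (η / 400) * (p:ℝ) ^ (η / 16) := by gcongr
      _ = (p:ℝ) ^ (η / 400 + η / 16) := by rw [Real.rpow_add hp0]
      _ ≤ _ := Real.rpow_le_rpow_of_exponent_le hp1 (by linarith)
  have hDy : D * D < y := by
    have h1 : ((D * D : ℕ) : ℝ) ≤ (p:ℝ) ^ (η / 4) := by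
      push_cast
      calc (D:ℝ) * D ≤ (p:ℝ) ^ (η / 8) * (p:ℝ) ^ (η / 8) := by gcongr
        _ = _ := by rw [← Real.rpow_add hp0]; congr 1; ring
    have h2 : (((D * D : ℕ) : ℝ)) ^ 3 < (y:ℝ) ^ 3 := by
      calc (((D * D : ℕ) : ℝ)) ^ 3 ≤ ((p:ℝ) ^ (η / 4)) ^ 3 := by gcongr
        _ = (p:ℝ) ^ (η / 4 * 3) := by rw [Real.rpow_mul hp0.le]; norm_cast
        _ ≤ (p:ℝ) ^ ((63:ℝ) / 76) := Real.rpow_le_rpow_of_exponent_le hp1 (by linarith)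
        _ < N := hNp
        _ ≤ (y:ℝ) ^ 3 := by exact_mod_cast hy1.le
    have := lt_of_pow_lt_pow_left₀ 3 (by positivity) h2
    exact_mod_cast this
  have hmain := norm_sum_sieveWeight_le (fun r => χ ((r : ZMod p) + k)) (N := N) (H := y) hD1 hDy hw le_rfl
  have hII := h₁ p hP1 N hN hNp χ hχ k hkp D y w y hDlow hy2
  have hW : (((D * w : ℕ) : ℝ) * (p:ℝ) ^ (η / 2)) ^ 2 ≤ N := by
    refine le_trans (pow_le_pow_left₀ (by positivity) ?_ 2) hwη
    push_cast
    calc (D:ℝ) * w * (p:ℝ) ^ (η / 2) ≤ (p:ℝ) ^ (η / 8) * w * (p:ℝ) ^ (η / 2) := by gcongr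
      _ = w * ((p:ℝ) ^ (η / 8) * (p:ℝ) ^ (η / 2)) := by ring
      _ ≤ w * (p:ℝ) ^ η := by
        rw [← Real.rpow_add hp0]
        exact mul_le_mul_of_nonneg_left (Real.rpow_le_rpow_of_exponent_le hp1 (by linarith))
          (Nat.cast_nonneg _)
  have hI := h₂ p hP2 N hN hNp χ hχ (D * w) hW
  refine hmain.trans ?_
  have hI' : 2 * (D:ℝ) * ∑ m ∈ Icc 1 (D * w), ‖∑ n ∈ Icc 1 (N / m), χ (((m * n : ℕ) : ZMod p) + k)‖ ≤
      6 * (p:ℝ) ^ (η / 16) * (N * (p:ℝ) ^ (-(η / 2 / 4))) := by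
    simp_rw [Nat.cast_mul]
    exact mul_le_mul (by linarith) hI (sum_nonneg fun _ _ => norm_nonneg _) (by positivity)
  have hfin : ∀ c : ℝ, c ≤ -(η / 200) → (p:ℝ) ^ c ≤ (p:ℝ) ^ (-(η / 400)) / 9 := by
    intro c hc
    rw [le_div_iff₀ (by norm_num)]
    calc (p:ℝ) ^ c * 9 ≤ (p:ℝ) ^ c * (p:ℝ) ^ (η / 400) := by gcongr
      _ = (p:ℝ) ^ (c + η / 400) := by rw [Real.rpow_add hp0]
      _ ≤ _ := Real.rpow_le_rpow_of_exponent_le hp1 (by linarith)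
  refine (add_le_add hI' hII).trans ?_
  have e1 : 6 * (p:ℝ) ^ (η / 16) * (N * (p:ℝ) ^ (-(η / 2 / 4))) =
      6 * N * (p:ℝ) ^ (η / 16 + -(η / 2 / 4)) := by rw [Real.rpow_add hp0]; ring
  rw [e1]
  have f1 := hfin (η / 16 + -(η / 2 / 4)) (by linarith)
  have f2 := hfin (-(η / 16 / 10)) (by linarith)
  have hN0 : (0:ℝ) ≤ N := Nat.cast_nonneg _
  have f3 : 0 ≤ (N:ℝ) * (p:ℝ) ^ (-(η / 400)) := by positivity
  calc _ ≤ 6 * N * ((p:ℝ) ^ (-(η / 400)) / 9) + N * ((p:ℝ) ^ (-(η / 400)) / 9) :=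
        add_le_add (mul_le_mul_of_nonneg_left f1 (by positivity))
          (mul_le_mul_of_nonneg_left f2 hN0)
    _ ≤ _ := by linarith
end sieveWeightSum

section large_values
variable {p : ℕ} [Fact p.Prime]

theorem sum_fej_le {T : ℕ} (hT : 1 ≤ T) (hTp : T ≤ p) : ∑ x : ZMod p, fej T x ≤ p / T := by
  have hp : p.Prime := Fact.out
  have hT0 : (0:ℝ) < T := by exact_mod_cast hT
  have h1 : (∑ x : ZMod p, (fej T x : ℂ)) = (p : ℂ) / T := by
    simp_rw [fej_eq]
    rw [← mul_sum, sum_comm]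
    have : ∀ i ∈ range T, ∑ x : ZMod p, ∑ j ∈ range T, ee (((i : ZMod p) - (j : ZMod p)) * x) = p := by
      intro i hi
      rw [sum_comm]
      simp_rw [sum_ee]
      rw [sum_eq_single i]
      · simp
      · intro j hj hji
        rw [if_neg]
        intro h
        exact hji (natCast_inj_of_lt ((mem_range.1 hj).trans_le hTp) ((mem_range.1 hi).trans_le hTp)
          (sub_eq_zero.1 h).symm)
      · intro h; exact absurd hi h
    rw [sum_congr rfl this, sum_const, card_range, nsmul_eq_mul]
    have : (T:ℂ) ≠ 0 := by exact_mod_cast hT0.ne'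
    field_simp
  rw [← Complex.ofReal_sum] at h1
  have h2 : (((p : ℝ) / T : ℝ) : ℂ) = (p : ℂ) / T := by push_cast; rfl
  rw [← h2] at h1
  exact (Complex.ofReal_injective h1).le

theorem norm_sum_range_sub_char_le (ψ : DirichletCharacter ℂ p) (T : ℕ) :
    ‖∑ i ∈ range T, ∑ j ∈ range T, ψ ((i : ZMod p) - (j : ZMod p))‖ ≤
      2 * ‖∑ t ∈ Icc 1 T, ((T - t : ℕ) : ℂ) * ψ (t : ZMod p)‖ := by
  have key : ∀ T : ℕ, ∑ i ∈ range T, ∑ j ∈ range T, ψ ((i : ZMod p) - (j : ZMod p)) =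
      (1 + ψ (-1)) * ∑ t ∈ Icc 1 T, ((T - t : ℕ) : ℂ) * ψ (t : ZMod p) := by
    intro T
    induction T with
    | zero => simp
    | succ n ih =>
      have h1 : ∑ t ∈ Icc 1 (n+1), ((n + 1 - t : ℕ) : ℂ) * ψ (t : ZMod p) =
          ∑ t ∈ Icc 1 n, ((n - t : ℕ) : ℂ) * ψ (t : ZMod p) + ∑ t ∈ Icc 1 n, ψ (t : ZMod p) := by
        rw [sum_Icc_succ_top (by omega), ← sum_add_distrib]
        simp only [tsub_self, Nat.cast_zero, zero_mul, add_zero]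
        refine sum_congr rfl fun t ht => ?_
        rw [Nat.succ_sub (mem_Icc.1 ht).2]; push_cast; ring
      have h2 : ∑ j ∈ range n, ψ ((n : ZMod p) - (j : ZMod p)) = ∑ t ∈ Icc 1 n, ψ (t : ZMod p) := by
        refine sum_nbij' (fun j => n - j) (fun t => n - t) ?_ ?_ ?_ ?_ ?_
        · intro j hj; simp only [mem_range, mem_Icc] at *; omega
        · intro j hj; simp only [mem_range, mem_Icc] at *; omega
        · intro j hj; simp only [mem_range] at *; omega
        · intro j hj; simp only [mem_Icc] at *; omega
        · intro j hj
          rw [Nat.cast_sub (mem_range.1 hj).le]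
      have h3 : ∑ i ∈ range n, ψ ((i : ZMod p) - (n : ZMod p)) =
          ψ (-1) * ∑ t ∈ Icc 1 n, ψ (t : ZMod p) := by
        rw [← h2, mul_sum]
        refine sum_congr rfl fun i _ => ?_
        rw [← map_mul]; congr 1; ring
      rw [sum_range_succ, sum_congr rfl fun i _ => sum_range_succ _ n, sum_add_distrib, ih, h1, h3,
        sum_range_succ, h2, sub_self, MulChar.map_zero ψ]
      ring
  rw [key, norm_mul]
  refine mul_le_mul_of_nonneg_right ((norm_add_le _ _).trans ?_) (norm_nonneg _)
  rw [norm_one]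
  linarith [norm_char_le_one ψ (-1)]

theorem norm_sum_fej_char_le {ψ : DirichletCharacter ℂ p} (hψ : ψ ≠ 1) (T : ℕ) :
    ‖∑ x : ZMod p, (fej T x : ℂ) * ψ x‖ ≤
      2 * √p / T ^ 2 * ‖∑ t ∈ Icc 1 T, ((T - t : ℕ) : ℂ) * ψ⁻¹ (t : ZMod p)‖ := by
  have h1 : ∑ x : ZMod p, (fej T x : ℂ) * ψ x = (1 / (T : ℂ) ^ 2) * ((∑ x, ψ x * ee x) *
      ∑ i ∈ range T, ∑ j ∈ range T, ψ⁻¹ ((i : ZMod p) - (j : ZMod p))) := by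
    simp_rw [fej_eq, mul_assoc]
    rw [← mul_sum]
    congr 1
    rw [mul_sum]
    simp_rw [sum_mul]
    rw [sum_comm]
    refine sum_congr rfl fun i _ => ?_
    rw [← sum_mul, mul_sum, sum_comm]
    refine sum_congr rfl fun j _ => ?_
    have := sum_char_mul_ee hψ ((i : ZMod p) - (j : ZMod p))
    rw [MulChar.inv_apply' , mul_comm, ← this]
    exact sum_congr rfl fun x _ => mul_comm _ _
  rw [h1, norm_mul, norm_mul]
  have h2 : ‖∑ x, ψ x * ee x‖ = √p := by
    rw [← norm_sum_char_ee hψ, Real.sqrt_sq (norm_nonneg _)]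
  rw [h2]
  have h3 := norm_sum_range_sub_char_le ψ⁻¹ T
  simp only [norm_div, norm_one, norm_pow, Complex.norm_natCast]
  calc _ ≤ 1 / (T:ℝ) ^ 2 * (√p * (2 * ‖∑ t ∈ Icc 1 T, ((T - t : ℕ) : ℂ) * ψ⁻¹ (t : ZMod p)‖)) := by
        gcongr
    _ = _ := by ring

/-- Large sieve type inequality over an arbitrary set of characters. -/
theorem sum_mem_normSq_le {N T : ℕ} (hN : N < p) (hT : 1 ≤ T) (hTN : T = 1 ∨ 16 * T * N ≤ p)
    (hTp : T ≤ p) {S : Finset ℕ} (hS : S ⊆ Icc 1 N) (V : Finset (DirichletCharacter ℂ p)) {W : ℝ}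
    (hW : ∀ χ : DirichletCharacter ℂ p,
      ∑ χ' ∈ V, ‖∑ t ∈ Icc 1 T, ((T - t : ℕ) : ℂ) * (χ * χ'⁻¹) (t : ZMod p)‖ ≤ W) :
    ∑ χ ∈ V, ‖∑ q ∈ S, χ (q : ZMod p)‖ ^ 2 ≤ 4 * N * (p / T + 2 * √p / T ^ 2 * W) := by
  classical
  set A : DirichletCharacter ℂ p → ℂ := fun χ => ∑ q ∈ S, χ (q : ZMod p) with hA
  set Y := ∑ χ ∈ V, ‖A χ‖ ^ 2 with hY
  have hW0 : 0 ≤ W := (sum_nonneg fun _ _ => norm_nonneg _).trans (hW 1)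
  have hY0 : 0 ≤ Y := sum_nonneg fun _ _ => by positivity
  set F : ZMod p → ℂ := fun x => ∑ χ ∈ V, conj (A χ) * χ x with hF
  have h1 : (Y : ℂ) = ∑ q ∈ S, F (q : ZMod p) := by
    simp only [hF]
    rw [sum_comm, hY, Complex.ofReal_sum]
    refine sum_congr rfl fun χ _ => ?_
    rw [← mul_sum, mul_comm]
    change _ = A χ * _
    rw [Complex.mul_conj']; push_cast; rfl
  have h2 : Y ^ 2 ≤ N * ∑ q ∈ S, ‖F (q : ZMod p)‖ ^ 2 := by
    have h : Y ≤ ∑ q ∈ S, ‖F (q : ZMod p)‖ := by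
      have := norm_sum_le S fun q => F (q : ZMod p)
      rwa [← h1, Complex.norm_of_nonneg hY0] at this
    calc Y ^ 2 ≤ (∑ q ∈ S, ‖F (q : ZMod p)‖) ^ 2 := pow_le_pow_left₀ hY0 h 2
      _ ≤ #S * ∑ q ∈ S, ‖F (q : ZMod p)‖ ^ 2 := sq_sum_le_card_mul_sum_sq
      _ ≤ _ := by
        refine mul_le_mul_of_nonneg_right ?_ (sum_nonneg fun _ _ => by positivity)
        have := card_le_card hS
        rw [Nat.card_Icc, Nat.add_sub_cancel] at this
        exact_mod_cast this
  have h3 : ∑ q ∈ S, ‖F (q : ZMod p)‖ ^ 2 ≤ 4 * ∑ x : ZMod p, fej T x * ‖F x‖ ^ 2 := by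
    rw [mul_sum]
    have hinj : Set.InjOn (fun q : ℕ => (q : ZMod p)) S := by
      intro a ha b hb hab
      have ha' := mem_Icc.1 (hS ha); have hb' := mem_Icc.1 (hS hb)
      exact natCast_inj_of_lt (by omega) (by omega) hab
    calc _ ≤ ∑ q ∈ S, 4 * (fej T (q : ZMod p) * ‖F (q : ZMod p)‖ ^ 2) := by
          refine sum_le_sum fun q hq => ?_
          have hq' := mem_Icc.1 (hS hq)
          have : 1 / 4 ≤ fej T (q : ZMod p) := by
            refine fej_ge hT (hTN.imp id fun h => le_trans ?_ h)
            exact Nat.mul_le_mul_left _ hq'.2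
          nlinarith [sq_nonneg ‖F (q : ZMod p)‖]
      _ = ∑ x ∈ S.image (fun q : ℕ => (q : ZMod p)), 4 * (fej T x * ‖F x‖ ^ 2) :=
          (sum_image (f := fun x : ZMod p => 4 * (fej T x * ‖F x‖ ^ 2)) hinj).symm
      _ ≤ _ := sum_le_sum_of_subset_of_nonneg (subset_univ _) fun x _ _ =>
          mul_nonneg (by norm_num) (mul_nonneg (fej_nonneg T x) (by positivity))
  set G : DirichletCharacter ℂ p → DirichletCharacter ℂ p → ℝ := fun χ χ' =>
    ‖∑ x : ZMod p, (fej T x : ℂ) * (χ * χ'⁻¹) x‖ with hG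
  set M := (p:ℝ) / T + 2 * √p / T ^ 2 * W with hM
  have hGM : ∀ χ, ∑ χ' ∈ V, G χ' χ ≤ M := by
    intro χ
    have hpt : ∀ χ', G χ' χ ≤ (if χ' = χ then (p:ℝ) / T else 0) + 2 * √p / T ^ 2 *
        ‖∑ t ∈ Icc 1 T, ((T - t : ℕ) : ℂ) * (χ * χ'⁻¹) (t : ZMod p)‖ := by
      intro χ'
      by_cases h : χ' = χ
      · rw [if_pos h]
        have : G χ' χ ≤ p / T := by
          refine (norm_sum_le _ _).trans (le_trans (sum_le_sum fun x _ => ?_) (sum_fej_le hT hTp))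
          rw [norm_mul, Complex.norm_of_nonneg (fej_nonneg T x)]
          exact mul_le_of_le_one_right (fej_nonneg T x) (norm_char_le_one _ _)
        have h0 : 0 ≤ 2 * √p / (T:ℝ) ^ 2 *
          ‖∑ t ∈ Icc 1 T, ((T - t : ℕ) : ℂ) * (χ * χ'⁻¹) (t : ZMod p)‖ := by positivity
        linarith
      · rw [if_neg h, zero_add]
        have hne : χ' * χ⁻¹ ≠ 1 := fun h' => h (mul_inv_eq_one.1 h')
        have := norm_sum_fej_char_le hne T
        rwa [mul_inv_rev, inv_inv] at this
    refine (sum_le_sum fun χ' _ => hpt χ').trans ?_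
    rw [sum_add_distrib, ← mul_sum]
    refine add_le_add ?_ (mul_le_mul_of_nonneg_left (hW χ) (by positivity))
    rw [sum_ite_eq']
    split_ifs
    · exact le_rfl
    · positivity
  have hGsymm : ∀ χ χ', G χ χ' = G χ' χ := by
    intro χ χ'
    simp only [hG]
    rw [← Complex.norm_conj, map_sum]
    congr 1
    refine sum_congr rfl fun x _ => ?_
    rw [map_mul, Complex.conj_ofReal, conj_char, ← MulChar.inv_apply', mul_inv_rev, inv_inv]
  have h4 : ∑ x : ZMod p, fej T x * ‖F x‖ ^ 2 ≤ Y * M := by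
    have e1 : ((∑ x : ZMod p, fej T x * ‖F x‖ ^ 2 : ℝ) : ℂ) =
        ∑ χ ∈ V, ∑ χ' ∈ V, (conj (A χ) * A χ') * ∑ x : ZMod p, (fej T x : ℂ) * (χ * χ'⁻¹) x := by
      rw [Complex.ofReal_sum]
      have : ∀ x : ZMod p, ((fej T x * ‖F x‖ ^ 2 : ℝ) : ℂ) =
          ∑ χ ∈ V, ∑ χ' ∈ V, (conj (A χ) * A χ') * ((fej T x : ℂ) * (χ * χ'⁻¹) x) := by
        intro x
        push_cast
        rw [← Complex.mul_conj']
        simp only [hF]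
        rw [map_sum, sum_mul_sum, mul_sum]
        refine sum_congr rfl fun χ _ => ?_
        rw [mul_sum]
        refine sum_congr rfl fun χ' _ => ?_
        rw [map_mul, Complex.conj_conj, conj_char, ← MulChar.inv_apply', MulChar.mul_apply]
        ring
      rw [sum_congr rfl fun x _ => this x, sum_comm]
      refine sum_congr rfl fun χ _ => ?_
      rw [sum_comm]
      exact sum_congr rfl fun χ' _ => (mul_sum _ _ _).symm
    have e0 : 0 ≤ ∑ x : ZMod p, fej T x * ‖F x‖ ^ 2 :=
      sum_nonneg fun x _ => mul_nonneg (fej_nonneg T x) (by positivity)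
    rw [← Complex.norm_of_nonneg e0, e1]
    calc _ ≤ ∑ χ ∈ V, ∑ χ' ∈ V, (‖A χ‖ ^ 2 / 2 * G χ χ' + ‖A χ'‖ ^ 2 / 2 * G χ χ') := by
          refine (norm_sum_le _ _).trans (sum_le_sum fun χ _ => (norm_sum_le _ _).trans
            (sum_le_sum fun χ' _ => ?_))
          rw [norm_mul, norm_mul, Complex.norm_conj]
          have hG0 : 0 ≤ G χ χ' := norm_nonneg _
          have : ‖A χ‖ * ‖A χ'‖ ≤ ‖A χ‖ ^ 2 / 2 + ‖A χ'‖ ^ 2 / 2 := by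
            nlinarith [sq_nonneg (‖A χ‖ - ‖A χ'‖)]
          have := mul_le_mul_of_nonneg_right this hG0
          rwa [add_mul] at this
      _ = (∑ χ ∈ V, ‖A χ‖ ^ 2 / 2 * ∑ χ' ∈ V, G χ' χ) + ∑ χ' ∈ V, ‖A χ'‖ ^ 2 / 2 * ∑ χ ∈ V, G χ χ' := by
          simp_rw [sum_add_distrib]
          congr 1
          · refine sum_congr rfl fun χ _ => ?_
            rw [mul_sum]
            exact sum_congr rfl fun χ' _ => by rw [hGsymm]
          · rw [sum_comm]
            exact sum_congr rfl fun χ' _ => (mul_sum _ _ _).symm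
      _ ≤ (∑ χ ∈ V, ‖A χ‖ ^ 2 / 2 * M) + ∑ χ' ∈ V, ‖A χ'‖ ^ 2 / 2 * M := by
          refine add_le_add (sum_le_sum fun χ _ => ?_) (sum_le_sum fun χ _ => ?_)
          · exact mul_le_mul_of_nonneg_left (hGM χ) (by positivity)
          · exact mul_le_mul_of_nonneg_left (hGM χ) (by positivity)
      _ = Y * M := by rw [← sum_mul, ← sum_div, ← hY]; ring
  rcases hY0.eq_or_lt with h0 | h0
  · rw [← h0]; positivity
  · have h5 : Y ^ 2 ≤ N * (4 * (Y * M)) :=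
      h2.trans (mul_le_mul_of_nonneg_left (h3.trans (mul_le_mul_of_nonneg_left h4 (by norm_num)))
        (Nat.cast_nonneg _))
    have h6 : Y * Y ≤ Y * (4 * N * M) := by nlinarith
    exact le_of_mul_le_mul_left h6 h0
end large_values

section large_values_bound

theorem sum_norm_char_pow_ten_le {p : ℕ} [Fact p.Prime] {T : ℕ} {D : ℝ} (hTp : T ^ 5 ≤ p) (hD0 : 0 ≤ D)
    (hD : ∀ n, n ≠ 0 → n ≤ T ^ 5 → (#n.divisors : ℝ) ≤ D) (V : Finset (DirichletCharacter ℂ p))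
    (χ : DirichletCharacter ℂ p) :
    (∑ χ' ∈ V, ‖∑ t ∈ Icc 1 T, ((T - t : ℕ) : ℂ) * (χ * χ'⁻¹) (t : ZMod p)‖) ^ 10 ≤
      (#V : ℝ) ^ 9 * (2 * p * T ^ 15 * D ^ 5) := by
  classical
  have hp0 : (0:ℝ) < p := by exact_mod_cast (Fact.out : p.Prime).pos
  set E : DirichletCharacter ℂ p → ℝ := fun ψ =>
    ‖∑ t ∈ Icc 1 T, ((T - t : ℕ) : ℂ) * ψ (t : ZMod p)‖ with hE
  have h1 : (∑ χ' ∈ V, E (χ * χ'⁻¹)) ^ 10 ≤ (#V : ℝ) ^ 9 * ∑ χ' ∈ V, E (χ * χ'⁻¹) ^ 10 := by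
    rcases V.eq_empty_or_nonempty with rfl | hV
    · simp
    · have := pow_sum_div_card_le_sum_pow (s := V) (f := fun χ' => E (χ * χ'⁻¹)) (n := 9)
        (fun _ _ => norm_nonneg _)
      have hc : (0:ℝ) < (#V : ℝ) ^ 9 := pow_pos (by exact_mod_cast hV.card_pos) _
      rwa [div_le_iff₀' hc] at this
  refine h1.trans (mul_le_mul_of_nonneg_left ?_ (by positivity))
  have h2 : ∑ χ' ∈ V, E (χ * χ'⁻¹) ^ 10 ≤ ∑ ψ, E ψ ^ 10 := by
    calc _ ≤ ∑ χ', E (χ * χ'⁻¹) ^ 10 :=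
          sum_le_sum_of_subset_of_nonneg (subset_univ _) fun _ _ _ => by positivity
      _ = _ := Fintype.sum_equiv ((Equiv.inv _).trans (Equiv.mulLeft χ)) _ _ fun _ => rfl
  refine h2.trans ?_
  have h3 := sum_char_pow_le (p := p) (X := T) (j := 5) (A := T) (Nat.cast_nonneg _) hD0 hD
    (fun t => ((T - t : ℕ) : ℂ)) (by
      intro t _
      rw [Complex.norm_natCast]
      exact_mod_cast Nat.sub_le _ _)
  refine h3.trans ?_
  have h4 : (T:ℝ) ^ 5 / p ≤ 1 := by
    rw [div_le_one hp0]; exact_mod_cast hTp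
  calc _ ≤ (p:ℝ) * T ^ (2 * 5) * (T ^ 5 * ((1 + 1) * D ^ 5)) := by gcongr
    _ = _ := by ring

theorem exists_sum_large_normSq_le : ∃ P : ℕ, ∀ p [Fact p.Prime], P ≤ p → ∀ N : ℕ, N < p →
    (p:ℝ) ^ ((63:ℝ)/76) < N → ∀ S ⊆ Icc 1 N, ∀ V : Finset (DirichletCharacter ℂ p),
    (∀ χ ∈ V, (N:ℝ) ^ 2 * (p:ℝ) ^ (-(1001/1000) : ℝ) ≤ ‖∑ q ∈ S, χ (q : ZMod p)‖) →
    ∑ χ ∈ V, ‖∑ q ∈ S, χ (q : ZMod p)‖ ^ 2 ≤ 256 * (N:ℝ) ^ 2 := by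
  obtain ⟨P1, hP1⟩ := exists_card_divisors_le_rpow (ε := 1/1000) (by norm_num)
  obtain ⟨P2, hP2⟩ := exists_log_pow_le_rpow (16 ^ 10 * 32 ^ 5 * 2) 0 (ε := 1/1000) (by norm_num)
  refine ⟨max P1 P2, fun p _ hPp N hNp hN S hS V hV => ?_⟩
  have hp : p.Prime := Fact.out
  have hp0 : (0:ℝ) < p := by exact_mod_cast hp.pos
  have hp1 : (1:ℝ) ≤ p := by exact_mod_cast hp.one_le
  have hN0r : (0:ℝ) < N := (Real.rpow_pos_of_pos hp0 _).trans hN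
  have hN0 : 0 < N := by exact_mod_cast hN0r
  set T := max 1 (p / (16 * N)) with hT
  have hT1 : 1 ≤ T := le_max_left _ _
  have hT0 : (0:ℝ) < T := by exact_mod_cast hT1
  have hTN : T = 1 ∨ 16 * T * N ≤ p := by
    rcases max_choice 1 (p / (16 * N)) with h | h
    · left; rw [hT, h]
    · right; rw [hT, h]
      have := Nat.div_mul_le_self p (16 * N)
      nlinarith
  have hTp : T ≤ p := max_le hp.one_le (Nat.div_le_self _ _)
  have hpT : (p:ℝ) ≤ 32 * N * T := by
    have h1 : p < 16 * N * (p / (16 * N) + 1) := Nat.lt_mul_div_succ p (by omega)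
    have h2 : p / (16 * N) ≤ T := le_max_right _ _
    have h3 : p ≤ 32 * N * T := by nlinarith [Nat.mul_le_mul_left (16 * N) h2, Nat.mul_le_mul_left (16 * N) hT1]
    exact_mod_cast h3
  have hT5 : T ^ 5 ≤ p := by
    rcases hTN with h | h
    · rw [h]; simpa using hp.one_le
    · have h1 : (T:ℝ) ≤ (p:ℝ) ^ ((1:ℝ)/5) := by
        have h2 : (16:ℝ) * T * N ≤ p := by exact_mod_cast h
        have h3 : (T:ℝ) * (p:ℝ) ^ ((63:ℝ)/76) ≤ (p:ℝ) ^ ((1:ℝ)/5) * (p:ℝ) ^ ((63:ℝ)/76) := by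
          calc _ ≤ (T:ℝ) * N := mul_le_mul_of_nonneg_left hN.le hT0.le
            _ ≤ p := by nlinarith [mul_pos hT0 hN0r]
            _ = (p:ℝ) ^ (1:ℝ) := (Real.rpow_one _).symm
            _ ≤ (p:ℝ) ^ ((1:ℝ)/5 + (63:ℝ)/76) := Real.rpow_le_rpow_of_exponent_le hp1 (by norm_num)
            _ = _ := Real.rpow_add hp0 _ _
        exact le_of_mul_le_mul_right h3 (Real.rpow_pos_of_pos hp0 _)
      have h4 : (T:ℝ) ^ 5 ≤ p := by
        refine (pow_le_pow_left₀ hT0.le h1 5).trans ?_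
        rw [← Real.rpow_natCast, ← Real.rpow_mul hp0.le]
        norm_num
      exact_mod_cast h4
  set D := (p:ℝ) ^ ((1:ℝ)/1000) with hD
  have hD0 : 0 ≤ D := (Real.rpow_pos_of_pos hp0 _).le
  set B := (#V : ℝ) ^ 9 * (2 * p * T ^ 15 * D ^ 5) with hB
  have hB0 : 0 ≤ B := by positivity
  set W := B ^ ((10 : ℕ) : ℝ)⁻¹ with hW
  have hW0 : 0 ≤ W := Real.rpow_nonneg hB0 _
  have hW10 : W ^ 10 = B := Real.rpow_inv_natCast_pow hB0 (by norm_num)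
  have key := sum_mem_normSq_le hNp hT1 hTN hTp hS V (W := W) fun χ => by
    refine le_of_pow_le_pow_left₀ (n := 10) (by norm_num) hW0 ?_
    rw [hW10]
    refine sum_norm_char_pow_ten_le hT5 hD0 (fun n hn hnT => ?_) V χ
    refine hP1 p ((le_max_left _ _).trans hPp) n hn (hnT.trans (hT5.trans ?_))
    nlinarith [hp.one_le]
  set Y := ∑ χ ∈ V, ‖∑ q ∈ S, χ (q : ZMod p)‖ ^ 2 with hY
  by_contra! hcon
  have hY0 : 0 < Y := lt_trans (by positivity) hcon
  have k1 : Y ≤ 16 * N * √p / T ^ 2 * W := by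
    have : 4 * (N:ℝ) * (p / T) ≤ 128 * N ^ 2 := by
      have : (p:ℝ) / T ≤ 32 * N := by rw [div_le_iff₀ hT0]; exact hpT
      nlinarith
    have e : 4 * (N:ℝ) * (p / T + 2 * √p / T ^ 2 * W) = 4 * N * (p / T) + (16 * N * √p / T ^ 2 * W) / 2 := by
      ring
    rw [e] at key
    linarith
  have hs10 : √(p:ℝ) ^ 10 = p ^ 5 := by
    rw [show (10:ℕ) = 2 * 5 from rfl, pow_mul, Real.sq_sqrt hp0.le]
  have k2 : Y ^ 10 * T ^ 5 ≤ 16 ^ 10 * N ^ 10 * p ^ 6 * (2 * D ^ 5) * (#V : ℝ) ^ 9 := by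
    calc Y ^ 10 * T ^ 5 ≤ (16 * N * √p / T ^ 2 * W) ^ 10 * T ^ 5 := by gcongr
      _ = 16 ^ 10 * N ^ 10 * √p ^ 10 / T ^ 20 * W ^ 10 * T ^ 5 := by ring
      _ = _ := by rw [hs10, hW10, hB]; field_simp
  have k3 : Y ^ 10 * p ^ 5 ≤ 32 ^ 5 * N ^ 5 * (16 ^ 10 * N ^ 10 * p ^ 6 * (2 * D ^ 5) * (#V : ℝ) ^ 9) := by
    calc Y ^ 10 * p ^ 5 ≤ Y ^ 10 * (32 * N * T) ^ 5 := by gcongr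
      _ = 32 ^ 5 * N ^ 5 * (Y ^ 10 * T ^ 5) := by ring
      _ ≤ _ := by gcongr
  set v := (N:ℝ) ^ 2 * (p:ℝ) ^ (-(1001/1000) : ℝ) with hv
  have hv0 : 0 < v := by positivity
  have k4 : (#V : ℝ) * v ^ 2 ≤ Y := by
    rw [← nsmul_eq_mul]
    exact card_nsmul_le_sum _ _ _ fun χ hχ => pow_le_pow_left₀ hv0.le (hV χ hχ) 2
  have k5 : Y * v ^ 18 ≤ 16 ^ 10 * 32 ^ 5 * 2 * (N ^ 15 * (p * D ^ 5)) := by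
    have h1 : (#V : ℝ) ^ 9 * v ^ 18 ≤ Y ^ 9 := by
      calc _ = ((#V : ℝ) * v ^ 2) ^ 9 := by ring
        _ ≤ _ := by gcongr
    have h2 : Y * v ^ 18 * (Y ^ 9 * p ^ 5) ≤
        16 ^ 10 * 32 ^ 5 * 2 * (N ^ 15 * (p * D ^ 5)) * (Y ^ 9 * p ^ 5) := by
      calc _ = (Y ^ 10 * p ^ 5) * v ^ 18 := by ring
        _ ≤ 32 ^ 5 * N ^ 5 * (16 ^ 10 * N ^ 10 * p ^ 6 * (2 * D ^ 5) * (#V : ℝ) ^ 9) * v ^ 18 := by gcongr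
        _ = 32 ^ 5 * N ^ 5 * (16 ^ 10 * N ^ 10 * p ^ 6 * (2 * D ^ 5)) * ((#V : ℝ) ^ 9 * v ^ 18) := by ring
        _ ≤ 32 ^ 5 * N ^ 5 * (16 ^ 10 * N ^ 10 * p ^ 6 * (2 * D ^ 5)) * Y ^ 9 := by gcongr
        _ = _ := by ring
    exact le_of_mul_le_mul_right h2 (by positivity)
  have hC := hP2 p ((le_max_right _ _).trans hPp)
  rw [pow_zero, mul_one] at hC
  have k6 : (N:ℝ) ^ 38 * ((p:ℝ) ^ (-(1001/1000) : ℝ)) ^ 18 ≤ D * (N ^ 15 * (p * D ^ 5)) := by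
    calc _ = (N:ℝ) ^ 2 * v ^ 18 := by rw [hv]; ring
      _ ≤ Y * v ^ 18 := by
        refine mul_le_mul_of_nonneg_right ?_ (by positivity)
        nlinarith [sq_nonneg (N:ℝ)]
      _ ≤ _ := k5.trans (mul_le_mul_of_nonneg_right hC (by positivity))
  have k7 : (N:ℝ) ^ 23 ≤ (p:ℝ) ^ ((1:ℝ) + 18 * (1001/1000) + 6 / 1000) := by
    have e1 : ((p:ℝ) ^ (-(1001/1000) : ℝ)) ^ 18 = ((p:ℝ) ^ ((18:ℝ) * (1001/1000)))⁻¹ := by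
      rw [← Real.rpow_natCast, ← Real.rpow_mul hp0.le, ← Real.rpow_neg hp0.le]; norm_num
    have e2 : (p:ℝ) * D ^ 6 = (p:ℝ) ^ ((1:ℝ) + 6 / 1000) := by
      rw [hD, ← Real.rpow_natCast, ← Real.rpow_mul hp0.le, Real.rpow_add hp0, Real.rpow_one]; norm_num
    rw [e1, ← div_eq_mul_inv, div_le_iff₀ (Real.rpow_pos_of_pos hp0 _)] at k6
    have e3 : (p:ℝ) ^ ((1:ℝ) + 18 * (1001/1000) + 6 / 1000) = p * D ^ 6 * (p:ℝ) ^ ((18:ℝ) * (1001/1000)) := by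
      rw [e2, ← Real.rpow_add hp0]; norm_num
    rw [e3]
    have : (N:ℝ) ^ 23 * N ^ 15 ≤ p * D ^ 6 * (p:ℝ) ^ ((18:ℝ) * (1001/1000)) * N ^ 15 := by
      calc _ = (N:ℝ) ^ 38 := by ring
        _ ≤ _ := k6
        _ = _ := by ring
    exact le_of_mul_le_mul_right this (by positivity)
  have k8 : (p:ℝ) ^ ((63:ℝ)/76 * 23) < (N:ℝ) ^ 23 := by
    rw [Real.rpow_mul hp0.le]
    have := pow_lt_pow_left₀ hN (Real.rpow_pos_of_pos hp0 _).le (n := 23) (by norm_num)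
    exact_mod_cast this
  have k9 : (p:ℝ) ^ ((1:ℝ) + 18 * (1001/1000) + 6 / 1000) ≤ (p:ℝ) ^ ((63:ℝ)/76 * 23) :=
    Real.rpow_le_rpow_of_exponent_le hp1 (by norm_num)
  linarith
end large_values_bound

section triple_count
variable {p : ℕ} [Fact p.Prime]

/-- Counting solutions of a ternary multiplicative congruence with characters. -/
theorem sum_triple_eq_sum_char {a : ZMod p} (ha : a ≠ 0) (s t u : Finset ℕ) (f g h : ℕ → ZMod p)
    (w : ℕ → ℂ) :
    ((p : ℂ) - 1) * ∑ x ∈ s, ∑ y ∈ t, ∑ r ∈ u, (if f x * g y * h r = a then w r else 0) =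
      ∑ χ : DirichletCharacter ℂ p, conj (χ a) *
        ((∑ x ∈ s, χ (f x)) * (∑ y ∈ t, χ (g y)) * ∑ r ∈ u, w r * χ (h r)) := by
  have h1 : ∀ χ : DirichletCharacter ℂ p, conj (χ a) *
        ((∑ x ∈ s, χ (f x)) * (∑ y ∈ t, χ (g y)) * ∑ r ∈ u, w r * χ (h r)) =
      ∑ x ∈ s, ∑ y ∈ t, ∑ r ∈ u, w r * (χ (f x * g y * h r) * conj (χ a)) := by
    intro χ
    rw [sum_mul_sum, sum_mul, mul_sum]
    refine sum_congr rfl fun x _ => ?_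
    rw [sum_mul, mul_sum]
    refine sum_congr rfl fun y _ => ?_
    rw [mul_sum, mul_sum]
    refine sum_congr rfl fun r _ => ?_
    rw [map_mul, map_mul]; ring
  rw [Fintype.sum_congr _ _ h1, mul_sum]
  conv_rhs => rw [sum_comm]
  refine sum_congr rfl fun x _ => ?_
  rw [mul_sum]
  conv_rhs => rw [sum_comm]
  refine sum_congr rfl fun y _ => ?_
  rw [mul_sum]
  conv_rhs => rw [sum_comm]
  refine sum_congr rfl fun r _ => ?_
  rw [← mul_sum, sum_char_mul_conj]
  by_cases hc : f x * g y * h r = a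
  · rw [if_pos hc, if_pos ⟨hc, by rw [hc]; exact ha⟩, mul_comm]
  · rw [if_neg hc, if_neg fun h => hc h.1, mul_zero, mul_zero]

theorem sum_char_normSq_shift_le {N : ℕ} (hN : N < p) {S : Finset ℕ} (hS : S ⊆ Icc 1 N) (k : ZMod p)
    (a : ℕ → ℂ) :
    ∑ χ : DirichletCharacter ℂ p, ‖∑ i ∈ S, a i * χ ((i : ZMod p) + k)‖ ^ 2 ≤
      p * ∑ i ∈ S, ‖a i‖ ^ 2 := by
  refine (sum_char_normSq_le S a fun i => (i : ZMod p) + k).trans ?_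
  refine mul_le_mul (by linarith) ?_ (sum_nonneg fun _ _ => sum_nonneg fun _ _ => by
    split_ifs <;> positivity) (Nat.cast_nonneg _)
  refine sum_le_sum fun i hi => ?_
  rw [sum_eq_single i]
  · split_ifs
    · rw [sq]
    · positivity
  · intro j hj hji
    rw [if_neg]
    rintro ⟨h, -⟩
    have hi' := mem_Icc.1 (hS hi); have hj' := mem_Icc.1 (hS hj)
    exact hji (natCast_inj_of_lt (by omega) (by omega) (add_right_cancel h)).symm
  · intro h; exact absurd hi h

theorem sum_char_normSq_subset_le {N : ℕ} (hN : N < p) {S : Finset ℕ} (hS : S ⊆ Icc 1 N) (k : ZMod p) :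
    ∑ χ : DirichletCharacter ℂ p, ‖∑ i ∈ S, χ ((i : ZMod p) + k)‖ ^ 2 ≤ p * N := by
  have := sum_char_normSq_shift_le hN hS k fun _ => 1
  simp only [one_mul, norm_one, one_pow, sum_const, nsmul_eq_mul, mul_one] at this
  refine this.trans (mul_le_mul_of_nonneg_left ?_ (Nat.cast_nonneg _))
  have := card_le_card hS
  rw [Nat.card_Icc, Nat.add_sub_cancel] at this
  exact_mod_cast this

theorem sum_one_char_subset {N : ℕ} (hN : N < p) {S : Finset ℕ} (hS : S ⊆ Icc 1 N) :
    ∑ i ∈ S, (1 : DirichletCharacter ℂ p) (i : ZMod p) = #S := by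
  rw [card_eq_sum_ones, Nat.cast_sum]
  refine sum_congr rfl fun i hi => ?_
  have hi' := mem_Icc.1 (hS hi)
  rw [MulChar.one_apply (natCast_ne_zero_of_lt (by omega) (by omega)).isUnit, Nat.cast_one]

theorem sum_mul_one_char (u : Finset ℕ) (w : ℕ → ℂ) (h : ℕ → ZMod p) :
    ∑ r ∈ u, w r * (1 : DirichletCharacter ℂ p) (h r) = ∑ r ∈ u with h r ≠ 0, w r := by
  rw [sum_filter]
  refine sum_congr rfl fun r _ => ?_
  by_cases hr : h r = 0
  · rw [hr, MulChar.map_zero, mul_zero, if_neg (by simp)]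
  · rw [MulChar.one_apply (isUnit_iff_ne_zero.2 hr), if_pos hr, mul_one]

theorem sum_norm_mul_norm_le {N : ℕ} (hN : N < p) {Q R : Finset ℕ} (hQ : Q ⊆ Icc 1 N)
    (hR : R ⊆ Icc 1 N) (k : ZMod p) :
    ∑ χ : DirichletCharacter ℂ p, ‖∑ q ∈ Q, χ (q : ZMod p)‖ * ‖∑ r ∈ R, χ ((r : ZMod p) + k)‖ ≤
      p * N := by
  have h1 := sum_char_normSq_subset_le hN hQ 0
  have h2 := sum_char_normSq_subset_le hN hR k
  simp only [add_zero] at h1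
  have h3 : ∑ χ : DirichletCharacter ℂ p, ‖∑ q ∈ Q, χ (q : ZMod p)‖ * ‖∑ r ∈ R, χ ((r : ZMod p) + k)‖ ≤
      ∑ χ : DirichletCharacter ℂ p, (‖∑ q ∈ Q, χ (q : ZMod p)‖ ^ 2 / 2 +
        ‖∑ r ∈ R, χ ((r : ZMod p) + k)‖ ^ 2 / 2) := by
    refine sum_le_sum fun χ _ => ?_
    nlinarith [sq_nonneg (‖∑ q ∈ Q, χ (q : ZMod p)‖ - ‖∑ r ∈ R, χ ((r : ZMod p) + k)‖)]
  refine h3.trans ?_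
  rw [sum_add_distrib, ← sum_div, ← sum_div]
  linarith

/-- Solutions with one variable in an interval. -/
theorem abs_count_interval_sub_le {N X : ℕ} (hN : N < p) (hX : X < p) {Q R : Finset ℕ}
    (hQ : Q ⊆ Icc 1 N) (hR : R ⊆ Icc 1 N) (k : ZMod p) {a D : ZMod p} (ha : a ≠ 0) (hD : D ≠ 0) :
    |(∑ m ∈ Icc 1 X, ∑ q ∈ Q, ∑ r ∈ R,
        (if (D * m) * (q : ZMod p) * ((r : ZMod p) + k) = a then (1:ℝ) else 0)) -
      X * (#Q * #{r ∈ R | ((r:ℕ) : ZMod p) + k ≠ 0} / ((p:ℝ) - 1))| ≤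
      4 * (1 + Real.log p) * √p * N := by
  classical
  have hp : p.Prime := Fact.out
  have hp2 : (2:ℝ) ≤ p := by exact_mod_cast hp.two_le
  have hp1 : (0:ℝ) < (p:ℝ) - 1 := by linarith
  have key := sum_triple_eq_sum_char ha (Icc 1 X) Q R (fun m => D * m) (fun q => (q : ZMod p))
    (fun r => (r : ZMod p) + k) (fun _ => 1)
  rw [← add_sum_erase univ _ (mem_univ (1 : DirichletCharacter ℂ p))] at key
  have h1 : ∑ x ∈ Icc 1 X, (1 : DirichletCharacter ℂ p) (D * (x : ZMod p)) = X := by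
    simp_rw [map_mul]
    rw [← mul_sum, sum_one_char_subset hX subset_rfl, MulChar.one_apply hD.isUnit]
    simp
  rw [h1, sum_one_char_subset hN hQ, sum_mul_one_char, MulChar.one_apply ha.isUnit] at key
  set c := ∑ m ∈ Icc 1 X, ∑ q ∈ Q, ∑ r ∈ R,
        (if (D * m) * (q : ZMod p) * ((r : ZMod p) + k) = a then (1:ℝ) else 0) with hc
  set Z : ℝ := X * (#Q * #{r ∈ R | ((r:ℕ) : ZMod p) + k ≠ 0}) with hZ
  set Er := ∑ χ ∈ univ.erase (1 : DirichletCharacter ℂ p), conj (χ a) *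
        ((∑ x ∈ Icc 1 X, χ (D * (x : ZMod p))) * (∑ y ∈ Q, χ (y : ZMod p)) *
          ∑ r ∈ R, 1 * χ ((r : ZMod p) + k)) with hEr
  have e1 : (((p:ℝ) - 1) * c - Z : ℝ) = Er := by
    have : (((((p:ℝ) - 1) * c : ℝ)) : ℂ) = Z + Er := by
      simp only [hc, hZ]
      push_cast
      simp only [apply_ite Complex.ofReal, Complex.ofReal_one, Complex.ofReal_zero]
      rw [key]
      simp only [map_one, one_mul, sum_const, nsmul_eq_mul, mul_one]
      ring
    push_cast at this ⊢
    rw [this]; ring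
  have hErb : ‖Er‖ ≤ (2 * (1 + Real.log p) * √p) * (p * N) := by
    have hl : 0 ≤ Real.log p := Real.log_nonneg (by linarith)
    calc ‖Er‖ ≤ ∑ χ ∈ univ.erase (1 : DirichletCharacter ℂ p), (2 * (1 + Real.log p) * √p) *
          (‖∑ q ∈ Q, χ (q : ZMod p)‖ * ‖∑ r ∈ R, χ ((r : ZMod p) + k)‖) := by
          refine (norm_sum_le _ _).trans (sum_le_sum fun χ hχ => ?_)
          have hχ1 : χ ≠ 1 := ne_of_mem_erase hχ
          simp_rw [map_mul, one_mul]
          rw [← mul_sum, norm_mul, norm_mul, norm_mul, norm_mul, Complex.norm_conj,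
            char_norm_eq_one χ ha, char_norm_eq_one χ hD, one_mul, one_mul, mul_assoc]
          exact mul_le_mul_of_nonneg_right (norm_sum_Icc_char_le hχ1 hX) (by positivity)
      _ ≤ ∑ χ : DirichletCharacter ℂ p, (2 * (1 + Real.log p) * √p) *
          (‖∑ q ∈ Q, χ (q : ZMod p)‖ * ‖∑ r ∈ R, χ ((r : ZMod p) + k)‖) :=
          sum_le_sum_of_subset_of_nonneg (subset_univ _) fun _ _ _ => by positivity
      _ ≤ _ := by
        rw [← mul_sum]
        exact mul_le_mul_of_nonneg_left (sum_norm_mul_norm_le hN hQ hR k) (by positivity)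
  have e2 : c - X * (#Q * #{r ∈ R | ((r:ℕ) : ZMod p) + k ≠ 0} / ((p:ℝ) - 1)) =
      (((p:ℝ) - 1) * c - Z) / ((p:ℝ) - 1) := by
    rw [hZ]; field_simp
  rw [e2, abs_div, abs_of_pos hp1, div_le_iff₀ hp1]
  have e3 : |((p:ℝ) - 1) * c - Z| = ‖Er‖ := by
    rw [← e1, Complex.norm_real, Real.norm_eq_abs]
  rw [e3]
  refine hErb.trans ?_
  have hl : 0 ≤ (1 + Real.log p) * √p * N :=
    mul_nonneg (mul_nonneg (by linarith [Real.log_nonneg (show (1:ℝ) ≤ p by linarith)])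
      (Real.sqrt_nonneg _)) (Nat.cast_nonneg _)
  nlinarith
end triple_count

section selberg
open ArithmeticFunction

/-- `∑ 1/e` over squarefree `e ≤ U`. -/
noncomputable def selV (U : ℕ) : ℝ := ∑ e ∈ Icc 1 U with Squarefree e, (e:ℝ)⁻¹

/-- Unnormalised Selberg weights of level `U`. -/
noncomputable def selL (U d : ℕ) : ℝ :=
  (moebius d : ℝ) * d * ∑ e ∈ (Icc 1 U).filter Squarefree with d ∣ e, (e:ℝ)⁻¹

theorem selL_one (U : ℕ) : selL U 1 = selV U := by
  simp [selL, selV]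

theorem abs_selL_le (U d : ℕ) : |selL U d| ≤ U := by
  rw [selL, abs_mul, abs_mul, Nat.abs_cast]
  have h0 : |(moebius d : ℝ)| ≤ 1 := by exact_mod_cast abs_moebius_le_one (n := d)
  have h1 : 0 ≤ ∑ e ∈ (Icc 1 U).filter Squarefree with d ∣ e, (e:ℝ)⁻¹ := sum_nonneg fun _ _ => by positivity
  rw [abs_of_nonneg h1, mul_assoc]
  have h2 : (d:ℝ) * ∑ e ∈ (Icc 1 U).filter Squarefree with d ∣ e, (e:ℝ)⁻¹ ≤ U := by
    rw [mul_sum]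
    calc _ ≤ ∑ e ∈ (Icc 1 U).filter Squarefree with d ∣ e, (1:ℝ) := by
          refine sum_le_sum fun e he => ?_
          rw [mem_filter, mem_filter, mem_Icc] at he
          have he0 : (0:ℝ) < e := by exact_mod_cast he.1.1.1
          rw [← div_eq_mul_inv, div_le_one he0]
          exact_mod_cast Nat.le_of_dvd he.1.1.1 he.2
      _ ≤ ∑ e ∈ Icc 1 U, (1:ℝ) := sum_le_sum_of_subset_of_nonneg
          ((filter_subset _ _).trans (filter_subset _ _)) fun _ _ _ => by norm_num
      _ = U := by simp
  calc _ ≤ 1 * (U:ℝ) := mul_le_mul h0 h2 (by positivity) (by norm_num)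
    _ = U := one_mul _

theorem log_le_selV (U : ℕ) : Real.log (U + 1) ≤ 2 * selV U := by
  have h1 : Real.log (U + 1) ≤ ∑ n ∈ Icc 1 U, (n:ℝ)⁻¹ := by
    have := log_add_one_le_harmonic U
    rw [harmonic_eq_sum_Icc] at this
    push_cast at this ⊢
    exact this
  refine h1.trans ?_
  have hex : ∀ n : ℕ, ∃ x : ℕ × ℕ, x.1 ^ 2 * x.2 = n ∧ Squarefree x.2 := by
    intro n
    obtain ⟨a, b, h, hs⟩ := Nat.sq_mul_squarefree n
    exact ⟨(b, a), h, hs⟩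
  choose φ hφ hsq using hex
  have hinj : Set.InjOn φ (Icc 1 U : Finset ℕ) := fun a _ b _ h => by rw [← hφ a, ← hφ b, h]
  have h2 : ∑ n ∈ Icc 1 U, (n:ℝ)⁻¹ = ∑ x ∈ (Icc 1 U).image φ, ((x.1:ℝ) ^ 2)⁻¹ * (x.2:ℝ)⁻¹ := by
    rw [sum_image hinj]
    refine sum_congr rfl fun n _ => ?_
    rw [← mul_inv]
    congr 1
    exact_mod_cast (hφ n).symm
  have h3 : (Icc 1 U).image φ ⊆ Icc 1 U ×ˢ (Icc 1 U).filter Squarefree := by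
    intro x hx
    obtain ⟨n, hn, rfl⟩ := mem_image.1 hx
    rw [mem_Icc] at hn
    have hn0 := hφ n
    have hb : (φ n).1 ≠ 0 := by rintro h; rw [h] at hn0; simp at hn0; omega
    have ha : (φ n).2 ≠ 0 := by rintro h; rw [h] at hn0; simp at hn0; omega
    have h1 : (φ n).1 ≤ n := by
      have := Nat.mul_le_mul (Nat.le_self_pow two_ne_zero (φ n).1) (Nat.one_le_iff_ne_zero.2 ha)
      omega
    have h2 : (φ n).2 ≤ n := by
      have := Nat.mul_le_mul_right (φ n).2 (Nat.one_le_pow 2 _ (Nat.pos_of_ne_zero hb))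
      omega
    rw [mem_product, mem_filter, mem_Icc, mem_Icc]
    exact ⟨⟨Nat.pos_of_ne_zero hb, h1.trans hn.2⟩, ⟨Nat.pos_of_ne_zero ha, h2.trans hn.2⟩, hsq n⟩
  rw [h2]
  refine (sum_le_sum_of_subset_of_nonneg h3 fun _ _ _ => by positivity).trans ?_
  rw [sum_product]
  dsimp only
  rw [← sum_mul_sum]
  refine mul_le_mul_of_nonneg_right ?_ (sum_nonneg fun _ _ => by positivity)
  have := sum_Ioo_inv_sq_le (α := ℝ) 0 (U + 1)
  have e : Ioo 0 (U + 1) = Icc 1 U := by ext x; simp only [mem_Ioo, mem_Icc]; omega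
  rw [e] at this
  simpa using this

theorem sum_moebius_between {f e : ℕ} (he : Squarefree e) (hfe : f ∣ e) :
    ∑ d ∈ e.divisors with f ∣ d, moebius d = if f = e then moebius f else 0 := by
  obtain ⟨g, rfl⟩ := hfe
  have hf0 : f ≠ 0 := by rintro rfl; simp at he
  have hg0 : g ≠ 0 := by rintro rfl; simp at he
  have h1 : ∑ d ∈ (f * g).divisors with f ∣ d, moebius d = ∑ d ∈ g.divisors, moebius (f * d) := by
    symm
    refine sum_nbij (fun d => f * d) ?_ ?_ ?_ (fun _ _ => rfl)
    · intro d hd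
      rw [Nat.mem_divisors] at hd
      rw [mem_filter, Nat.mem_divisors]
      exact ⟨⟨Nat.mul_dvd_mul_left f hd.1, mul_ne_zero hf0 hg0⟩, dvd_mul_right _ _⟩
    · intro a _ b _ h
      exact Nat.eq_of_mul_eq_mul_left (Nat.pos_of_ne_zero hf0) h
    · intro d hd
      rw [mem_coe, mem_filter, Nat.mem_divisors] at hd
      obtain ⟨⟨h1, -⟩, d', rfl⟩ := hd
      exact ⟨d', mem_coe.2 (Nat.mem_divisors.2 ⟨Nat.dvd_of_mul_dvd_mul_left (Nat.pos_of_ne_zero hf0) h1, hg0⟩), rfl⟩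
  have hcop : Nat.Coprime f g := Nat.coprime_of_squarefree_mul he
  have h2 : ∑ d ∈ g.divisors, moebius (f * d) = moebius f * ∑ d ∈ g.divisors, moebius d := by
    rw [mul_sum]
    refine sum_congr rfl fun d hd => ?_
    exact isMultiplicative_moebius.map_mul_of_coprime (hcop.coprime_dvd_right (Nat.dvd_of_mem_divisors hd))
  rw [h1, h2, ← coe_mul_zeta_apply, moebius_mul_coe_zeta, one_apply]
  by_cases hg : g = 1
  · simp [hg]
  · rw [if_neg hg, if_neg, mul_zero]
    intro h
    exact hg (Nat.eq_of_mul_eq_mul_left (Nat.pos_of_ne_zero hf0) (by omega))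

theorem sum_selL_div_eq (U f : ℕ) (hf : f ∈ Icc 1 U) :
    ∑ d ∈ Icc 1 U with f ∣ d, selL U d / d = if Squarefree f then (moebius f : ℝ) * (f:ℝ)⁻¹ else 0 := by
  set Q := (Icc 1 U).filter Squarefree with hQ
  have h1 : ∀ d ∈ (Icc 1 U).filter (fun d => f ∣ d), selL U d / d =
      ∑ e ∈ Q, if d ∣ e then (moebius d : ℝ) * (e:ℝ)⁻¹ else 0 := by
    intro d hd
    have hd0 : (d:ℝ) ≠ 0 := by
      have := (mem_Icc.1 (mem_filter.1 hd).1).1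
      exact_mod_cast (by omega : d ≠ 0)
    rw [selL, ← sum_filter, ← mul_sum, mul_right_comm, mul_div_cancel_right₀ _ hd0]
  rw [sum_congr rfl h1, sum_comm]
  have h2 : ∀ e ∈ Q, (∑ d ∈ Icc 1 U with f ∣ d, if d ∣ e then (moebius d : ℝ) * (e:ℝ)⁻¹ else 0) =
      if f = e then (moebius f : ℝ) * (e:ℝ)⁻¹ else 0 := by
    intro e he
    rw [hQ, mem_filter, mem_Icc] at he
    rw [← sum_filter, ← sum_mul, filter_filter]
    by_cases hfe : f ∣ e
    · have := sum_moebius_between he.2 hfe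
      have hset : (Icc 1 U).filter (fun d => f ∣ d ∧ d ∣ e) = e.divisors.filter (fun d => f ∣ d) := by
        ext d
        rw [mem_filter, mem_filter, mem_Icc, Nat.mem_divisors]
        constructor
        · rintro ⟨-, h1, h2⟩; exact ⟨⟨h2, by omega⟩, h1⟩
        · rintro ⟨⟨h1, -⟩, h2⟩
          exact ⟨⟨Nat.pos_of_dvd_of_pos h1 (by omega), (Nat.le_of_dvd (by omega) h1).trans he.1.2⟩, h2, h1⟩
      rw [hset, ← Int.cast_sum, this]
      split_ifs <;> simp
    · rw [if_neg (fun h : f = e => hfe (h ▸ dvd_rfl)), filter_false_of_mem, sum_empty, zero_mul]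
      rintro d - ⟨h1, h2⟩
      exact hfe (h1.trans h2)
  rw [sum_congr rfl h2, sum_ite_eq]
  simp only [hQ, mem_filter, hf, true_and]

theorem sum_selL_lcm_le (U : ℕ) :
    ∑ d ∈ Icc 1 U, ∑ d' ∈ Icc 1 U, selL U d * selL U d' / (d.lcm d' : ℕ) ≤ selV U := by
  have h1 : ∀ d ∈ Icc 1 U, ∀ d' ∈ Icc 1 U, selL U d * selL U d' / (d.lcm d' : ℕ) =
      ∑ f ∈ Icc 1 U, (f.totient : ℝ) * ((if f ∣ d then selL U d / d else 0) *
        (if f ∣ d' then selL U d' / d' else 0)) := by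
    intro d hd d' hd'
    rw [mem_Icc] at hd hd'
    have hd0 : (0:ℝ) < d := by exact_mod_cast hd.1
    have hd0' : (0:ℝ) < d' := by exact_mod_cast hd'.1
    have hl0 : (0:ℝ) < (d.lcm d' : ℕ) := by exact_mod_cast Nat.lcm_pos hd.1 hd'.1
    have hg : ((d.gcd d' : ℕ) : ℝ) * (d.lcm d' : ℕ) = d * d' := by exact_mod_cast Nat.gcd_mul_lcm d d'
    have h2 : ∑ f ∈ Icc 1 U, (f.totient : ℝ) * ((if f ∣ d then selL U d / d else 0) *
        (if f ∣ d' then selL U d' / d' else 0)) =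
        (selL U d / d) * (selL U d' / d') * ∑ f ∈ (d.gcd d').divisors, (f.totient : ℝ) := by
      rw [mul_sum]
      have hset : (d.gcd d').divisors = (Icc 1 U).filter (fun f => f ∣ d ∧ f ∣ d') := by
        ext f
        rw [mem_filter, Nat.mem_divisors, mem_Icc, Nat.dvd_gcd_iff]
        constructor
        · rintro ⟨h, -⟩
          exact ⟨⟨Nat.pos_of_dvd_of_pos h.1 hd.1, (Nat.le_of_dvd hd.1 h.1).trans hd.2⟩, h⟩
        · rintro ⟨-, h⟩
          exact ⟨h, (Nat.gcd_pos_of_pos_left _ hd.1).ne'⟩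
      rw [hset, sum_filter]
      refine sum_congr rfl fun f _ => ?_
      by_cases h1 : f ∣ d <;> by_cases h2 : f ∣ d' <;> simp [h1, h2]
      ring
    rw [h2, ← Nat.cast_sum, Nat.sum_totient]
    field_simp
    rw [mul_assoc, ← hg]; ring
  rw [sum_congr rfl fun d hd => sum_congr rfl fun d' hd' => h1 d hd d' hd']
  have h2 : ∑ d ∈ Icc 1 U, ∑ d' ∈ Icc 1 U, ∑ f ∈ Icc 1 U, (f.totient : ℝ) *
      ((if f ∣ d then selL U d / d else 0) * (if f ∣ d' then selL U d' / d' else 0)) =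
      ∑ f ∈ Icc 1 U, (f.totient : ℝ) * (∑ d ∈ Icc 1 U with f ∣ d, selL U d / d) ^ 2 := by
    rw [sum_congr rfl fun d _ => sum_comm, sum_comm]
    refine sum_congr rfl fun f _ => ?_
    rw [sq, sum_filter, sum_mul_sum, mul_sum]
    exact sum_congr rfl fun d _ => (mul_sum _ _ _).symm
  rw [h2, selV, sum_filter]
  refine sum_le_sum fun f hf => ?_
  rw [sum_selL_div_eq U f hf]
  have hf0 : (0:ℝ) < f := by exact_mod_cast (mem_Icc.1 hf).1
  split_ifs with h
  · have h0 : (moebius f : ℝ) ^ 2 ≤ 1 := by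
      rw [sq_le_one_iff_abs_le_one]
      exact_mod_cast abs_moebius_le_one (n := f)
    have h3 : (f.totient : ℝ) ≤ f := by exact_mod_cast Nat.totient_le f
    calc (f.totient : ℝ) * ((moebius f : ℝ) * (f:ℝ)⁻¹) ^ 2 = f.totient * ((moebius f : ℝ) ^ 2 * ((f:ℝ)⁻¹) ^ 2) := by ring
      _ ≤ f * (1 * ((f:ℝ)⁻¹) ^ 2) := by gcongr
      _ = (f:ℝ)⁻¹ := by field_simp
  · simp
end selberg

section sieve_count
variable {p : ℕ} [Fact p.Prime]

/-- Indicator count of pairs `(q, r)` with `n q (r + k) = a`. -/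
noncomputable def pairCount (Q R : Finset ℕ) (k a : ZMod p) (n : ℕ) : ℝ :=
  ∑ q ∈ Q, ∑ r ∈ R, if (n : ZMod p) * (q : ZMod p) * ((r : ZMod p) + k) = a then (1:ℝ) else 0

theorem pairCount_nonneg (Q R : Finset ℕ) (k a : ZMod p) (n : ℕ) : 0 ≤ pairCount Q R k a n :=
  sum_nonneg fun _ _ => sum_nonneg fun _ _ => by split_ifs <;> norm_num

theorem pairCount_le {N : ℕ} (hN : N < p) {Q R : Finset ℕ} (hQ : Q ⊆ Icc 1 N) (hR : R ⊆ Icc 1 N)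
    (k a : ZMod p) {n : ℕ} (hn : n ∈ Icc 1 N) : pairCount Q R k a n ≤ N := by
  rw [mem_Icc] at hn
  have hn0 : (n : ZMod p) ≠ 0 := natCast_ne_zero_of_lt (by omega) (by omega)
  have hQc : (#Q : ℝ) ≤ N := by
    have := card_le_card hQ
    rw [Nat.card_Icc, Nat.add_sub_cancel] at this
    exact_mod_cast this
  refine le_trans ?_ hQc
  rw [card_eq_sum_ones, Nat.cast_sum]
  refine sum_le_sum fun q hq => ?_
  have hq' := mem_Icc.1 (hQ hq)
  have hq0 : (q : ZMod p) ≠ 0 := natCast_ne_zero_of_lt (by omega) (by omega)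
  rw [← sum_filter, sum_const, nsmul_eq_mul, mul_one, Nat.cast_one]
  have : #{r ∈ R | (n : ZMod p) * (q : ZMod p) * (((r:ℕ) : ZMod p) + k) = a} ≤ 1 := by
    rw [card_le_one]
    intro r hr r' hr'
    rw [mem_filter] at hr hr'
    have h1 := mem_Icc.1 (hR hr.1); have h2 := mem_Icc.1 (hR hr'.1)
    have := mul_left_cancel₀ (mul_ne_zero hn0 hq0) (hr.2.trans hr'.2.symm)
    exact natCast_inj_of_lt (by omega) (by omega) (add_right_cancel this)
  exact_mod_cast this

theorem sq_selV_mul_sum_le {N U : ℕ} (hN : N < p) (hU : 1 ≤ U) (hUp : U ^ 2 < p) {Q R : Finset ℕ}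
    (hQ : Q ⊆ Icc 1 N) (hR : R ⊆ Icc 1 N) (k : ZMod p) {a : ZMod p} (ha : a ≠ 0) {Z : ℝ}
    (hZ : Z = #Q * #{r ∈ R | ((r:ℕ) : ZMod p) + k ≠ 0} / ((p:ℝ) - 1)) :
    selV U ^ 2 * ∑ n ∈ Icc 1 N with n.Prime ∧ U < n, pairCount Q R k a n ≤
      N * Z * selV U + U ^ 4 * (Z + 4 * (1 + Real.log p) * √p * N) := by
  have hp : p.Prime := Fact.out
  have hp1 : (1:ℝ) < p := by exact_mod_cast hp.one_lt
  set E := 4 * (1 + Real.log p) * √p * N with hE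
  have hE0 : 0 ≤ E := by
    have := Real.log_nonneg hp1.le
    positivity
  have hZ0 : 0 ≤ Z := by
    rw [hZ]; exact div_nonneg (by positivity) (by linarith)
  set c := pairCount Q R k a with hc
  have hc0 : ∀ n, 0 ≤ c n := pairCount_nonneg Q R k a
  have h1 : selV U ^ 2 * ∑ n ∈ Icc 1 N with n.Prime ∧ U < n, c n ≤
      ∑ n ∈ Icc 1 N, (∑ d ∈ Icc 1 U with d ∣ n, selL U d) ^ 2 * c n := by
    rw [mul_sum]
    calc _ = ∑ n ∈ Icc 1 N with n.Prime ∧ U < n, (∑ d ∈ Icc 1 U with d ∣ n, selL U d) ^ 2 * c n := by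
          refine sum_congr rfl fun n hn => ?_
          rw [mem_filter] at hn
          have : (Icc 1 U).filter (fun d => d ∣ n) = {1} := by
            ext d
            rw [mem_filter, mem_Icc, mem_singleton]
            constructor
            · rintro ⟨⟨-, h2⟩, h⟩
              rcases (Nat.dvd_prime hn.2.1).1 h with h | h
              · exact h
              · omega
            · rintro rfl; exact ⟨⟨le_rfl, hU⟩, one_dvd _⟩
          rw [this, sum_singleton, selL_one]
      _ ≤ _ := sum_le_sum_of_subset_of_nonneg (filter_subset _ _) fun n _ _ =>
          mul_nonneg (sq_nonneg _) (hc0 n)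
  refine h1.trans ?_
  have h2 : ∑ n ∈ Icc 1 N, (∑ d ∈ Icc 1 U with d ∣ n, selL U d) ^ 2 * c n =
      ∑ d ∈ Icc 1 U, ∑ d' ∈ Icc 1 U, selL U d * selL U d' *
        ∑ m ∈ Icc 1 (N / d.lcm d'), c (d.lcm d' * m) := by
    have : ∀ n ∈ Icc 1 N, (∑ d ∈ Icc 1 U with d ∣ n, selL U d) ^ 2 * c n =
        ∑ d ∈ Icc 1 U, ∑ d' ∈ Icc 1 U, (if d.lcm d' ∣ n then selL U d * selL U d' * c n else 0) := by
      intro n _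
      rw [sq, sum_filter, sum_mul_sum, sum_mul]
      refine sum_congr rfl fun d _ => ?_
      rw [sum_mul]
      refine sum_congr rfl fun d' _ => ?_
      by_cases h1 : d ∣ n <;> by_cases h2 : d' ∣ n <;> simp [h1, h2, Nat.lcm_dvd_iff]
    rw [sum_congr rfl this, sum_comm]
    refine sum_congr rfl fun d hd => ?_
    rw [sum_comm]
    refine sum_congr rfl fun d' hd' => ?_
    rw [← sum_filter, sum_Icc_filter_dvd _ N (Nat.lcm_pos (mem_Icc.1 hd).1 (mem_Icc.1 hd').1), mul_sum]
  rw [h2]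
  have h3 : ∀ d ∈ Icc 1 U, ∀ d' ∈ Icc 1 U, selL U d * selL U d' *
      ∑ m ∈ Icc 1 (N / d.lcm d'), c (d.lcm d' * m) ≤
      N * Z * (selL U d * selL U d' / (d.lcm d' : ℕ)) + U ^ 2 * (Z + E) := by
    intro d hd d' hd'
    rw [mem_Icc] at hd hd'
    set D := d.lcm d' with hD
    have hD0 : 0 < D := Nat.lcm_pos hd.1 hd'.1
    have hDp : D < p := by
      have : D ≤ d * d' := Nat.le_of_dvd (Nat.mul_pos hd.1 hd'.1) (Nat.lcm_dvd_mul d d')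
      have := Nat.mul_le_mul hd.2 hd'.2
      nlinarith
    have hDz : (D : ZMod p) ≠ 0 := natCast_ne_zero_of_lt hD0 hDp
    have hD0r : (0:ℝ) < D := by exact_mod_cast hD0
    set s := ∑ m ∈ Icc 1 (N / D), c (D * m) with hs
    have hcnt : |s - ((N / D : ℕ) : ℝ) * Z| ≤ E := by
      have := abs_count_interval_sub_le hN ((Nat.div_le_self N D).trans_lt hN) hQ hR k ha hDz
      rw [← hZ] at this
      convert this using 3
      rw [hs]
      refine sum_congr rfl fun m _ => ?_
      rw [hc, pairCount]
      push_cast; rfl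
    have hfl : |((N / D : ℕ) : ℝ) * Z - N / D * Z| ≤ Z := by
      have h1 : ((N / D : ℕ) : ℝ) ≤ N / D := Nat.cast_div_le
      have h2 : (N:ℝ) / D < (N / D : ℕ) + 1 := by
        rw [div_lt_iff₀ hD0r]
        have := Nat.lt_div_mul_add (a := N) hD0
        have h : N < (N / D + 1) * D := by nlinarith
        exact_mod_cast h
      rw [← sub_mul, abs_mul, abs_of_nonneg hZ0]
      have : |((N / D : ℕ) : ℝ) - N / D| ≤ 1 := abs_le.2 ⟨by linarith, by linarith⟩
      nlinarith
    have hdiff : |s - N / D * Z| ≤ Z + E := by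
      calc _ = |(((N / D : ℕ) : ℝ) * Z - N / D * Z) + (s - ((N / D : ℕ) : ℝ) * Z)| := by congr 1; ring
        _ ≤ _ := (abs_add_le _ _).trans (add_le_add hfl hcnt)
    have hLL : |selL U d * selL U d'| ≤ (U:ℝ) ^ 2 := by
      rw [abs_mul, sq]
      exact mul_le_mul (abs_selL_le U d) (abs_selL_le U d') (abs_nonneg _) (Nat.cast_nonneg _)
    have h4 : selL U d * selL U d' * (s - N / D * Z) ≤ U ^ 2 * (Z + E) := by
      refine (le_abs_self _).trans ?_
      rw [abs_mul]
      exact mul_le_mul hLL hdiff (abs_nonneg _) (by positivity)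
    calc selL U d * selL U d' * s = N * Z * (selL U d * selL U d' / D) +
          selL U d * selL U d' * (s - N / D * Z) := by field_simp; ring
      _ ≤ _ := by linarith
  refine (sum_le_sum fun d hd => sum_le_sum fun d' hd' => h3 d hd d' hd').trans ?_
  simp_rw [sum_add_distrib, ← mul_sum]
  refine add_le_add (mul_le_mul_of_nonneg_left (sum_selL_lcm_le U) (by positivity)) (le_of_eq ?_)
  simp
  ring
end sieve_count

section sieve_bound

theorem exists_sieve_error_le : ∃ P : ℕ, ∀ p : ℕ, P ≤ p → 1 ≤ p → ∀ N : ℕ, (p:ℝ) ^ ((63:ℝ)/76) < N →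
    (p:ℝ) ^ ((1:ℝ)/100) * N + ((p:ℝ) ^ ((1:ℝ)/100)) ^ 4 * (4 * (1 + Real.log p) * √p * N) +
      ((p:ℝ) ^ ((1:ℝ)/100)) ^ 4 * (2 * (N ^ 2 / p)) ≤ (N:ℝ) ^ 3 * (p:ℝ) ^ (-(1001/1000) : ℝ) := by
  obtain ⟨P1, hP1⟩ := exists_log_pow_le_rpow 12 1 (ε := 1/10) (by norm_num)
  refine ⟨P1, fun p hPp hp N hN => ?_⟩
  have hp1 : (1:ℝ) ≤ p := by exact_mod_cast hp
  have hp0 : (0:ℝ) < p := by linarith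
  have hN0 : (0:ℝ) < N := (Real.rpow_pos_of_pos hp0 _).trans hN
  have hlog : 0 ≤ Real.log p := Real.log_nonneg hp1
  have hC := hP1 p hPp
  rw [pow_one] at hC
  set u := (p:ℝ) ^ ((1:ℝ)/100) with hu
  have hu0 : 0 < u := Real.rpow_pos_of_pos hp0 _
  have hu4 : u ^ 4 = (p:ℝ) ^ ((4:ℝ)/100) := by
    rw [hu, ← Real.rpow_natCast, ← Real.rpow_mul hp0.le]; norm_num
  have hN2 : (p:ℝ) ^ ((63:ℝ)/38) ≤ (N:ℝ) ^ 2 := by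
    have := pow_le_pow_left₀ (Real.rpow_pos_of_pos hp0 _).le hN.le 2
    rw [← Real.rpow_natCast ((p:ℝ) ^ _), ← Real.rpow_mul hp0.le] at this
    refine le_of_eq_of_le ?_ this
    norm_num
  have hpm : (p:ℝ) ^ (-(1001/1000) : ℝ) * (p:ℝ) ^ ((1001/1000) : ℝ) = 1 := by
    rw [← Real.rpow_add hp0]; norm_num
  have hm0 : 0 < (p:ℝ) ^ (-(1001/1000) : ℝ) := Real.rpow_pos_of_pos hp0 _
  have hq0 : 0 < (p:ℝ) ^ ((1001/1000) : ℝ) := Real.rpow_pos_of_pos hp0 _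
  have h12 : (12:ℝ) ≤ (p:ℝ) ^ ((1:ℝ)/10) := by nlinarith
  have c1 : 3 * u * (p:ℝ) ^ ((1001/1000) : ℝ) ≤ (N:ℝ) ^ 2 := by
    calc 3 * u * (p:ℝ) ^ ((1001/1000) : ℝ) ≤ (p:ℝ) ^ ((1:ℝ)/10) * u * (p:ℝ) ^ ((1001/1000) : ℝ) := by
          gcongr; linarith
      _ = (p:ℝ) ^ ((1:ℝ)/10 + 1/100 + 1001/1000) := by
        rw [Real.rpow_add hp0, Real.rpow_add hp0]
      _ ≤ (p:ℝ) ^ ((63:ℝ)/38) := Real.rpow_le_rpow_of_exponent_le hp1 (by norm_num)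
      _ ≤ _ := hN2
  have c2 : 12 * (1 + Real.log p) * √p * u ^ 4 * (p:ℝ) ^ ((1001/1000) : ℝ) ≤ (N:ℝ) ^ 2 := by
    calc _ ≤ (p:ℝ) ^ ((1:ℝ)/10) * √p * u ^ 4 * (p:ℝ) ^ ((1001/1000) : ℝ) := by gcongr
      _ = (p:ℝ) ^ ((1:ℝ)/10 + 1/2 + 4/100 + 1001/1000) := by
        rw [Real.rpow_add hp0, Real.rpow_add hp0, Real.rpow_add hp0, hu4, Real.sqrt_eq_rpow]
      _ ≤ (p:ℝ) ^ ((63:ℝ)/38) := Real.rpow_le_rpow_of_exponent_le hp1 (by norm_num)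
      _ ≤ _ := hN2
  have c3 : 6 * u ^ 4 * (p:ℝ) ^ ((1001/1000) : ℝ) ≤ N * p := by
    calc 6 * u ^ 4 * (p:ℝ) ^ ((1001/1000) : ℝ) ≤
          (p:ℝ) ^ ((1:ℝ)/10) * u ^ 4 * (p:ℝ) ^ ((1001/1000) : ℝ) := by gcongr; linarith
      _ = (p:ℝ) ^ ((1:ℝ)/10 + 4/100 + 1001/1000) := by
        rw [Real.rpow_add hp0, Real.rpow_add hp0, hu4]
      _ ≤ (p:ℝ) ^ ((63:ℝ)/76 + 1) := Real.rpow_le_rpow_of_exponent_le hp1 (by norm_num)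
      _ ≤ N * p := by
        rw [Real.rpow_add hp0, Real.rpow_one]; gcongr
  generalize (p:ℝ) ^ (-(1001/1000) : ℝ) = m at *
  generalize (p:ℝ) ^ ((1001/1000) : ℝ) = q at *
  have b1 : 3 * (u * N) ≤ (N:ℝ) ^ 3 * m := by
    calc 3 * (u * N) = 3 * u * q * (N * m) := by linear_combination (-3 * u * N) * hpm
      _ ≤ N ^ 2 * (N * m) := mul_le_mul_of_nonneg_right c1 (by positivity)
      _ = _ := by ring
  have b2 : 3 * (u ^ 4 * (4 * (1 + Real.log p) * √p * N)) ≤ (N:ℝ) ^ 3 * m := by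
    calc 3 * (u ^ 4 * (4 * (1 + Real.log p) * √p * N)) =
          12 * (1 + Real.log p) * √p * u ^ 4 * q * (N * m) := by
            linear_combination (-12 * (1 + Real.log p) * √p * u ^ 4 * N) * hpm
      _ ≤ N ^ 2 * (N * m) := mul_le_mul_of_nonneg_right c2 (by positivity)
      _ = _ := by ring
  have b3 : 3 * (u ^ 4 * (2 * (N ^ 2 / p))) ≤ (N:ℝ) ^ 3 * m := by
    calc 3 * (u ^ 4 * (2 * (N ^ 2 / p))) = 6 * u ^ 4 * q * (N ^ 2 / p * m) := by
          linear_combination (-6 * u ^ 4 * (N ^ 2 / p)) * hpm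
      _ ≤ N * p * (N ^ 2 / p * m) := mul_le_mul_of_nonneg_right c3 (by positivity)
      _ = _ := by field_simp
  linarith

theorem sum_prime_pairCount_le_add {p : ℕ} [Fact p.Prime] {N : ℕ} (hNp : N < p) (U : ℕ)
    {Q R : Finset ℕ} (hQ : Q ⊆ Icc 1 N) (hR : R ⊆ Icc 1 N) (k a : ZMod p) :
    ∑ n ∈ Icc 1 N with n.Prime, pairCount Q R k a n ≤
      ∑ n ∈ Icc 1 N with n.Prime ∧ U < n, pairCount Q R k a n + U * N := by
  have h1 : ∑ n ∈ Icc 1 N with n.Prime, pairCount Q R k a n ≤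
      ∑ n ∈ Icc 1 N with n.Prime ∧ U < n, pairCount Q R k a n + ∑ n ∈ (Icc 1 N).filter (fun n => n ≤ U), pairCount Q R k a n := by
    rw [sum_filter, sum_filter, sum_filter, ← sum_add_distrib]
    refine sum_le_sum fun n _ => ?_
    have := pairCount_nonneg Q R k a n
    by_cases h1 : n.Prime <;> by_cases h2 : U < n
    · simp [h1, h2, not_le.2 h2]
    · simp [h1, h2, not_lt.1 h2]
    · simp [h1, not_le.2 h2]
    · simp [h1, not_lt.1 h2, this]
  refine h1.trans (add_le_add le_rfl ?_)
  calc _ ≤ ∑ n ∈ (Icc 1 N).filter (fun n => n ≤ U), (N:ℝ) :=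
        sum_le_sum fun n hn => pairCount_le hNp hQ hR k a (mem_filter.1 hn).1
    _ ≤ U * N := by
      rw [sum_const, nsmul_eq_mul]
      have : #((Icc 1 N).filter (fun n => n ≤ U)) ≤ U := by
        have h : (Icc 1 N).filter (fun n => n ≤ U) ⊆ Icc 1 U := by
          intro n hn
          simp only [mem_filter, mem_Icc] at hn ⊢
          omega
        simpa using card_le_card h
      gcongr

set_option maxHeartbeats 1000000 in
/-- Upper bound for the number of solutions of `p₁ q (r + k) = a` with `p₁` prime. -/
theorem exists_sum_prime_pairCount_le : ∃ P : ℕ, ∀ p [Fact p.Prime], P ≤ p → ∀ N : ℕ, N < p →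
    (p:ℝ) ^ ((63:ℝ)/76) < N → ∀ Q ⊆ Icc 1 N, ∀ R ⊆ Icc 1 N, ∀ k a : ZMod p, a ≠ 0 →
    ∑ n ∈ Icc 1 N with n.Prime, pairCount Q R k a n ≤
      400 * (N / Real.log p) * (#Q * #R / p) + (N:ℝ) ^ 3 * (p:ℝ) ^ (-(1001/1000) : ℝ) := by
  obtain ⟨P1, hP1⟩ := exists_sieve_error_le
  refine ⟨max P1 2, fun p _ hPp N hNp hN Q hQ R hR k a ha => ?_⟩
  have hp : p.Prime := Fact.out
  have hp0 : (0:ℝ) < p := by exact_mod_cast hp.pos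
  have hp2 : (2:ℝ) ≤ p := by exact_mod_cast hp.two_le
  have hp1 : (1:ℝ) ≤ p := by linarith
  have hN0 : (0:ℝ) < N := (Real.rpow_pos_of_pos hp0 _).trans hN
  have hlog : 0 < Real.log p := Real.log_pos (by linarith)
  have hC := hP1 p ((le_max_left _ _).trans hPp) hp.one_le N hN
  set u := (p:ℝ) ^ ((1:ℝ)/100) with hu
  have hu1 : 1 ≤ u := Real.one_le_rpow hp1 (by norm_num)
  set U := ⌊u⌋₊ with hU
  have hU1 : 1 ≤ U := Nat.one_le_floor_iff _ |>.2 hu1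
  have hUu : (U:ℝ) ≤ u := Nat.floor_le (by linarith)
  have hU1r : (1:ℝ) ≤ U := by exact_mod_cast hU1
  have hUp : U ^ 2 < p := by
    have h1 : (U:ℝ) ^ 2 ≤ u ^ 2 := by gcongr
    have h2 : u ^ 2 < p := by
      rw [hu, ← Real.rpow_natCast, ← Real.rpow_mul hp0.le]
      calc _ < (p:ℝ) ^ (1:ℝ) := Real.rpow_lt_rpow_of_exponent_lt (by linarith) (by norm_num)
        _ = p := Real.rpow_one _
    exact_mod_cast h1.trans_lt h2
  set Z : ℝ := #Q * #{r ∈ R | ((r:ℕ) : ZMod p) + k ≠ 0} / ((p:ℝ) - 1) with hZ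
  have key := sq_selV_mul_sum_le hNp hU1 hUp hQ hR k ha hZ
  set V := selV U with hV
  have hVlog : Real.log p / 200 ≤ V := by
    have h1 := log_le_selV U
    have h2 : Real.log u ≤ Real.log (U + 1) := Real.log_le_log (by linarith) (Nat.lt_floor_add_one u).le
    rw [hu, Real.log_rpow hp0] at h2
    linarith
  have hV1 : 1 ≤ V := by
    rw [hV, selV]
    have : (1:ℕ) ∈ (Icc 1 U).filter Squarefree := by
      rw [mem_filter, mem_Icc]; exact ⟨⟨le_rfl, hU1⟩, squarefree_one⟩
    have := single_le_sum (f := fun e : ℕ => (e:ℝ)⁻¹) (fun _ _ => by positivity) this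
    simpa using this
  have hQR : (#Q : ℝ) ≤ N ∧ (#R : ℝ) ≤ N := by
    constructor
    · have := card_le_card hQ
      rw [Nat.card_Icc, Nat.add_sub_cancel] at this
      exact_mod_cast this
    · have := card_le_card hR
      rw [Nat.card_Icc, Nat.add_sub_cancel] at this
      exact_mod_cast this
  have hZle : Z ≤ 2 * (#Q * #R / p) := by
    rw [hZ, div_le_iff₀ (by linarith)]
    have h1 : (#{r ∈ R | ((r:ℕ) : ZMod p) + k ≠ 0} : ℝ) ≤ #R := by exact_mod_cast card_filter_le _ _
    have h2 : (1:ℝ) ≤ 2 * (((p:ℝ) - 1) / p) := by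
      rw [← mul_div_assoc, le_div_iff₀ hp0]; linarith
    calc (#Q : ℝ) * #{r ∈ R | ((r:ℕ) : ZMod p) + k ≠ 0} ≤ #Q * #R * 1 := by rw [mul_one]; gcongr
      _ ≤ #Q * #R * (2 * (((p:ℝ) - 1) / p)) := by gcongr
      _ = _ := by ring
  have hZ0 : 0 ≤ Z := div_nonneg (by positivity) (by linarith)
  have hZN : Z ≤ 2 * (N ^ 2 / p) := by
    refine hZle.trans ?_
    have : (#Q : ℝ) * #R ≤ N ^ 2 := by
      rw [sq]; exact mul_le_mul hQR.1 hQR.2 (by positivity) hN0.le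
    gcongr
  set E := 4 * (1 + Real.log p) * √p * N with hE
  have hE0 : 0 ≤ E := by positivity
  set S := ∑ n ∈ Icc 1 N with n.Prime ∧ U < n, pairCount Q R k a n with hS
  have hS1 : S ≤ N * Z / V + U ^ 4 * (Z + E) := by
    have h1 : V ^ 2 * S ≤ V ^ 2 * (N * Z / V + U ^ 4 * (Z + E)) := by
      refine key.trans ?_
      have e : V ^ 2 * (N * Z / V + U ^ 4 * (Z + E)) = N * Z * V + V ^ 2 * (U ^ 4 * (Z + E)) := by
        field_simp
      rw [e]
      have : 0 ≤ (U:ℝ) ^ 4 * (Z + E) := by positivity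
      nlinarith [one_le_pow₀ (n := 2) hV1]
    exact le_of_mul_le_mul_left h1 (by positivity)
  have hS2 : ∑ n ∈ Icc 1 N with n.Prime, pairCount Q R k a n ≤ S + U * N :=
    sum_prime_pairCount_le_add hNp U hQ hR k a
  have hU4 : (U:ℝ) ^ 4 ≤ u ^ 4 := pow_le_pow_left₀ (by linarith) hUu 4
  have hmain : N * Z / V ≤ 400 * (N / Real.log p) * (#Q * #R / p) := by
    calc N * Z / V ≤ N * (2 * (#Q * #R / p)) / (Real.log p / 200) :=
          div_le_div₀ (by positivity) (mul_le_mul_of_nonneg_left hZle hN0.le) (by linarith) hVlog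
      _ = _ := by field_simp; ring
  have b1 : (U:ℝ) * N ≤ u * N := mul_le_mul_of_nonneg_right hUu hN0.le
  have b2 : (U:ℝ) ^ 4 * E ≤ u ^ 4 * E := mul_le_mul_of_nonneg_right hU4 hE0
  have b3 : (U:ℝ) ^ 4 * Z ≤ u ^ 4 * (2 * (N ^ 2 / p)) :=
    mul_le_mul hU4 hZN hZ0 (by linarith [pow_nonneg (by linarith : (0:ℝ) ≤ u) 4])
  have e : (U:ℝ) ^ 4 * (Z + E) = U ^ 4 * Z + U ^ 4 * E := by ring
  rw [e] at hS1
  linarith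
end sieve_bound

section sieve_weight_prime

theorem midCoeff_eq_of_card {y w r n : ℕ} (h : #{q ∈ midPrimes y w | q ∣ r} = n) :
    midCoeff y w r = 1 - n := by
  rw [midCoeff, h]

theorem mem_midPrimes {y w q : ℕ} : q ∈ midPrimes y w ↔ (y ≤ q ∧ q < w) ∧ q.Prime := by
  rw [midPrimes, mem_filter, mem_Ico]

theorem exists_two_primes_of_rough {y r : ℕ} (hr1 : r ≠ 1) (hr : r ≠ 0) (hrp : ¬ r.Prime)
    (hrough : ∀ q ∈ r.primeFactors, y ≤ q) (hlt : r < y ^ 3) :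
    ∃ q₁ q₂ : ℕ, q₁.Prime ∧ q₂.Prime ∧ y ≤ q₁ ∧ q₁ ≤ q₂ ∧ r = q₁ * q₂ := by
  have h1 := Nat.minFac_prime hr1
  obtain ⟨m, hm⟩ := Nat.minFac_dvd r
  have hm0 : m ≠ 0 := by rintro rfl; exact hr (by rw [hm, mul_zero])
  have hm1 : m ≠ 1 := by
    rintro rfl
    rw [mul_one] at hm
    exact hrp (hm ▸ h1)
  have hy1 : y ≤ r.minFac := hrough _ (Nat.mem_primeFactors.2 ⟨h1, Nat.minFac_dvd r, hr⟩)
  have hmr : m ∣ r := Dvd.intro_left _ hm.symm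
  have hmp : m.Prime := by
    by_contra hmp
    have h2 := Nat.minFac_prime hm1
    obtain ⟨l, hl⟩ := Nat.minFac_dvd m
    have hl1 : l ≠ 1 := by
      rintro rfl
      rw [mul_one] at hl
      exact hmp (hl ▸ h2)
    have h3 := Nat.minFac_prime hl1
    have hy2 : y ≤ m.minFac :=
      hrough _ (Nat.mem_primeFactors.2 ⟨h2, (Nat.minFac_dvd m).trans hmr, hr⟩)
    have hlm : l ∣ m := Dvd.intro_left _ hl.symm
    have hy3 : y ≤ l.minFac :=
      hrough _ (Nat.mem_primeFactors.2 ⟨h3, (Nat.minFac_dvd l).trans (hlm.trans hmr), hr⟩)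
    have hl0 : 0 < l := Nat.pos_of_ne_zero (by rintro rfl; exact hm0 (by rw [hl, mul_zero]))
    have hy4 : y ≤ l := hy3.trans (Nat.minFac_le hl0)
    have : y ^ 3 ≤ r := by
      rw [hm, hl]
      calc y ^ 3 = y * (y * y) := by ring
        _ ≤ _ := Nat.mul_le_mul hy1 (Nat.mul_le_mul hy2 hy4)
    omega
  exact ⟨r.minFac, m, h1, hmp, hy1, Nat.minFac_le_of_dvd hmp.two_le hmr, hm⟩

theorem sieveWeight_sub_prime {y w r : ℕ} (hr : r ≠ 0) (hlt : r < y ^ 3) (hyw : y ≤ w) :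
    |sieveWeight y w r - (if r.Prime then 1 else 0)| ≤ 1 ∧
      (sieveWeight y w r ≠ (if r.Prime then 1 else 0) → r ≤ w ^ 2 ∨
        ∃ q₁ q₂ : ℕ, q₁.Prime ∧ q₂.Prime ∧ w ≤ q₁ ∧ q₁ ≤ q₂ ∧ r = q₁ * q₂) := by
  have hw2 : w ≤ w ^ 2 := Nat.le_self_pow two_ne_zero w
  have hy0 : 0 < y := Nat.pos_of_ne_zero (by rintro rfl; simp at hlt)
  by_cases hrough : ∀ q ∈ r.primeFactors, y ≤ q
  · have hg : sieveWeight y w r = midCoeff y w r := by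
      rw [sieveWeight, roughInd, if_pos hrough, one_mul]
    rw [hg]
    by_cases hr1 : r = 1
    · subst hr1
      have : midCoeff y w 1 = 1 := by
        rw [midCoeff_eq_of_card (n := 0)]
        · simp
        · rw [card_eq_zero, filter_eq_empty_iff]
          intro q hq h
          exact (mem_midPrimes.1 hq).2.one_lt.ne' (Nat.dvd_one.1 h)
      rw [this, if_neg Nat.not_prime_one]
      exact ⟨by norm_num, fun _ => Or.inl (by omega)⟩
    by_cases hrp : r.Prime
    · have hyr : y ≤ r := hrough r (Nat.mem_primeFactors.2 ⟨hrp, dvd_rfl, hr⟩)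
      rw [if_pos hrp]
      by_cases hrw : r < w
      · have : midCoeff y w r = 0 := by
          rw [midCoeff_eq_of_card (n := 1)]
          · simp
          · rw [card_eq_one]
            refine ⟨r, ?_⟩
            ext q
            rw [mem_filter, mem_midPrimes, mem_singleton]
            constructor
            · rintro ⟨⟨-, hq⟩, h⟩
              exact (Nat.prime_dvd_prime_iff_eq hq hrp).1 h
            · rintro rfl
              exact ⟨⟨⟨hyr, hrw⟩, hrp⟩, dvd_rfl⟩
        rw [this]
        exact ⟨by norm_num, fun _ => Or.inl (by omega)⟩
      · have : midCoeff y w r = 1 := by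
          rw [midCoeff_eq_of_card (n := 0)]
          · simp
          · rw [card_eq_zero, filter_eq_empty_iff]
            intro q hq h
            rw [mem_midPrimes] at hq
            have := (Nat.prime_dvd_prime_iff_eq hq.2 hrp).1 h
            omega
        rw [this]
        exact ⟨by norm_num, fun h => absurd rfl h⟩
    · obtain ⟨q₁, q₂, h1, h2, hyq, hqq, rfl⟩ := exists_two_primes_of_rough hr1 hr hrp hrough hlt
      rw [if_neg hrp]
      have hmem : ∀ q, q ∈ (midPrimes y w).filter (fun q => q ∣ q₁ * q₂) ↔
          (q = q₁ ∨ q = q₂) ∧ q < w := by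
        intro q
        rw [mem_filter, mem_midPrimes]
        constructor
        · rintro ⟨⟨⟨-, hq⟩, hp⟩, h⟩
          rw [hp.dvd_mul, Nat.prime_dvd_prime_iff_eq hp h1, Nat.prime_dvd_prime_iff_eq hp h2] at h
          exact ⟨h, hq⟩
        · rintro ⟨rfl | rfl, h⟩
          · exact ⟨⟨⟨hyq, h⟩, h1⟩, dvd_mul_right _ _⟩
          · exact ⟨⟨⟨hyq.trans hqq, h⟩, h2⟩, dvd_mul_left _ _⟩
      by_cases hq2 : q₂ < w
      · have hle : q₁ * q₂ ≤ w ^ 2 := by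
          rw [sq]; exact Nat.mul_le_mul (by omega) hq2.le
        have hc : 1 ≤ #((midPrimes y w).filter (fun q => q ∣ q₁ * q₂)) ∧
            #((midPrimes y w).filter (fun q => q ∣ q₁ * q₂)) ≤ 2 := by
          have : (midPrimes y w).filter (fun q => q ∣ q₁ * q₂) = {q₁, q₂} := by
            ext q
            rw [hmem, mem_insert, mem_singleton]
            constructor
            · exact fun h => h.1
            · exact fun h => ⟨h, by rcases h with h | h <;> omega⟩
          rw [this]
          exact ⟨card_pos.2 ⟨q₁, mem_insert_self _ _⟩, card_le_two⟩
        refine ⟨?_, fun _ => Or.inl hle⟩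
        rw [midCoeff, sub_zero, abs_le]
        omega
      · by_cases hq1 : q₁ < w
        · have : midCoeff y w (q₁ * q₂) = 0 := by
            rw [midCoeff_eq_of_card (n := 1)]
            · simp
            · rw [card_eq_one]
              refine ⟨q₁, ?_⟩
              ext q
              rw [hmem, mem_singleton]
              constructor
              · rintro ⟨h | h, h'⟩
                · exact h
                · omega
              · rintro rfl; exact ⟨Or.inl rfl, hq1⟩
          rw [this]
          exact ⟨by norm_num, fun h => absurd rfl h⟩
        · have : midCoeff y w (q₁ * q₂) = 1 := by
            rw [midCoeff_eq_of_card (n := 0)]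
            · simp
            · rw [card_eq_zero, eq_empty_iff_forall_notMem]
              intro q hq
              rw [hmem] at hq
              rcases hq with ⟨h | h, h'⟩ <;> omega
          rw [this]
          exact ⟨by norm_num, fun _ => Or.inr ⟨q₁, q₂, h1, h2, by omega, hqq, rfl⟩⟩
  · have hg : sieveWeight y w r = 0 := by
      rw [sieveWeight, roughInd, if_neg hrough, zero_mul]
    rw [hg]
    by_cases hrp : r.Prime
    · rw [if_pos hrp]
      refine ⟨by norm_num, fun _ => Or.inl ?_⟩
      have : r < y := by
        by_contra h
        exact hrough fun q hq => by
          rw [hrp.primeFactors, mem_singleton] at hq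
          omega
      omega
    · rw [if_neg hrp]
      exact ⟨by norm_num, fun h => absurd rfl h⟩

end sieve_weight_prime

section chebyshev

theorem primeCounting_floor_le {x : ℝ} (hx : 1 < x) : (⌊x⌋₊.primeCounting : ℝ) ≤ 5 * x / Real.log x := by
  have h := Chebyshev.pi_le_log4_mul_div hx
  have hx0 : 0 < x := by linarith
  have hlog := Real.log_pos hx
  have h1 : Real.log (√x) = Real.log x / 2 := Real.log_sqrt hx0.le
  have h2 : Real.log x / 2 ≤ √x := by
    rw [← h1]
    have := Real.log_le_sub_one_of_pos (Real.sqrt_pos.2 hx0)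
    linarith
  have h3 : √x ≤ 2 * x / Real.log x := by
    rw [le_div_iff₀ hlog]
    nlinarith [Real.mul_self_sqrt hx0.le, Real.sqrt_nonneg x]
  have h4 : Real.log 4 ≤ 1.4 := by
    rw [show (4:ℝ) = 2 ^ 2 by norm_num, Real.log_pow]
    have := Real.log_two_lt_d9
    push_cast
    linarith
  rw [h1] at h
  refine h.trans ?_
  have h5 : Real.log 4 * x / (Real.log x / 2) ≤ 3 * x / Real.log x := by
    rw [div_le_div_iff₀ (by positivity) hlog]
    have := mul_pos hx0 hlog
    nlinarith
  calc _ ≤ 3 * x / Real.log x + 2 * x / Real.log x := add_le_add h5 h3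
    _ = _ := by ring

theorem half_div_log_le_primeCounting {n : ℕ} (hn : 300 ≤ n) :
    (n:ℝ) / (2 * Real.log n) ≤ n.primeCounting := by
  have hnr : (300:ℝ) ≤ n := by exact_mod_cast hn
  refine le_trans ?_ (Chebyshev.pi_ge n)
  have hlog : 0 < Real.log n := Real.log_pos (by linarith)
  have h1 : Real.log (n + 1) ≤ 2 * √(n + 1) := by
    have := Real.log_le_sub_one_of_pos (Real.sqrt_pos.2 (by linarith : (0:ℝ) < n + 1))
    rw [Real.log_sqrt (by linarith)] at this
    linarith
  have h2 : √((n:ℝ) + 1) ≤ 0.08 * n := by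
    rw [Real.sqrt_le_left (by linarith)]
    nlinarith
  have h3 := Real.log_two_gt_d9
  rw [div_le_div_iff₀ (by positivity) hlog]
  have : (n:ℝ) ≤ (n * Real.log 2 - Real.log (n + 1)) * 2 := by nlinarith
  calc (n:ℝ) * Real.log n ≤ ((n * Real.log 2 - Real.log (n + 1)) * 2) * Real.log n := by gcongr
    _ = _ := by ring

theorem sum_prime_inv_le {w W : ℕ} (hw : 2 ≤ w) (hwW : w ≤ W) :
    ∑ q ∈ Icc w W with q.Prime, (q:ℝ)⁻¹ ≤
      (Real.log ((W:ℝ) / w) / Real.log 2 + 2) * (10 / Real.log w) := by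
  have hlw : 0 < Real.log w := Real.log_pos (by exact_mod_cast hw)
  have hl2 : 0 < Real.log 2 := Real.log_pos (by norm_num)
  have hw0 : (0:ℝ) < w := by positivity
  have hW0 : (0:ℝ) < W := by
    have : 0 < W := by omega
    exact_mod_cast this
  set f : ℕ → ℝ := fun q => if w ≤ q ∧ q.Prime then (q:ℝ)⁻¹ else 0 with hf
  have hf0 : ∀ q, 0 ≤ f q := fun q => by
    rw [hf]; dsimp only; split_ifs <;> positivity
  have h1 : ∑ q ∈ Icc w W with q.Prime, (q:ℝ)⁻¹ = ∑ q ∈ Icc 1 W, f q := by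
    rw [hf, ← sum_filter]
    refine sum_congr ?_ fun _ _ => rfl
    ext q
    simp only [mem_filter, mem_Icc]
    constructor
    · rintro ⟨⟨h1, h2⟩, h3⟩; exact ⟨⟨by omega, h2⟩, h1, h3⟩
    · rintro ⟨⟨h1, h2⟩, h3, h4⟩; exact ⟨⟨h3, h2⟩, h4⟩
  rw [h1]
  refine (sum_Icc_le_sum_dyadic f hf0 W).trans ?_
  have hblock : ∀ j ∈ range (Nat.log 2 W + 1), ∑ m ∈ Ico (2 ^ j) (2 * 2 ^ j), f m ≤
      if Nat.log 2 w ≤ j then 10 / Real.log w else 0 := by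
    intro j _
    split_ifs with hj
    · have hwj : w < 2 * 2 ^ j := by
        rw [← pow_succ']
        exact Nat.lt_pow_of_log_lt (by norm_num) (by omega)
      have h2 : ∑ m ∈ Ico (2 ^ j) (2 * 2 ^ j), f m ≤
          ∑ m ∈ (Icc 1 (2 * 2 ^ j)).filter Nat.Prime, ((2:ℝ) ^ j)⁻¹ := by
        rw [sum_filter]
        have hs : Ico (2 ^ j) (2 * 2 ^ j) ⊆ Icc 1 (2 * 2 ^ j) := by
          intro m hm
          rw [mem_Ico] at hm
          rw [mem_Icc]
          have := Nat.one_le_two_pow (n := j)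
          omega
        refine le_trans (sum_le_sum fun m hm => ?_)
          (sum_le_sum_of_subset_of_nonneg hs fun _ _ _ => by positivity)
        rw [mem_Ico] at hm
        rw [hf]
        dsimp only
        by_cases hp : m.Prime
        · rw [if_pos hp]
          have : ((2:ℝ) ^ j) ≤ m := by exact_mod_cast hm.1
          split_ifs
          · gcongr
          · positivity
        · simp [hp]
      refine h2.trans ?_
      rw [sum_const, nsmul_eq_mul]
      have hc : (#((Icc 1 (2 * 2 ^ j)).filter Nat.Prime) : ℝ) ≤
          5 * ((2 * 2 ^ j : ℕ) : ℝ) / Real.log ((2 * 2 ^ j : ℕ) : ℝ) := by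
        have h3 : (1:ℝ) < ((2 * 2 ^ j : ℕ) : ℝ) := by
          have : 1 < 2 * 2 ^ j := by omega
          exact_mod_cast this
        have h4 := primeCounting_floor_le h3
        rw [Nat.floor_natCast] at h4
        refine le_trans ?_ h4
        have : #((Icc 1 (2 * 2 ^ j)).filter Nat.Prime) ≤ (2 * 2 ^ j).primeCounting := by
          rw [Nat.primeCounting, Nat.primeCounting', Nat.count_eq_card_filter_range]
          refine card_le_card fun m hm => ?_
          simp only [mem_filter, mem_Icc, mem_range] at hm ⊢
          exact ⟨by omega, hm.2⟩
        exact_mod_cast this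
      have h5 : Real.log w ≤ Real.log ((2 * 2 ^ j : ℕ) : ℝ) :=
        Real.log_le_log hw0 (by exact_mod_cast hwj.le)
      calc _ ≤ 5 * ((2 * 2 ^ j : ℕ) : ℝ) / Real.log ((2 * 2 ^ j : ℕ) : ℝ) * ((2:ℝ) ^ j)⁻¹ := by
            gcongr
        _ ≤ 5 * ((2 * 2 ^ j : ℕ) : ℝ) / Real.log w * ((2:ℝ) ^ j)⁻¹ := by gcongr
        _ = _ := by push_cast; field_simp; ring
    · refine le_of_eq (sum_eq_zero fun m hm => ?_)
      rw [mem_Ico] at hm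
      rw [hf]
      dsimp only
      rw [if_neg]
      rintro ⟨h, -⟩
      have : 2 * 2 ^ j ≤ w := by
        rw [← pow_succ']
        exact Nat.pow_le_of_le_log (by omega) (by omega)
      omega
  refine (sum_le_sum hblock).trans ?_
  rw [← sum_filter, sum_const, nsmul_eq_mul]
  refine mul_le_mul_of_nonneg_right ?_ (by positivity)
  have hcard : #((range (Nat.log 2 W + 1)).filter fun j => Nat.log 2 w ≤ j) ≤
      Nat.log 2 W + 1 - Nat.log 2 w := by
    have : (range (Nat.log 2 W + 1)).filter (fun j => Nat.log 2 w ≤ j) ⊆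
        Ico (Nat.log 2 w) (Nat.log 2 W + 1) := by
      intro j hj
      simp only [mem_filter, mem_range, mem_Ico] at hj ⊢
      omega
    simpa using card_le_card this
  have hcr : (#((range (Nat.log 2 W + 1)).filter fun j => Nat.log 2 w ≤ j) : ℝ) + Nat.log 2 w ≤
      Nat.log 2 W + 1 := by
    have := Nat.log_mono_right (b := 2) hwW
    have : #((range (Nat.log 2 W + 1)).filter fun j => Nat.log 2 w ≤ j) + Nat.log 2 w ≤
      Nat.log 2 W + 1 := by omega
    exact_mod_cast this
  have hWl : (Nat.log 2 W : ℝ) ≤ Real.log W / Real.log 2 := by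
    have := Real.natLog_le_logb W 2
    rwa [Real.logb] at this
  have hwl : Real.log w / Real.log 2 ≤ Nat.log 2 w + 1 := by
    rw [div_le_iff₀ hl2]
    have h := Nat.lt_pow_succ_log_self (b := 2) (by norm_num) w
    have h' : (w:ℝ) ≤ 2 ^ (Nat.log 2 w + 1) := by exact_mod_cast h.le
    have := Real.log_le_log hw0 h'
    rw [Real.log_pow] at this
    exact_mod_cast this
  rw [Real.log_div hW0.ne' hw0.ne', sub_div]
  linarith
end chebyshev

section exceptional

/-- The products `q * m ≤ N` of primes with `w ≤ q ≤ √N`. -/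
def twoPrimeProducts (w N : ℕ) : Finset ℕ :=
  ((Icc w N.sqrt).filter Nat.Prime).biUnion fun q =>
    ((Icc 1 (N / q)).filter Nat.Prime).image fun m => q * m

theorem mul_mem_twoPrimeProducts {w N q₁ q₂ : ℕ} (h1 : q₁.Prime) (h2 : q₂.Prime) (hwq : w ≤ q₁)
    (hqq : q₁ ≤ q₂) (hN : q₁ * q₂ ≤ N) : q₁ * q₂ ∈ twoPrimeProducts w N := by
  simp only [twoPrimeProducts, mem_biUnion, mem_image, mem_filter, mem_Icc]
  refine ⟨q₁, ⟨⟨hwq, Nat.le_sqrt.2 ((Nat.mul_le_mul_left _ hqq).trans hN)⟩, h1⟩, q₂,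
    ⟨⟨h2.one_le, ?_⟩, h2⟩, rfl⟩
  rw [Nat.le_div_iff_mul_le h1.pos, mul_comm]
  exact hN

/-- The number of products of two primes `≥ w` up to `N`. -/
theorem card_two_primes_le {w N : ℕ} (hw : 2 ≤ w) (hwN : w ^ 2 ≤ N) :
    (#(twoPrimeProducts w N) : ℝ) ≤
      10 * N / Real.log N *
        ((Real.log ((N.sqrt : ℝ) / w) / Real.log 2 + 2) * (10 / Real.log w)) := by
  have hwS : w ≤ N.sqrt := Nat.le_sqrt'.2 hwN
  have hN4 : 4 ≤ N := by nlinarith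
  have hN0 : (0:ℝ) < N := by exact_mod_cast (by omega : 0 < N)
  have hlN : 0 < Real.log N := Real.log_pos (by exact_mod_cast (by omega : 1 < N))
  have h1 : (#(twoPrimeProducts w N) : ℝ)
      ≤ ∑ q ∈ Icc w N.sqrt with q.Prime, (#((Icc 1 (N / q)).filter Nat.Prime) : ℝ) := by
    have h2 : #(twoPrimeProducts w N) ≤ _ := card_biUnion_le.trans (sum_le_sum fun q _ => card_image_le)
    exact_mod_cast h2
  refine h1.trans ?_
  have h2 : ∀ q ∈ (Icc w N.sqrt).filter Nat.Prime,
      (#((Icc 1 (N / q)).filter Nat.Prime) : ℝ) ≤ 10 * N / Real.log N * (q:ℝ)⁻¹ := by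
    intro q hq
    rw [mem_filter, mem_Icc] at hq
    have hq0 : (0:ℝ) < q := by exact_mod_cast hq.2.pos
    have hqN : (q:ℝ) * q ≤ N := by exact_mod_cast Nat.le_sqrt.1 hq.1.2
    have hq2 : (2:ℝ) ≤ q := by exact_mod_cast hq.2.two_le
    set x : ℝ := N / q with hx
    have hxq : (q:ℝ) ≤ x := by rw [hx, le_div_iff₀ hq0]; exact hqN
    have hx1 : 1 < x := by linarith
    have hxx : (N:ℝ) ≤ x ^ 2 := by
      have : (N:ℝ) = x * q := by rw [hx]; field_simp
      rw [this, sq]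
      gcongr
    have hlx : Real.log N / 2 ≤ Real.log x := by
      have := Real.log_le_log hN0 hxx
      rw [Real.log_pow] at this
      push_cast at this
      linarith
    have hfl : ⌊x⌋₊ = N / q := by rw [hx]; exact Nat.floor_div_eq_div N q
    have h3 := primeCounting_floor_le hx1
    rw [hfl] at h3
    have h4 : #((Icc 1 (N / q)).filter Nat.Prime) ≤ (N / q).primeCounting := by
      rw [Nat.primeCounting, Nat.primeCounting', Nat.count_eq_card_filter_range]
      refine card_le_card fun m hm => ?_
      simp only [mem_filter, mem_Icc, mem_range] at hm ⊢
      exact ⟨by omega, hm.2⟩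
    calc (#((Icc 1 (N / q)).filter Nat.Prime) : ℝ) ≤ (N / q).primeCounting := by exact_mod_cast h4
      _ ≤ 5 * x / Real.log x := h3
      _ ≤ 5 * x / (Real.log N / 2) := by gcongr
      _ = _ := by rw [hx]; field_simp; ring
  refine (sum_le_sum h2).trans ?_
  rw [← mul_sum]
  exact mul_le_mul_of_nonneg_left (sum_prime_inv_le hw hwS) (by positivity)

theorem exists_cube_between {N : ℕ} (hN : 1 ≤ N) :
    ∃ y : ℕ, N < y ^ 3 ∧ y ^ 3 ≤ 8 * N ∧ (y:ℝ) ≤ 2 * (N:ℝ) ^ ((1:ℝ)/3) := by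
  have hNr : (1:ℝ) ≤ N := by exact_mod_cast hN
  set x := (N:ℝ) ^ ((1:ℝ)/3) with hx
  have hx1 : 1 ≤ x := Real.one_le_rpow hNr (by norm_num)
  have hx3 : x ^ 3 = N := by
    rw [hx, ← Real.rpow_natCast, ← Real.rpow_mul (by linarith)]; norm_num
  have h1 : x < (⌊x⌋₊ + 1 : ℕ) := by push_cast; exact Nat.lt_floor_add_one x
  have h2 : ((⌊x⌋₊ + 1 : ℕ) : ℝ) ≤ 2 * x := by
    push_cast
    have := Nat.floor_le (by linarith : 0 ≤ x)
    linarith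
  refine ⟨⌊x⌋₊ + 1, ?_, ?_, h2⟩
  · have := pow_lt_pow_left₀ h1 (by linarith) three_ne_zero
    rw [hx3] at this
    exact_mod_cast this
  · have := pow_le_pow_left₀ (by positivity) h2 3
    rw [mul_pow, hx3] at this
    norm_num at this
    exact_mod_cast this

/-- The integers up to `N` at which the sieve weight differs from the indicator of the primes. -/
def sieveExceptions (y w N : ℕ) : Finset ℕ :=
  (Icc 1 N).filter fun r => sieveWeight y w r ≠ if r.Prime then 1 else 0

theorem card_sieveExceptions_le {y w N : ℕ} (hN : N < y ^ 3) (hyw : y ≤ w) :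
    #(sieveExceptions y w N) ≤ w ^ 2 +
      #(twoPrimeProducts w N) := by
  have : sieveExceptions y w N ⊆ Icc 1 (w ^ 2) ∪
      twoPrimeProducts w N := by
    intro r hr
    rw [sieveExceptions, mem_filter] at hr
    have hrI := mem_Icc.1 hr.1
    rw [mem_union, mem_Icc]
    rcases (sieveWeight_sub_prime (by omega) (hrI.2.trans_lt hN) hyw).2 hr.2 with h | h
    · exact Or.inl ⟨hrI.1, h⟩
    · obtain ⟨q₁, q₂, h1, h2, hwq, hqq, rfl⟩ := h
      exact Or.inr (mul_mem_twoPrimeProducts h1 h2 hwq hqq hrI.2)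
  refine (card_le_card this).trans ((card_union_le _ _).trans ?_)
  rw [Nat.card_Icc, Nat.add_sub_cancel]

theorem two_prime_bound_le {w W : ℕ} {N L δ η lN : ℝ} (hwW : w ≤ W) (hw0 : (0:ℝ) < w) (hN0 : 0 ≤ N)
    (hl0 : 0 < L) (hδ : 0 < δ) (hη0 : 0 ≤ η) (hη2 : η ≤ δ / 20000) (hlp : 19200 / δ ≤ L)
    (hlw : L / 8 ≤ Real.log w) (hlN : L / 2 ≤ lN)
    (hq : Real.log ((W:ℝ) / w) ≤ Real.log 2 + η * L) :
    10 * N / lN * ((Real.log ((W:ℝ) / w) / Real.log 2 + 2) * (10 / Real.log w)) ≤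
      δ / 2 * (N / L) := by
  have hl2 := Real.log_two_gt_d9
  have hq2 : Real.log ((W:ℝ) / w) / Real.log 2 + 2 ≤ 3 + 2 * η * L := by
    have : Real.log ((W:ℝ) / w) / Real.log 2 ≤ 1 + 2 * η * L := by
      rw [div_le_iff₀ (by linarith)]
      have : 0 ≤ η * L := by positivity
      nlinarith
    linarith
  have h3 : 3 + 2 * η * L ≤ δ / 3200 * L := by
    have : 19200 ≤ δ * L := by
      rw [div_le_iff₀ hδ] at hlp; linarith
    nlinarith
  have h4 : 10 * N / lN ≤ 20 * N / L := by
    rw [div_le_div_iff₀ (by linarith) hl0]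
    nlinarith
  have h5 : 10 / Real.log w ≤ 80 / L := by
    rw [div_le_div_iff₀ (by linarith) hl0]
    nlinarith
  calc _ ≤ 20 * N / L * ((δ / 3200 * L) * (80 / L)) := by
        refine mul_le_mul h4 ?_ ?_ (by positivity)
        · exact mul_le_mul (hq2.trans h3) h5 (by
            exact div_nonneg (by norm_num) (by linarith)) (by positivity)
        · refine mul_nonneg ?_ (div_nonneg (by norm_num) (by linarith))
          have : 0 ≤ Real.log ((W:ℝ) / w) := by
            refine Real.log_nonneg ?_
            rw [le_div_iff₀ (by linarith), one_mul]
            exact_mod_cast hwW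
          have : 0 ≤ Real.log ((W:ℝ) / w) / Real.log 2 := div_nonneg this (by linarith)
          linarith
    _ = δ / 2 * (N / L) := by field_simp; ring

theorem exists_card_sieveExceptions_le {δ : ℝ} (hδ : 0 < δ) :
    ∃ η : ℝ, 0 < η ∧ η ≤ 1/1000 ∧ ∃ P : ℕ, ∀ p : ℕ, P ≤ p → ∀ N : ℕ, N < p →
      (p:ℝ) ^ ((63:ℝ)/76) < N → ∃ y w : ℕ, N < y ^ 3 ∧ y ^ 3 ≤ 8 * N ∧ 0 < w ∧
        ((w:ℝ) * (p:ℝ) ^ η) ^ 2 ≤ N ∧ y ≤ w ∧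
        (#(sieveExceptions y w N) : ℝ) ≤ δ * (N / Real.log p) := by
  set η : ℝ := min (1/1000) (δ/20000) with hη
  have hη0 : 0 < η := lt_min (by norm_num) (by positivity)
  have hη1 : η ≤ 1/1000 := min_le_left _ _
  have hη2 : η ≤ δ/20000 := min_le_right _ _
  obtain ⟨P1, hP1⟩ := exists_log_pow_le_rpow (2/δ) 1 (ε := 2 * η) (by positivity)
  obtain ⟨P2, hP2⟩ := exists_log_pow_le_rpow 6 0 (ε := (1:ℝ)/10) (by norm_num)
  refine ⟨η, hη0, hη1, max (max P1 P2) (max 2 ⌈Real.exp (19200/δ)⌉₊), fun p hp N hNp hN => ?_⟩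
  rw [max_le_iff, max_le_iff, max_le_iff] at hp
  obtain ⟨⟨hpP1, hpP2⟩, hp2, hpe⟩ := hp
  have hp2r : (2:ℝ) ≤ p := by exact_mod_cast hp2
  have hp0 : (0:ℝ) < p := by linarith
  have hp1 : (1:ℝ) ≤ p := by linarith
  have hlp : 19200/δ ≤ Real.log p := by
    rw [Real.le_log_iff_exp_le hp0]
    exact (Nat.le_ceil _).trans (by exact_mod_cast hpe)
  have hl0 : 0 < Real.log p := Real.log_pos (by linarith)
  have hlogp : 2 / δ * Real.log p ≤ (p:ℝ) ^ (2 * η) := by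
    have := hP1 p hpP1
    rw [pow_one] at this
    refine le_trans ?_ this
    gcongr; linarith
  have h6 : (6:ℝ) ≤ (p:ℝ) ^ ((1:ℝ)/10) := by
    have := hP2 p hpP2
    rwa [pow_zero, mul_one] at this
  have hN0 : (0:ℝ) < N := (Real.rpow_pos_of_pos hp0 _).trans hN
  have hN1 : 1 ≤ N := by exact_mod_cast hN0
  obtain ⟨y, hy1, hy2, hy3⟩ := exists_cube_between hN1
  set pe := (p:ℝ) ^ η with hpe'
  have hpe0 : 0 < pe := Real.rpow_pos_of_pos hp0 _
  have hpe2 : pe ^ 2 = (p:ℝ) ^ (2 * η) := by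
    rw [hpe', ← Real.rpow_natCast, ← Real.rpow_mul hp0.le]
    congr 1; push_cast; ring
  set v := √N / pe with hv
  have hv0 : 0 < v := by positivity
  have hpe1000 : pe ≤ (p:ℝ) ^ ((1:ℝ)/1000) := Real.rpow_le_rpow_of_exponent_le hp1 hη1
  have hN16 : (p:ℝ) ^ ((63:ℝ)/456) ≤ (N:ℝ) ^ ((1:ℝ)/6) := by
    have := Real.rpow_le_rpow (Real.rpow_pos_of_pos hp0 _).le hN.le (by norm_num : (0:ℝ) ≤ 1/6)
    rw [← Real.rpow_mul hp0.le] at this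
    refine le_of_eq_of_le ?_ this
    norm_num
  have hsq : √(N:ℝ) = (N:ℝ) ^ ((1:ℝ)/3) * (N:ℝ) ^ ((1:ℝ)/6) := by
    rw [Real.sqrt_eq_rpow, ← Real.rpow_add hN0]; norm_num
  have hN13 : (p:ℝ) ^ ((1:ℝ)/8) ≤ (N:ℝ) ^ ((1:ℝ)/3) := by
    have := Real.rpow_le_rpow (Real.rpow_pos_of_pos hp0 _).le hN.le (by norm_num : (0:ℝ) ≤ 1/3)
    rw [← Real.rpow_mul hp0.le] at this
    refine le_trans (Real.rpow_le_rpow_of_exponent_le hp1 (by norm_num)) this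
  have hN13' : 1 ≤ (N:ℝ) ^ ((1:ℝ)/3) := Real.one_le_rpow (by exact_mod_cast hN1) (by norm_num)
  have hbig : 6 * (N:ℝ) ^ ((1:ℝ)/3) ≤ v := by
    rw [hv, le_div_iff₀ hpe0, hsq, mul_comm (6:ℝ), mul_assoc]
    refine mul_le_mul_of_nonneg_left ?_ (by linarith)
    calc 6 * pe ≤ (p:ℝ) ^ ((1:ℝ)/10) * (p:ℝ) ^ ((1:ℝ)/1000) := by gcongr
      _ = (p:ℝ) ^ ((1:ℝ)/10 + 1/1000) := by rw [Real.rpow_add hp0]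
      _ ≤ (p:ℝ) ^ ((63:ℝ)/456) := Real.rpow_le_rpow_of_exponent_le hp1 (by norm_num)
      _ ≤ _ := hN16
  set w := ⌊v⌋₊ with hw
  have hwv : (w:ℝ) ≤ v := Nat.floor_le hv0.le
  have hvw : v < w + 1 := Nat.lt_floor_add_one v
  have hwhalf : v / 2 ≤ w := by linarith
  have hyw : y ≤ w := by
    have : (y:ℝ) ≤ w := by linarith
    exact_mod_cast this
  have hw2r : (2:ℝ) ≤ w := by linarith
  have hw2 : 2 ≤ w := by exact_mod_cast hw2r
  have hwpe : (w:ℝ) * pe ≤ √N := by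
    calc (w:ℝ) * pe ≤ v * pe := by gcongr
      _ = √N := by rw [hv]; field_simp
  have hwN : ((w:ℝ) * pe) ^ 2 ≤ N := by
    calc ((w:ℝ) * pe) ^ 2 ≤ √N ^ 2 := pow_le_pow_left₀ (by positivity) hwpe 2
      _ = N := Real.sq_sqrt hN0.le
  have hpe1 : 1 ≤ pe := Real.one_le_rpow hp1 hη0.le
  have hw2N : w ^ 2 ≤ N := by
    have : (w:ℝ) ^ 2 ≤ N := by
      refine le_trans ?_ hwN
      rw [mul_pow]
      nlinarith [one_le_pow₀ (n := 2) hpe1, sq_nonneg (w:ℝ)]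
    exact_mod_cast this
  refine ⟨y, w, hy1, hy2, by omega, hwN, hyw, ?_⟩
  have hcard := card_sieveExceptions_le hy1 hyw
  have hcr : (#(sieveExceptions y w N) : ℝ) ≤ (w:ℝ) ^ 2 +
      #(twoPrimeProducts w N) := by
    exact_mod_cast hcard
  have hmid := card_two_primes_le hw2 hw2N
  have hA : (w:ℝ) ^ 2 ≤ δ / 2 * (N / Real.log p) := by
    have h1 : (w:ℝ) ^ 2 * (2 / δ * Real.log p) ≤ N := by
      refine le_trans ?_ hwN
      rw [mul_pow, hpe2]
      gcongr
    have : (w:ℝ) ^ 2 = (w:ℝ) ^ 2 * (2 / δ * Real.log p) * (δ / 2 / Real.log p) := by field_simp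
    rw [this]
    calc _ ≤ N * (δ / 2 / Real.log p) := by gcongr
      _ = _ := by ring
  have hlw : Real.log p / 8 ≤ Real.log w := by
    have h1 : (p:ℝ) ^ ((1:ℝ)/8) ≤ w := by linarith
    have := Real.log_le_log (Real.rpow_pos_of_pos hp0 _) h1
    rw [Real.log_rpow hp0] at this
    linarith
  have hlN : Real.log p / 2 ≤ Real.log N := by
    have := Real.log_le_log (Real.rpow_pos_of_pos hp0 _) hN.le
    rw [Real.log_rpow hp0] at this
    linarith
  have hq : Real.log ((N.sqrt : ℝ) / w) ≤ Real.log 2 + η * Real.log p := by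
    rw [← Real.log_rpow hp0, ← Real.log_mul (by norm_num) hpe0.ne']
    have hs0 : (0:ℝ) < N.sqrt := by
      have : w ≤ N.sqrt := Nat.le_sqrt'.2 hw2N
      exact_mod_cast (by omega : 0 < N.sqrt)
    refine Real.log_le_log (by positivity) ?_
    rw [div_le_iff₀ (by linarith)]
    calc (N.sqrt : ℝ) ≤ √N := Real.nat_sqrt_le_real_sqrt
      _ = 2 * pe * (v / 2) := by rw [hv]; field_simp
      _ ≤ _ := by gcongr
  have hB := two_prime_bound_le (Nat.le_sqrt'.2 hw2N) (by linarith) hN0.le hl0 hδ hη0.le hη2 hlp hlw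
    hlN hq
  calc _ ≤ _ := hcr
    _ ≤ δ / 2 * (N / Real.log p) + δ / 2 * (N / Real.log p) := add_le_add hA (hmid.trans hB)
    _ = _ := by ring
end exceptional

section ternary
variable {p : ℕ} [Fact p.Prime]

theorem sum_nonprincipal_le {N : ℕ} (hN : N < p) {S : Finset ℕ} (hS : S ⊆ Icc 1 N) {g : ℕ → ℂ}
    (hg : ∀ r ∈ Icc 1 N, ‖g r‖ ≤ 2) (k : ZMod p) {V₀ M K : ℝ} (hV₀ : 0 ≤ V₀) (hM0 : 0 ≤ M)
    (hK : ∀ V : Finset (DirichletCharacter ℂ p), (∀ χ ∈ V, V₀ ≤ ‖∑ q ∈ S, χ (q : ZMod p)‖) →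
      ∑ χ ∈ V, ‖∑ q ∈ S, χ (q : ZMod p)‖ ^ 2 ≤ K)
    (hM : ∀ χ : DirichletCharacter ℂ p, χ ≠ 1 → ‖∑ r ∈ Icc 1 N, g r * χ ((r : ZMod p) + k)‖ ≤ M) :
    ∑ χ : DirichletCharacter ℂ p with χ ≠ 1, ‖∑ q ∈ S, χ (q : ZMod p)‖ ^ 2 *
      ‖∑ r ∈ Icc 1 N, g r * χ ((r : ZMod p) + k)‖ ≤ V₀ * (5 * (p * N)) + M * K := by
  classical
  set A : DirichletCharacter ℂ p → ℝ := fun χ => ‖∑ q ∈ S, χ (q : ZMod p)‖ with hA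
  set B : DirichletCharacter ℂ p → ℝ := fun χ => ‖∑ r ∈ Icc 1 N, g r * χ ((r : ZMod p) + k)‖ with hB
  have hA0 : ∀ χ, 0 ≤ A χ := fun χ => norm_nonneg _
  have hB0 : ∀ χ, 0 ≤ B χ := fun χ => norm_nonneg _
  have hA2 : ∑ χ, A χ ^ 2 ≤ p * N := by
    have := sum_char_normSq_subset_le hN hS 0
    simpa only [add_zero] using this
  have hB2 : ∑ χ, B χ ^ 2 ≤ 4 * (p * N) := by
    refine (sum_char_normSq_shift_le hN (Subset.refl _) k g).trans ?_
    have : ∑ i ∈ Icc 1 N, ‖g i‖ ^ 2 ≤ ∑ i ∈ Icc 1 N, (4:ℝ) :=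
      sum_le_sum fun i hi => by nlinarith [hg i hi, norm_nonneg (g i)]
    rw [sum_const, Nat.card_Icc, Nat.add_sub_cancel, nsmul_eq_mul] at this
    have h := mul_le_mul_of_nonneg_left this (Nat.cast_nonneg (α := ℝ) p)
    linarith
  have hAB : ∑ χ, A χ * B χ ≤ 5 * (p * N) := by
    calc ∑ χ, A χ * B χ ≤ ∑ χ, (A χ ^ 2 + B χ ^ 2) :=
          sum_le_sum fun χ _ => by nlinarith [sq_nonneg (A χ - B χ), sq_nonneg (A χ + B χ)]
      _ ≤ _ := by rw [sum_add_distrib]; linarith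
  have hVK := hK (univ.filter fun χ => V₀ ≤ A χ) fun χ hχ => (mem_filter.1 hχ).2
  calc ∑ χ : DirichletCharacter ℂ p with χ ≠ 1, A χ ^ 2 * B χ
      ≤ ∑ χ : DirichletCharacter ℂ p with χ ≠ 1,
          (V₀ * (A χ * B χ) + if V₀ ≤ A χ then M * A χ ^ 2 else 0) := by
        refine sum_le_sum fun χ hχ => ?_
        have hne := (mem_filter.1 hχ).2
        have h0 := mul_nonneg (hA0 χ) (hB0 χ)
        split_ifs with h
        · have := mul_le_mul_of_nonneg_left (hM χ hne) (sq_nonneg (A χ))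
          have := mul_nonneg hV₀ h0
          linarith
        · have := mul_le_mul_of_nonneg_right (not_le.1 h).le h0
          linarith
    _ ≤ ∑ χ : DirichletCharacter ℂ p,
          (V₀ * (A χ * B χ) + if V₀ ≤ A χ then M * A χ ^ 2 else 0) := by
        refine sum_le_sum_of_subset_of_nonneg (filter_subset _ _) fun χ _ _ => ?_
        have := mul_nonneg hV₀ (mul_nonneg (hA0 χ) (hB0 χ))
        split_ifs
        · have := mul_nonneg hM0 (sq_nonneg (A χ))
          linarith
        · linarith
    _ ≤ _ := by
        rw [sum_add_distrib, ← mul_sum, ← sum_filter, ← mul_sum]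
        exact add_le_add (mul_le_mul_of_nonneg_left hAB hV₀) (mul_le_mul_of_nonneg_left hVK hM0)

theorem abs_sum_weighted_sub_le {N : ℕ} (hN : N < p) {S : Finset ℕ} (hS : S ⊆ Icc 1 N) {g : ℕ → ℤ}
    (hg : ∀ r ∈ Icc 1 N, |g r| ≤ 2) (k : ZMod p) {a : ZMod p} (ha : a ≠ 0) {V₀ M K : ℝ}
    (hV₀ : 0 ≤ V₀) (hM0 : 0 ≤ M)
    (hK : ∀ V : Finset (DirichletCharacter ℂ p), (∀ χ ∈ V, V₀ ≤ ‖∑ q ∈ S, χ (q : ZMod p)‖) →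
      ∑ χ ∈ V, ‖∑ q ∈ S, χ (q : ZMod p)‖ ^ 2 ≤ K)
    (hM : ∀ χ : DirichletCharacter ℂ p, χ ≠ 1 →
      ‖∑ r ∈ Icc 1 N, (g r : ℂ) * χ ((r : ZMod p) + k)‖ ≤ M) :
    |((p:ℝ) - 1) * (∑ x ∈ S, ∑ y ∈ S, ∑ r ∈ Icc 1 N,
        if (x : ZMod p) * (y : ZMod p) * ((r : ZMod p) + k) = a then (g r : ℝ) else 0) -
      (#S : ℝ) ^ 2 * ∑ r ∈ Icc 1 N with ((r:ℕ) : ZMod p) + k ≠ 0, (g r : ℝ)| ≤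
      V₀ * (5 * (p * N)) + M * K := by
  classical
  have h1 := sum_triple_eq_sum_char ha S S (Icc 1 N) (fun x => (x : ZMod p)) (fun x => (x : ZMod p))
    (fun r => (r : ZMod p) + k) (fun r => (g r : ℂ))
  rw [← add_sum_erase _ _ (mem_univ (1 : DirichletCharacter ℂ p)), sum_one_char_subset hN hS,
    sum_mul_one_char, MulChar.one_apply (isUnit_iff_ne_zero.2 ha), map_one, one_mul] at h1
  have h2 := sum_nonprincipal_le hN hS (g := fun r => (g r : ℂ)) (fun r hr => by
    rw [Complex.norm_intCast]; exact_mod_cast hg r hr) k hV₀ hM0 hK hM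
  rw [← Real.norm_eq_abs, ← Complex.norm_real]
  have h3 : (((((p:ℝ) - 1) * (∑ x ∈ S, ∑ y ∈ S, ∑ r ∈ Icc 1 N,
        if (x : ZMod p) * (y : ZMod p) * ((r : ZMod p) + k) = a then (g r : ℝ) else 0) -
      (#S : ℝ) ^ 2 * ∑ r ∈ Icc 1 N with ((r:ℕ) : ZMod p) + k ≠ 0, (g r : ℝ)) : ℝ) : ℂ) =
      ∑ χ ∈ univ.erase (1 : DirichletCharacter ℂ p), conj (χ a) *
        ((∑ x ∈ S, χ (x : ZMod p)) * (∑ y ∈ S, χ (y : ZMod p)) *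
          ∑ r ∈ Icc 1 N, (g r : ℂ) * χ ((r : ZMod p) + k)) := by
    push_cast [apply_ite Complex.ofReal]
    rw [h1]
    ring
  rw [h3]
  refine (norm_sum_le _ _).trans (le_trans ?_ h2)
  rw [filter_ne']
  refine sum_le_sum fun χ _ => ?_
  rw [norm_mul, norm_mul, norm_mul, ← sq]
  have h4 : ‖conj (χ a)‖ ≤ 1 := by rw [Complex.norm_conj]; exact norm_char_le_one χ a
  exact mul_le_of_le_one_left (by positivity) h4

/-- Replacing a weight by the indicator of the primes. -/
theorem abs_count_sub_weighted_le (S : Finset ℕ) (N : ℕ) {g : ℕ → ℤ}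
    (hg : ∀ r ∈ Icc 1 N, |g r - (if r.Prime then 1 else 0)| ≤ 1) (k a : ZMod p) :
    |(∑ x ∈ S, ∑ y ∈ S, ∑ r ∈ Icc 1 N,
        if (x : ZMod p) * (y : ZMod p) * ((r : ZMod p) + k) = a then
          (if r.Prime then (1:ℝ) else 0) else 0) -
      (∑ x ∈ S, ∑ y ∈ S, ∑ r ∈ Icc 1 N,
        if (x : ZMod p) * (y : ZMod p) * ((r : ZMod p) + k) = a then (g r : ℝ) else 0)| ≤
      ∑ n ∈ S, pairCount S ((Icc 1 N).filter fun r => g r ≠ if r.Prime then 1 else 0) k a n := by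
  simp only [← sum_sub_distrib]
  refine (abs_sum_le_sum_abs _ _).trans (sum_le_sum fun x _ => ?_)
  rw [pairCount]
  refine (abs_sum_le_sum_abs _ _).trans (sum_le_sum fun y _ => ?_)
  refine (abs_sum_le_sum_abs _ _).trans ?_
  rw [sum_filter]
  refine sum_le_sum fun r hr => ?_
  have h := hg r hr
  have h' : |((if r.Prime then (1:ℝ) else 0) - (g r : ℝ))| ≤ 1 := by
    rw [abs_sub_comm]; exact_mod_cast h
  by_cases h1 : (x : ZMod p) * (y : ZMod p) * ((r : ZMod p) + k) = a
  · rw [if_pos h1, if_pos h1, if_pos h1]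
    by_cases h2 : g r = if r.Prime then 1 else 0
    · rw [if_neg (not_not.2 h2), h2]; simp
    · rw [if_pos h2]; exact h'
  · rw [if_neg h1, if_neg h1, if_neg h1]; simp

theorem abs_sum_weight_sub_card_le {N : ℕ} (hN : N < p) {g : ℕ → ℤ}
    (hg : ∀ r ∈ Icc 1 N, |g r - (if r.Prime then 1 else 0)| ≤ 1) (k : ZMod p) :
    |(∑ r ∈ Icc 1 N with ((r:ℕ) : ZMod p) + k ≠ 0, (g r : ℝ)) - #((Icc 1 N).filter Nat.Prime)| ≤
      #((Icc 1 N).filter fun r => g r ≠ if r.Prime then 1 else 0) + 2 := by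
  have h1 : (∑ r ∈ Icc 1 N with ((r:ℕ) : ZMod p) + k ≠ 0, (g r : ℝ)) -
      #((Icc 1 N).filter Nat.Prime) =
      ∑ r ∈ Icc 1 N, ((if ((r:ℕ) : ZMod p) + k ≠ 0 then (g r : ℝ) else 0) -
        (if r.Prime then 1 else 0)) := by
    rw [sum_sub_distrib, sum_filter, ← sum_filter Nat.Prime, sum_const, nsmul_eq_mul, mul_one]
  rw [h1]
  refine (abs_sum_le_sum_abs _ _).trans ?_
  have h2 : ∀ r ∈ Icc 1 N, |(if ((r:ℕ) : ZMod p) + k ≠ 0 then (g r : ℝ) else 0) -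
        (if r.Prime then 1 else 0)| ≤ (if g r ≠ (if r.Prime then 1 else 0) then 1 else 0) +
        (if ((r:ℕ) : ZMod p) + k = 0 then 1 else 0) := by
    intro r hr
    have h' : |(g r : ℝ) - (if r.Prime then (1:ℝ) else 0)| ≤ 1 := by exact_mod_cast hg r hr
    by_cases hk : ((r:ℕ) : ZMod p) + k = 0
    · rw [if_neg (not_not.2 hk), if_pos hk]
      have : |0 - (if r.Prime then (1:ℝ) else 0)| ≤ 1 := by split_ifs <;> simp
      have h0 : (0:ℝ) ≤ if g r ≠ (if r.Prime then 1 else 0) then 1 else 0 := by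
        split_ifs <;> norm_num
      linarith
    · rw [if_pos hk, if_neg hk, add_zero]
      by_cases h2 : g r = if r.Prime then 1 else 0
      · rw [if_neg (not_not.2 h2), h2]; simp
      · rw [if_pos h2]; exact h'
  refine (sum_le_sum h2).trans ?_
  rw [sum_add_distrib, ← sum_filter, ← sum_filter, sum_const, sum_const, nsmul_eq_mul,
    nsmul_eq_mul, mul_one, mul_one]
  have h3 : #((Icc 1 N).filter fun r => ((r:ℕ) : ZMod p) + k = 0) ≤ 1 := by
    refine card_le_one.2 fun r hr s hs => ?_
    rw [mem_filter, mem_Icc] at hr hs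
    have h : (r : ZMod p) = s := by
      rw [eq_neg_of_add_eq_zero_left hr.2, eq_neg_of_add_eq_zero_left hs.2]
    exact natCast_inj_of_lt (p := p) (by omega) (by omega) h
  have : (#((Icc 1 N).filter fun r => ((r:ℕ) : ZMod p) + k = 0) : ℝ) ≤ 1 := by exact_mod_cast h3
  linarith

theorem card_filter_triple_eq_sum (N : ℕ) (k lam : ℤ) :
    (((Icc 1 N ×ˢ Icc 1 N ×ˢ Icc 1 N).filter
      (fun t => t.1.Prime ∧ t.2.1.Prime ∧ t.2.2.Prime ∧
        (((t.1 : ℤ) * (t.2.1 : ℤ) * ((t.2.2 : ℤ) + k) : ℤ) : ZMod p) =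
          ((lam : ℤ) : ZMod p))).card : ℝ) =
    ∑ x ∈ (Icc 1 N).filter Nat.Prime, ∑ y ∈ (Icc 1 N).filter Nat.Prime, ∑ r ∈ Icc 1 N,
      if (x : ZMod p) * (y : ZMod p) * ((r : ZMod p) + (k : ZMod p)) = (lam : ZMod p) then
        (if r.Prime then (1:ℝ) else 0) else 0 := by
  rw [card_eq_sum_ones, Nat.cast_sum, sum_filter, sum_product]
  rw [sum_filter]
  refine sum_congr rfl fun x _ => ?_
  rw [sum_product]
  dsimp only
  by_cases hx : x.Prime
  · rw [if_pos hx, sum_filter]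
    refine sum_congr rfl fun y _ => ?_
    by_cases hy : y.Prime
    · rw [if_pos hy]
      refine sum_congr rfl fun r _ => ?_
      push_cast
      by_cases hr : r.Prime <;> simp [hx, hy, hr]
    · rw [if_neg hy]; simp [hy]
  · rw [if_neg hx]; simp [hx]

theorem card_filter_prime_Icc (N : ℕ) : #((Icc 1 N).filter Nat.Prime) = N.primeCounting := by
  rw [Nat.primeCounting, Nat.primeCounting', Nat.count_eq_card_filter_range]
  congr 1
  ext m
  simp only [mem_filter, mem_Icc, mem_range]
  constructor
  · rintro ⟨h, h'⟩; exact ⟨by omega, h'⟩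
  · rintro ⟨h, h'⟩; exact ⟨⟨h'.one_le, by omega⟩, h'⟩
end ternary

section assembly

theorem abs_sub_cube_div_le {T Tg G P R N p L m e₁ e₂ c : ℝ} (hc : 0 < c) (hp2 : 2 ≤ p)
    (hpc : 40 / c ≤ p) (hP : 40 / c ≤ P) (hN : 0 ≤ N) (hL : 0 < L) (hR0 : 0 ≤ R)
    (hR : R ≤ c / 5000 * (N / L)) (hNP : N / L ≤ 2 * P) (hm : m = e₁ / p) (he₁ : 0 ≤ e₁)
    (he₂ : 0 ≤ e₂) (h8 : 8 * L ^ 3 * e₁ ≤ c / 100) (h8' : 8 * L ^ 3 * e₂ ≤ c / 5120)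
    (hT : |T - Tg| ≤ 400 * (N / L) * (P * R / p) + N ^ 3 * m)
    (hTg : |(p - 1) * Tg - P ^ 2 * G| ≤ N ^ 2 * m * (5 * (p * N)) + N * e₂ * (256 * N ^ 2))
    (hG : |G - P| ≤ R + 2) :
    |T - P ^ 3 / p| ≤ c * P ^ 3 / p := by
  have hp0 : 0 < p := by linarith
  have hP0 : 0 < P := lt_of_lt_of_le (by positivity) hP
  have hRP : R ≤ c / 2500 * P := by
    refine hR.trans ?_
    have := mul_le_mul_of_nonneg_left hNP (by positivity : 0 ≤ c / 5000)
    linarith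
  have hN2 : N ≤ 2 * P * L := by rwa [div_le_iff₀ hL] at hNP
  have hN3 : N ^ 3 ≤ 8 * L ^ 3 * P ^ 3 := by
    refine (pow_le_pow_left₀ hN hN2 3).trans (le_of_eq (by ring))
  have hE1 : N ^ 3 * e₁ ≤ c / 100 * P ^ 3 := by
    calc N ^ 3 * e₁ ≤ 8 * L ^ 3 * P ^ 3 * e₁ := mul_le_mul_of_nonneg_right hN3 he₁
      _ = 8 * L ^ 3 * e₁ * P ^ 3 := by ring
      _ ≤ _ := mul_le_mul_of_nonneg_right h8 (by positivity)
  have hE2 : N ^ 3 * e₂ ≤ c / 5120 * P ^ 3 := by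
    calc N ^ 3 * e₂ ≤ 8 * L ^ 3 * P ^ 3 * e₂ := mul_le_mul_of_nonneg_right hN3 he₂
      _ = 8 * L ^ 3 * e₂ * P ^ 3 := by ring
      _ ≤ _ := mul_le_mul_of_nonneg_right h8' (by positivity)
  have hP4 : 4 * P ^ 2 ≤ c / 10 * P ^ 3 := by
    rw [div_le_iff₀ hc] at hP
    nlinarith [sq_nonneg P]
  have hpP : P ^ 3 ≤ c / 40 * P ^ 3 * p := by
    rw [div_le_iff₀ hc] at hpc
    nlinarith [pow_pos hP0 3]
  have t1 : p * |T - Tg| ≤ c * 0.33 * P ^ 3 := by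
    have h1 : (N / L) * (P * R) ≤ 2 * P * (P * (c / 2500 * P)) :=
      mul_le_mul hNP (mul_le_mul_of_nonneg_left hRP hP0.le) (by positivity) (by positivity)
    calc p * |T - Tg| ≤ p * (400 * (N / L) * (P * R / p) + N ^ 3 * m) :=
          mul_le_mul_of_nonneg_left hT hp0.le
      _ = 400 * ((N / L) * (P * R)) + N ^ 3 * e₁ := by rw [hm]; field_simp
      _ ≤ _ := by nlinarith
  have t2 : |(p - 1) * Tg - P ^ 2 * G| ≤ c / 10 * P ^ 3 := by
    have : N ^ 2 * m * (5 * (p * N)) + N * e₂ * (256 * N ^ 2) =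
        5 * (N ^ 3 * e₁) + 256 * (N ^ 3 * e₂) := by rw [hm]; field_simp
    rw [this] at hTg
    linarith
  have t3 : |P ^ 2 * G - P ^ 3| ≤ c * 0.051 * P ^ 3 := by
    have : P ^ 2 * G - P ^ 3 = P ^ 2 * (G - P) := by ring
    rw [this, abs_mul, abs_of_nonneg (sq_nonneg P)]
    have h1 := mul_le_mul_of_nonneg_left hG (sq_nonneg P)
    have h2 := mul_le_mul_of_nonneg_left hRP (sq_nonneg P)
    nlinarith
  have t4 : |(p - 1) * Tg - P ^ 3 / p * (p - 1)| ≤ c * 0.176 * P ^ 3 := by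
    have e : (p - 1) * Tg - P ^ 3 / p * (p - 1) =
      ((p - 1) * Tg - P ^ 2 * G) + ((P ^ 2 * G - P ^ 3) + P ^ 3 / p) := by field_simp; ring
    have h1 : |P ^ 3 / p| ≤ c / 40 * P ^ 3 := by
      rw [abs_of_nonneg (by positivity), div_le_iff₀ hp0]; exact hpP
    rw [e]
    have := abs_add_le ((p - 1) * Tg - P ^ 2 * G) ((P ^ 2 * G - P ^ 3) + P ^ 3 / p)
    have := abs_add_le (P ^ 2 * G - P ^ 3) (P ^ 3 / p)
    linarith
  have t5 : p * |Tg - P ^ 3 / p| ≤ c * 0.352 * P ^ 3 := by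
    have e : (p - 1) * Tg - P ^ 3 / p * (p - 1) = (p - 1) * (Tg - P ^ 3 / p) := by ring
    rw [e, abs_mul, abs_of_nonneg (by linarith : 0 ≤ p - 1)] at t4
    nlinarith [abs_nonneg (Tg - P ^ 3 / p)]
  rw [le_div_iff₀ hp0]
  have := abs_add_le (T - Tg) (Tg - P ^ 3 / p)
  rw [sub_add_sub_cancel] at this
  have h0 : 0 < c * P ^ 3 := by positivity
  nlinarith [mul_le_mul_of_nonneg_left this hp0.le]

theorem exists_log_cube_mul_le {C ε : ℝ} (hε : 0 < ε) : ∃ P : ℕ, ∀ p : ℕ, P ≤ p → 1 ≤ p →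
    C * Real.log p ^ 3 * (p:ℝ) ^ (-ε) ≤ 1 := by
  obtain ⟨P, hP⟩ := exists_log_pow_le_rpow |C| 3 hε
  refine ⟨P, fun p hp hp1 => ?_⟩
  have hp0 : (0:ℝ) < p := by exact_mod_cast hp1
  have hl : 0 ≤ Real.log p := Real.log_nonneg (by exact_mod_cast hp1)
  have h1 : C * Real.log p ^ 3 ≤ (p:ℝ) ^ ε := by
    refine le_trans ?_ (hP p hp)
    refine mul_le_mul (le_abs_self C) (pow_le_pow_left₀ hl (by linarith) 3) (by positivity)
      (abs_nonneg C)
  rw [Real.rpow_neg hp0.le, ← div_eq_mul_inv, div_le_one (Real.rpow_pos_of_pos hp0 _)]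
  exact h1

theorem exists_primeCounting_ge (K : ℝ) : ∃ P : ℕ, ∀ p : ℕ, P ≤ p → 2 ≤ p → ∀ N : ℕ, N < p →
    (p:ℝ) ^ ((63:ℝ)/76) < N →
    N / Real.log p ≤ 2 * N.primeCounting ∧ K ≤ N.primeCounting := by
  obtain ⟨P1, hP1⟩ := exists_log_pow_le_rpow (2 * |K|) 1 (ε := (63:ℝ)/76) (by norm_num)
  obtain ⟨P2, hP2⟩ := exists_log_pow_le_rpow 300 0 (ε := (63:ℝ)/76) (by norm_num)
  refine ⟨max P1 P2, fun p hp hp2 N hNp hN => ?_⟩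
  have hp0 : (0:ℝ) < p := by exact_mod_cast (by omega : 0 < p)
  have hl : 0 < Real.log p := Real.log_pos (by exact_mod_cast (by omega : 1 < p))
  have h1 := hP1 p ((le_max_left _ _).trans hp)
  have h2 := hP2 p ((le_max_right _ _).trans hp)
  rw [pow_one] at h1
  rw [pow_zero, mul_one] at h2
  have hN300 : 300 ≤ N := by exact_mod_cast h2.trans hN.le
  have hN0 : (0:ℝ) < N := by exact_mod_cast (by omega : 0 < N)
  have hlN : 0 < Real.log N := Real.log_pos (by exact_mod_cast (by omega : 1 < N))
  have hlNp : Real.log N ≤ Real.log p := Real.log_le_log hN0 (by exact_mod_cast hNp.le)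
  have h3 := half_div_log_le_primeCounting hN300
  have h4 : N / Real.log p ≤ 2 * N.primeCounting := by
    have : (N:ℝ) / (2 * Real.log p) ≤ N / (2 * Real.log N) := by gcongr
    have e : (N:ℝ) / Real.log p = 2 * (N / (2 * Real.log p)) := by field_simp
    linarith
  refine ⟨h4, ?_⟩
  have h5 : 2 * |K| * Real.log p ≤ N := by
    have : 0 ≤ |K| := abs_nonneg K
    nlinarith
  have h6 : 2 * |K| ≤ N / Real.log p := by rwa [le_div_iff₀ hl]
  linarith [le_abs_self K]

end assembly

end

/-- For a fixed nonzero integer k and fixed ε > 0, if p is a large prime,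
p > N > p^(63/76+ε), and λ is coprime to p, then the congruence
p₁p₂(p₃+k) ≡ λ (mod p) has (1+o(1))·π(N)³/p solutions in primes p₁,p₂,p₃ ≤ N. -/
theorem stmt6 :
    ∀ k : ℤ, k ≠ 0 → ∀ ε : ℝ, 0 < ε → ∀ c : ℝ, 0 < c → ∃ P : ℕ,
      ∀ p : ℕ, p.Prime → P ≤ p → ∀ N : ℕ, ∀ lam : ℤ, IsCoprime lam (p : ℤ) →
      N < p → (p : ℝ) ^ ((63 : ℝ)/76 + ε) < (N : ℝ) →
      |(((Finset.Icc 1 N ×ˢ Finset.Icc 1 N ×ˢ Finset.Icc 1 N).filter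
            (fun t => t.1.Prime ∧ t.2.1.Prime ∧ t.2.2.Prime ∧
              (((t.1 : ℤ) * (t.2.1 : ℤ) * ((t.2.2 : ℤ) + k) : ℤ) : ZMod p)
                = ((lam : ℤ) : ZMod p))).card : ℝ)
          - (N.primeCounting : ℝ) ^ 3 / (p : ℝ)|
        ≤ c * (N.primeCounting : ℝ) ^ 3 / (p : ℝ) := by
  intro k hk ε hε c hc
  obtain ⟨η, hη0, hη1, P1, hP1⟩ := exists_card_sieveExceptions_le (δ := c / 5000) (by positivity)
  obtain ⟨P2, hP2⟩ := exists_norm_sum_sieveWeight_char_le hk hη0 hη1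
  obtain ⟨P3, hP3⟩ := exists_sum_large_normSq_le
  obtain ⟨P4, hP4⟩ := exists_sum_prime_pairCount_le
  obtain ⟨P5, hP5⟩ := exists_log_cube_mul_le (C := 800 / c) (ε := 1/1000) (by norm_num)
  obtain ⟨P6, hP6⟩ := exists_log_cube_mul_le (C := 40960 / c) (ε := η/400) (by positivity)
  obtain ⟨P7, hP7⟩ := exists_primeCounting_ge (40 / c)
  refine ⟨P1 + P2 + P3 + P4 + P5 + P6 + P7 + ⌈40 / c⌉₊, fun p hp hPp N lam hlam hNp hNε => ?_⟩
  have : Fact p.Prime := ⟨hp⟩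
  have hp1 : (1:ℝ) ≤ p := by exact_mod_cast hp.one_le
  have hp2 : (2:ℝ) ≤ p := by exact_mod_cast hp.two_le
  have hp0 : (0:ℝ) < p := by linarith
  have hN : (p:ℝ) ^ ((63:ℝ)/76) < N :=
    (Real.rpow_le_rpow_of_exponent_le hp1 (by linarith)).trans_lt hNε
  have hl0 : 0 < Real.log p := Real.log_pos (by linarith)
  obtain ⟨y, w, hy1, hy2, hw0, hwN, hyw, hcard⟩ := hP1 p (by omega) N hNp hN
  have ha : ((lam : ℤ) : ZMod p) ≠ 0 := by
    intro h
    rw [ZMod.intCast_zmod_eq_zero_iff_dvd] at h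
    exact (Nat.prime_iff_prime_int.1 hp).not_isUnit (hlam.symm.isUnit_of_dvd h)
  have hg : ∀ r ∈ Finset.Icc 1 N, |sieveWeight y w r - (if r.Prime then 1 else 0)| ≤ 1 := by
    intro r hr
    rw [Finset.mem_Icc] at hr
    exact (sieveWeight_sub_prime (by omega) (by omega) hyw).1
  have hg2 : ∀ r ∈ Finset.Icc 1 N, |sieveWeight y w r| ≤ 2 := by
    intro r hr
    have := hg r hr
    rw [abs_le] at this ⊢
    split_ifs at this <;> omega
  have hS : (Finset.Icc 1 N).filter Nat.Prime ⊆ Finset.Icc 1 N := Finset.filter_subset _ _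
  rw [card_filter_triple_eq_sum, ← card_filter_prime_Icc]
  have hpi := hP7 p (by omega) hp.two_le N hNp hN
  rw [← card_filter_prime_Icc] at hpi
  have hcount := hP4 p (by omega) N hNp hN _ hS (sieveExceptions y w N) (Finset.filter_subset _ _)
    (k : ZMod p) _ ha
  have hM := fun χ hχ => hP2 p (by omega) N hNp hN χ hχ y w hy1 hy2 hw0 hwN
  have hT := (abs_count_sub_weighted_le ((Finset.Icc 1 N).filter Nat.Prime) N hg (k : ZMod p)
    (lam : ZMod p)).trans hcount
  have hTg := abs_sum_weighted_sub_le hNp hS hg2 (k : ZMod p) ha (by positivity) (by positivity)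
    (hP3 p (by omega) N hNp hN _ hS) hM
  have hG := abs_sum_weight_sub_card_le hNp hg (k : ZMod p)
  have h5 := hP5 p (by omega) hp.one_le
  have h6 := hP6 p (by omega) hp.one_le
  have hpc : 40 / c ≤ p := (Nat.le_ceil _).trans (by exact_mod_cast (by omega : ⌈40 / c⌉₊ ≤ p))
  refine abs_sub_cube_div_le (e₁ := (p:ℝ) ^ (-(1/1000) : ℝ)) (e₂ := (p:ℝ) ^ (-(η/400)))
    hc hp2 hpc hpi.2 (Nat.cast_nonneg N) hl0 (Nat.cast_nonneg _) hcard hpi.1 ?_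
    (by positivity) (by positivity) ?_ ?_ hT hTg hG
  · rw [eq_div_iff hp0.ne', ← Real.rpow_add_one hp0.ne']; norm_num
  · have e : 8 * Real.log p ^ 3 * (p:ℝ) ^ (-(1/1000) : ℝ) =
      c / 100 * (800 / c * Real.log p ^ 3 * (p:ℝ) ^ (-(1/1000) : ℝ)) := by field_simp; ring
    rw [e]
    exact mul_le_of_le_one_right (by positivity) h5
  · have e : 8 * Real.log p ^ 3 * (p:ℝ) ^ (-(η/400)) =
      c / 5120 * (40960 / c * Real.log p ^ 3 * (p:ℝ) ^ (-(η/400))) := by field_simp; ring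
    rw [e]
    exact mul_le_of_le_one_right (by positivity) h6
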